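/- arXiv:1407.2844 — 5 statements merged into one kernel-verified Lean document; each statement's English description precedes it below -/
import Mathlib

section
/- Let G be a 2-vertex-connected simple graph on n vertices and let T be a spanning tree of G such that for every pair of distinct, non-adjacent vertices u and v that both have odd degree in T, the sum of their degrees in G is at least n. Then G has a TSP tour of length at most 4n/3. -/
namespace TSPAux

open Classical in
theorem walk_parity {V : Type*} {G : SimpleGraph V} {u v : V} (p : G.Walk u v) (x : V) :
    ((p.edges.countP (fun e => decide (x ∈ e)) : ℕ) : ZMod 2) =
      (if x = u then 1 else 0) + (if x = v then 1 else 0) := by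
  induction p with
  | nil =>
    have : (1 : ZMod 2) + 1 = 0 := by decide
    simp only [SimpleGraph.Walk.edges_nil, List.countP_nil]
    split_ifs <;> simp [this]
  | @cons a b c h p ih =>
    have : (1 : ZMod 2) + 1 = 0 := by decide
    have hab := h.ne
    rw [SimpleGraph.Walk.edges_cons, List.countP_cons]
    push_cast
    rw [ih]
    by_cases h1 : x = a
    · subst h1
      simp [hab]; ring
    · by_cases h2 : x = b
      · subst h2
        simp only [Sym2.mem_iff, if_true, h1, if_false, or_true, decide_true]
        linear_combination this
      · simp [h1, h2]

open Classical in
theorem euler {V : Type*} [Nonempty V] {G : SimpleGraph V} (M : Multiset (Sym2 V))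
    (hM : ∀ e ∈ M, e ∈ G.edgeSet) (hev : ∀ x, ((M.countP (fun e => x ∈ e) : ℕ) : ZMod 2) = 0) :
    ∃ (r : V) (w : G.Walk r r), (w.edges : Multiset (Sym2 V)) ≤ M ∧
      ∀ x ∈ w.support, ∀ y, s(x, y) ∈ M → y ∈ w.support := by
  let P : ℕ → Prop := fun k => ∃ (a b : V) (w : G.Walk a b), (w.edges : Multiset (Sym2 V)) ≤ M ∧
    w.length = k
  have hP0 : P 0 := ⟨Classical.arbitrary V, _, .nil, by simp, rfl⟩
  have hbd : ∀ k, P k → k ≤ M.card := by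
    rintro k ⟨a, b, w, hw, rfl⟩
    simpa using Multiset.card_le_card hw
  have hk := Nat.findGreatest_spec (P := P) (Nat.zero_le M.card) hP0
  have hmax : ∀ j, P j → j ≤ Nat.findGreatest P M.card := fun j hj =>
    Nat.le_findGreatest (hbd j hj) hj
  generalize Nat.findGreatest P M.card = k at hk hmax
  obtain ⟨a, b, w, hw, rfl⟩ := hk
  -- extension
  have hext : ∀ (a b : V) (w' : G.Walk a b), (w'.edges : Multiset (Sym2 V)) ≤ M →
      w'.length = w.length → ∀ e ∈ M - (w'.edges : Multiset (Sym2 V)), b ∉ e := by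
    intro a b w' hw' hl e he hbe
    obtain ⟨c, rfl⟩ := hbe
    have hadj : G.Adj b c := hM _ (Multiset.mem_of_le (Multiset.sub_le_self _ _) he)
    have := hmax (w'.length + 1) ⟨a, c, w'.concat hadj, ?_, by simp⟩
    · omega
    · rw [SimpleGraph.Walk.edges_concat, List.concat_eq_append, ← Multiset.coe_add,
        ← add_tsub_cancel_of_le hw']
      gcongr
      simpa using he
  have hab : a = b := by
    by_contra hne
    have h1 := walk_parity w b
    have h2 : (M - (w.edges : Multiset (Sym2 V))).countP (fun e => b ∈ e) = 0 :=
      Multiset.countP_eq_zero.2 (hext a b w hw rfl)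
    have h3 := hev b
    rw [← add_tsub_cancel_of_le hw, Multiset.countP_add, h2, Multiset.coe_countP, add_zero, h1] at h3
    simp [Ne.symm hne] at h3
  subst hab
  refine ⟨a, w, hw, fun x hx y hxy => ?_⟩
  have hperm : ((w.rotate x hx).edges : Multiset (Sym2 V)) = w.edges :=
    Multiset.coe_eq_coe.2 (w.rotate_edges x hx).perm
  have h := hext x x (w.rotate x hx) (by rw [hperm]; exact hw) (by simp)
  by_cases hmem : s(x, y) ∈ w.edges
  · exact w.snd_mem_support_of_mem_edges hmem
  · exfalso
    apply h s(x, y) _ (by simp)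
    rw [hperm]
    rw [← Multiset.count_pos, Multiset.count_sub]
    have : Multiset.count s(x,y) (w.edges : Multiset (Sym2 V)) = 0 :=
      Multiset.count_eq_zero.2 (by simpa using hmem)
    rw [this]
    simpa using Multiset.count_pos.2 hxy

open Classical in
theorem join {V : Type*} [Fintype V] {G : SimpleGraph V} {u v : V} (p : G.Walk u v)
    (χ : V → ZMod 2) (hχ : ∀ x, χ x ≠ 0 → x ∈ p.support) (hs : ∑ x, χ x = 0) :
    ∃ J : Multiset (Sym2 V), J ≤ (p.edges : Multiset (Sym2 V)) ∧
      ∀ x, ((J.countP (fun e => x ∈ e) : ℕ) : ZMod 2) = χ x := by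
  induction p generalizing χ with
  | @nil a =>
    refine ⟨0, by simp, fun x => ?_⟩
    have h0 : ∀ x, x ≠ a → χ x = 0 := fun x hx => by
      by_contra h; exact hx (by simpa using hχ x h)
    rw [Finset.sum_eq_single a (fun x _ hx => h0 x hx) (by simp)] at hs
    by_cases hx : x = a
    · subst hx; simp [hs]
    · simp [h0 x hx]
  | @cons a b c h p ih =>
    by_cases ha : ∀ x, χ x ≠ 0 → x ∈ p.support
    · obtain ⟨J, hJ, hc⟩ := ih χ ha hs
      refine ⟨J, hJ.trans ?_, hc⟩
      rw [SimpleGraph.Walk.edges_cons, ← Multiset.cons_coe]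
      exact Multiset.le_cons_self _ _
    · push Not at ha
      obtain ⟨x, hx0, hxp⟩ := ha
      have hxa : x = a := by
        have := hχ x hx0
        simp only [SimpleGraph.Walk.support_cons, List.mem_cons] at this
        tauto
      subst hxa
      have hab := h.ne
      have h1 : χ x = 1 := by
        generalize χ x = t at hx0
        revert t; decide
      have h2 : (1 : ZMod 2) + 1 = 0 := by decide
      obtain ⟨J, hJ, hc⟩ := ih (fun y => χ y + ((if y = x then 1 else 0) + (if y = b then 1 else 0))) (by
        intro y hy
        by_cases hyx : y = x
        · subst hyx; simp [h1, hab, h2] at hy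
        · by_cases hyb : y = b
          · subst hyb; simp
          · simp [hyx, hyb] at hy
            have := hχ y hy
            simp only [SimpleGraph.Walk.support_cons, List.mem_cons] at this
            tauto) (by
        simp [Finset.sum_add_distrib, hs, h2])
      refine ⟨s(x, b) ::ₘ J, ?_, fun y => ?_⟩
      · rw [SimpleGraph.Walk.edges_cons, ← Multiset.cons_coe]
        exact Multiset.cons_le_cons _ hJ
      · rw [Multiset.countP_cons]
        push_cast
        rw [hc]
        by_cases hyx : y = x
        · subst hyx; simp [hab]; linear_combination h2
        · by_cases hyb : y = b
          · subst hyb; simp [hyx]; linear_combination h2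
          · simp [hyx, hyb]

open Classical in
theorem extend {V : Type*} [Fintype V] {G : SimpleGraph V} (hG : G.Connected) (c : ℕ) :
    ∀ (k : ℕ) (r : V) (w : G.Walk r r), Fintype.card V - w.support.toFinset.card = k →
      w.length + c ≤ 2 * w.support.toFinset.card →
      ∃ (r : V) (w : G.Walk r r), (∀ x, x ∈ w.support) ∧ w.length + c ≤ 2 * Fintype.card V := by
  intro k
  induction k with
  | zero =>
    intro r w hk hl
    have h1 : w.support.toFinset.card ≤ Fintype.card V := Finset.card_le_univ _
    have h2 : w.support.toFinset = Finset.univ := Finset.eq_univ_of_card _ (by omega)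
    refine ⟨r, w, fun x => ?_, by omega⟩
    rw [← List.mem_toFinset, h2]; simp
  | succ k ih =>
    intro r w hk hl
    have : ∃ y, y ∉ w.support := by
      by_contra! hall
      have h2 : w.support.toFinset = Finset.univ := by ext; simp [hall]
      rw [h2, Finset.card_univ] at hk
      omega
    obtain ⟨y, hy⟩ := this
    obtain ⟨q⟩ := hG.preconnected r y
    obtain ⟨d, -, hd1, hd2⟩ := q.exists_boundary_dart {x | x ∈ w.support} (by simp) hy
    obtain ⟨⟨x, z⟩, hadj⟩ := d
    simp only [Set.mem_ofPred_eq] at hd1 hd2 hadj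
    have hsup : (SimpleGraph.Walk.cons hadj.symm (w.rotate x hd1)).support.toFinset =
        insert z w.support.toFinset := by
      ext t; simp
    have hsup' : ((SimpleGraph.Walk.cons hadj.symm (w.rotate x hd1)).concat hadj).support.toFinset =
        insert z w.support.toFinset := by
      ext t
      simp [SimpleGraph.Walk.support_concat]
    have hcard : (insert z w.support.toFinset).card = w.support.toFinset.card + 1 :=
      Finset.card_insert_of_notMem (by simpa using hd2)
    refine ih z ((SimpleGraph.Walk.cons hadj.symm (w.rotate x hd1)).concat hadj) ?_ ?_
    · rw [hsup', hcard]; omega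
    · rw [hsup', hcard]; simp; omega

open Classical in
theorem final {V : Type*} [Fintype V] (G T : SimpleGraph V) (hTG : T ≤ G) (hT : T.IsTree)
    (r : V) (w : G.Walk r r) (hw : w.length ≤ w.support.toFinset.card)
    (hX : ∀ x, Odd (T.degree x) → x ∈ w.support) :
    ∃ (r : V) (w : G.Walk r r), (∀ x : V, x ∈ w.support) ∧
      3 * w.length ≤ 4 * Fintype.card V := by
  have : Nonempty V := ⟨r⟩
  have hGc : G.Connected := hT.connected.mono hTG
  by_cases hc : 2 * Fintype.card V ≤ 3 * w.length
  · obtain ⟨r', w', h1, h2⟩ := extend hGc w.length _ r w rfl (by omega)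
    exact ⟨r', w', h1, by omega⟩
  · have hpar : ∀ x, ((T.degree x : ℕ) : ZMod 2) ≠ 0 → x ∈ w.support := by
      intro x hx
      apply hX
      rw [← Nat.not_even_iff_odd, ← ZMod.natCast_eq_zero_iff_even]
      exact hx
    have hsum : ∑ x, ((T.degree x : ℕ) : ZMod 2) = 0 := by
      rw [← Nat.cast_sum, T.sum_degrees_eq_twice_card_edges]
      push_cast
      rw [show (2 : ZMod 2) = 0 from by decide, zero_mul]
    have key : ∃ J : Multiset (Sym2 V), J ≤ (w.edges : Multiset (Sym2 V)) ∧
        (∀ x, ((J.countP (fun e => x ∈ e) : ℕ) : ZMod 2) = (T.degree x : ℕ)) ∧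
        2 * J.card ≤ w.length := by
      obtain ⟨J, hJ, hc⟩ := join w (fun x => ((T.degree x : ℕ) : ZMod 2)) hpar hsum
      have hcard : J.card + (↑w.edges - J).card = w.length := by
        rw [← Multiset.card_add, add_tsub_cancel_of_le hJ]; simp
      by_cases h : 2 * J.card ≤ w.length
      · exact ⟨J, hJ, hc, h⟩
      · refine ⟨w.edges - J, Multiset.sub_le_self _ _, fun x => ?_, by omega⟩
        have h1 := walk_parity w x
        have h2 : (1 : ZMod 2) + 1 = 0 := by decide
        rw [← Multiset.coe_countP, ← add_tsub_cancel_of_le hJ, Multiset.countP_add] at h1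
        push_cast at h1
        rw [hc] at h1
        have h3 : ((if x = r then 1 else 0) + (if x = r then 1 else 0) : ZMod 2) = 0 := by
          split_ifs <;> simp [h2]
        rw [h3] at h1
        linear_combination h1 - ((T.degree x : ℕ) : ZMod 2) * h2
    obtain ⟨J, hJ, hJc, hJl⟩ := key
    obtain ⟨s, z, hz, hcl⟩ := euler (G := G) (T.edgeFinset.val + J) (by
      intro e he
      rcases Multiset.mem_add.1 he with he | he
      · have : e ∈ T.edgeSet := by simpa using he
        exact SimpleGraph.edgeSet_mono hTG this
      · exact w.edges_subset_edgeSet (by simpa using Multiset.mem_of_le hJ he)) (by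
      intro x
      have h2 : (1 : ZMod 2) + 1 = 0 := by decide
      have : T.edgeFinset.val.countP (fun e => x ∈ e) = T.degree x := by
        rw [Multiset.countP_eq_card_filter, ← T.card_incidenceFinset_eq_degree,
          T.incidenceFinset_eq_filter]
        rfl
      rw [Multiset.countP_add, this]
      push_cast
      rw [hJc]
      linear_combination ((T.degree x : ℕ) : ZMod 2) * h2)
    refine ⟨s, z, fun x => ?_, ?_⟩
    · by_contra hx
      obtain ⟨q⟩ := hT.connected.preconnected s x
      obtain ⟨⟨⟨a, b⟩, hadj⟩, -, hd1, hd2⟩ := q.exists_boundary_dart {x | x ∈ z.support} (by simp) hx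
      exact hd2 (hcl a hd1 b (by simpa using Or.inl hadj))
    · have h1 := Multiset.card_le_card hz
      have h2 := hT.card_edgeFinset
      simp only [Multiset.coe_card, SimpleGraph.Walk.length_edges, Multiset.card_add,
        Finset.card_val] at h1
      omega

def Cyc {V : Type*} (H : SimpleGraph V) (l : List V) : Prop :=
  l.Nodup ∧ l.IsChain H.Adj ∧ ∃ hne : l ≠ [], H.Adj (l.getLast hne) (l.head hne)

theorem cyc_walk {V : Type*} [DecidableEq V] {G : SimpleGraph V} {l : List V} (h : Cyc G l) :
    ∃ (r : V) (w : G.Walk r r), w.length ≤ w.support.toFinset.card ∧ ∀ x ∈ l, x ∈ w.support := by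
  obtain ⟨hn, hch, hne, hadj⟩ := h
  have hlen : (SimpleGraph.Walk.ofSupport l hne hch).length + 1 = l.length := by
    rw [← SimpleGraph.Walk.length_support, SimpleGraph.Walk.support_ofSupport]
  refine ⟨_, (SimpleGraph.Walk.ofSupport l hne hch).concat hadj, ?_, fun x hx => ?_⟩
  · rw [SimpleGraph.Walk.length_concat, hlen, ← List.toFinset_card_of_nodup hn]
    apply Finset.card_le_card
    intro x hx
    simp only [List.mem_toFinset] at hx ⊢
    simp [SimpleGraph.Walk.support_concat, hx]
  · simp [SimpleGraph.Walk.support_concat, hx]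

open Classical in
theorem ore {V : Type*} [Fintype V] (H : SimpleGraph V) (l : List V) (hn : l.Nodup)
    (hch : l.IsChain H.Adj) (hne : l ≠ [])
    (hd : Fintype.card V ≤ H.degree (l.head hne) + H.degree (l.getLast hne)) :
    ∃ l', Cyc H l' ∧ ∀ x ∈ l, x ∈ l' := by
  by_cases hout : ∃ x, x ∉ l ∧ H.Adj (l.head hne) x ∧ H.Adj (l.getLast hne) x
  · obtain ⟨x, hx, h1, h2⟩ := hout
    refine ⟨l ++ [x], ⟨?_, ?_, by simp, ?_⟩, fun y hy => by simp [hy]⟩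
    · simp only [List.nodup_append, hn, List.nodup_singleton, true_and, List.mem_singleton]
      rintro a ha b rfl rfl
      exact hx ha
    · rw [List.isChain_append]
      refine ⟨hch, by simp, fun a ha b hb => ?_⟩
      rw [List.getLast?_eq_some_getLast hne] at ha
      simp at ha hb
      subst ha hb
      exact h2
    · rw [List.head_append_of_ne_nil hne]
      simpa using h1.symm
  by_cases hin : ∃ (i : ℕ) (hi : i + 1 < l.length), H.Adj (l.head hne) l[i+1] ∧
      H.Adj (l.getLast hne) l[i]
  · obtain ⟨i, hi, h1, h2⟩ := hin
    have ha : l.take (i+1) ≠ [] := by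
      simp [hne]
    have hb : l.drop (i+1) ≠ [] := by
      simp; omega
    have hl : l.take (i+1) ++ l.drop (i+1) = l := List.take_append_drop _ _
    have hp : (l.take (i+1) ++ (l.drop (i+1)).reverse).Perm l := by
      conv_rhs => rw [← hl]
      exact List.Perm.append_left _ (List.reverse_perm _)
    refine ⟨l.take (i+1) ++ (l.drop (i+1)).reverse, ⟨hp.nodup_iff.2 hn, ?_, by simp [hne], ?_⟩,
      fun y hy => hp.mem_iff.2 hy⟩
    · rw [List.isChain_append]
      refine ⟨hch.take _, ?_, ?_⟩
      · rw [List.isChain_reverse]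
        have := hch.drop (i+1)
        simpa only [H.adj_comm] using this
      · intro a ha' b hb'
        rw [List.getLast?_eq_some_getLast ha] at ha'
        rw [List.head?_reverse, List.getLast?_eq_some_getLast hb] at hb'
        simp only [Option.mem_def, Option.some.injEq] at ha' hb'
        subst ha' hb'
        have e1 : (l.take (i+1)).getLast ha = l[i] := by
          rw [List.getLast_eq_getElem]
          simp only [List.length_take, List.getElem_take]
          congr 1
          omega
        have e2 : (l.drop (i+1)).getLast hb = l.getLast hne := by
          rw [List.getLast_drop]
        rw [e1, e2]
        exact h2.symm
    · rw [List.head_append_of_ne_nil ha, List.getLast_append_of_ne_nil _ (by simpa using hb)]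
      rw [List.getLast_reverse, List.head_take, List.head_drop]
      exact h1.symm
  exfalso
  push Not at hout hin
  set u := l.head hne with hu
  set v := l.getLast hne with hv
  have hu0 : ∀ h : 0 < l.length, l[0] = u := fun h => by rw [hu, List.head_eq_getElem]
  have hpos : 0 < l.length := List.length_pos_iff.2 hne
  have hvl : l[l.length - 1] = v := by rw [hv, List.getLast_eq_getElem]
  let φ : V → V := fun x => if h : x ∈ l then
    l[l.idxOf x - 1]'(by have := List.idxOf_lt_length_iff.2 h; omega) else x
  have hidx : ∀ x ∈ l, H.Adj u x → ∃ (i : ℕ) (hi : i + 1 < l.length), l[i+1] = x ∧ φ x = l[i] := by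
    intro x hx hux
    have hlt := List.idxOf_lt_length_iff.2 hx
    have hget : l[l.idxOf x] = x := List.getElem_idxOf hlt
    have h0 : l.idxOf x ≠ 0 := by
      intro h0
      apply hux.ne
      rw [← hu0 hpos, ← hget]
      congr 1
      exact h0.symm
    refine ⟨l.idxOf x - 1, by omega, ?_, by simp [φ, hx]⟩
    refine Eq.trans ?_ hget
    congr 1
    omega
  have hφout : ∀ x, x ∉ l → φ x = x := fun x hx => by simp [φ, hx]
  have hinj : Set.InjOn φ (H.neighborFinset u) := by
    intro x hx y hy hxy
    simp only [Finset.mem_coe, SimpleGraph.mem_neighborFinset] at hx hy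
    by_cases hxl : x ∈ l <;> by_cases hyl : y ∈ l
    · obtain ⟨i, hi, h1, h2⟩ := hidx x hxl hx
      obtain ⟨j, hj, h3, h4⟩ := hidx y hyl hy
      rw [h2, h4, hn.getElem_inj_iff] at hxy
      subst hxy
      rw [← h1, ← h3]
    · obtain ⟨i, hi, h1, h2⟩ := hidx x hxl hx
      rw [h2, hφout y hyl] at hxy
      exact absurd (hxy ▸ List.getElem_mem _) hyl
    · obtain ⟨i, hi, h1, h2⟩ := hidx y hyl hy
      rw [h2, hφout x hxl] at hxy
      exact absurd (hxy ▸ List.getElem_mem _) hxl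
    · rwa [hφout x hxl, hφout y hyl] at hxy
  have hdisj : Disjoint ((H.neighborFinset u).image φ) (insert v (H.neighborFinset v)) := by
    rw [Finset.disjoint_left]
    intro z hz hz'
    obtain ⟨x, hx, rfl⟩ := Finset.mem_image.1 hz
    simp only [SimpleGraph.mem_neighborFinset, Finset.mem_insert] at hx hz'
    by_cases hxl : x ∈ l
    · obtain ⟨i, hi, h1, h2⟩ := hidx x hxl hx
      rw [h2] at hz'
      rcases hz' with hz' | hz'
      · rw [← hvl, hn.getElem_inj_iff] at hz'
        omega
      · exact hin i hi (h1 ▸ hx) hz'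
    · rw [hφout x hxl] at hz'
      rcases hz' with hz' | hz'
      · exact hxl (hz' ▸ List.getLast_mem hne)
      · exact hout x hxl hx hz'
  have h1 := Finset.card_le_univ ((H.neighborFinset u).image φ ∪ insert v (H.neighborFinset v))
  rw [Finset.card_union_of_disjoint hdisj, Finset.card_image_of_injOn hinj,
    Finset.card_insert_of_notMem (by simp)] at h1
  simp only [SimpleGraph.card_neighborFinset_eq_degree] at h1
  omega

theorem del_edge {V : Type*} (H H' : SimpleGraph V) (u v : V)
    (hH : ∀ x y, H.Adj x y → ¬ H'.Adj x y → s(x, y) = s(u, v)) (l : List V) (hl : Cyc H l)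
    (h3 : 3 ≤ l.length) :
    Cyc H' l ∨ ∃ (l' : List V), l'.Perm l ∧ l'.IsChain H'.Adj ∧ ∃ hne : l' ≠ [],
      s(l'.head hne, l'.getLast hne) = s(u, v) := by
  obtain ⟨hn, hch, hne, hadj⟩ := hl
  have aux : ∀ (l : List V), l.Nodup → l.IsChain H.Adj → 3 ≤ l.length → ∀ hne : l ≠ [],
      s(l.head hne, l.getLast hne) = s(u, v) → l.IsChain H'.Adj := by
    intro l hn hch h3 hne he
    rw [List.isChain_iff_getElem] at hch ⊢
    intro i hi
    by_contra hcon
    have h1 := hH _ _ (hch i hi) hcon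
    rw [← he, List.head_eq_getElem, List.getLast_eq_getElem, Sym2.eq_iff] at h1
    simp only [hn.getElem_inj_iff] at h1
    omega
  by_cases hc : l.IsChain H'.Adj
  · by_cases ha : H'.Adj (l.getLast hne) (l.head hne)
    · exact Or.inl ⟨hn, hc, hne, ha⟩
    · refine Or.inr ⟨l, .refl _, hc, hne, ?_⟩
      rw [← hH _ _ hadj ha, Sym2.eq_swap]
  · right
    have hch' := hch
    rw [List.isChain_iff_getElem] at hc hch'
    push Not at hc
    obtain ⟨i, hi, hbad⟩ := hc
    have he := hH _ _ (hch' i hi) hbad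
    have ha : l.take (i+1) ≠ [] := by
      simp [hne]
    have hb : l.drop (i+1) ≠ [] := by
      simp; omega
    have hl : l.take (i+1) ++ l.drop (i+1) = l := List.take_append_drop _ _
    have hp : (l.drop (i+1) ++ l.take (i+1)).Perm l := by
      conv_rhs => rw [← hl]
      exact List.perm_append_comm
    have hne' : l.drop (i+1) ++ l.take (i+1) ≠ [] := by simp [hne]
    have hends : s((l.drop (i+1) ++ l.take (i+1)).head hne',
        (l.drop (i+1) ++ l.take (i+1)).getLast hne') = s(u, v) := by
      rw [List.head_append_of_ne_nil hb, List.getLast_append_of_ne_nil _ ha, List.head_drop,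
        ← he, Sym2.eq_swap]
      have e1 : (l.take (i+1)).getLast ha = l[i] := by
        rw [List.getLast_eq_getElem]
        simp only [List.length_take, List.getElem_take]
        congr 1
        omega
      rw [e1]
    refine ⟨_, hp, aux _ (hp.nodup_iff.2 hn) ?_ (by rw [hp.length_eq]; exact h3) hne' hends,
      hne', hends⟩
    rw [List.isChain_append]
    refine ⟨hch.drop _, hch.take _, ?_⟩
    intro a ha' b hb'
    rw [List.getLast?_eq_some_getLast hb] at ha'
    rw [List.head?_eq_some_head ha] at hb'
    simp only [Option.mem_def, Option.some.injEq] at ha' hb'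
    subst ha' hb'
    rw [List.getLast_drop, List.head_take]
    exact hadj

open Classical in
theorem shi {V : Type*} [Fintype V] (G : SimpleGraph V) (X : Finset V) (hX : 3 ≤ X.card)
    (hd : ∀ u ∈ X, ∀ v ∈ X, u ≠ v → ¬ G.Adj u v → Fintype.card V ≤ G.degree u + G.degree v) :
    ∃ l, Cyc G l ∧ ∀ x ∈ X, x ∈ l := by
  let S : Set (SimpleGraph V) := {H | G ≤ H ∧ (∀ x y, H.Adj x y → ¬ G.Adj x y → x ∈ X ∧ y ∈ X) ∧
    ∃ l, Cyc H l ∧ ∀ x ∈ X, x ∈ l}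
  have hS : S.Nonempty := by
    let K : SimpleGraph V := SimpleGraph.fromRel fun x y => x ∈ X ∧ y ∈ X
    have hK : ∀ x ∈ X, ∀ y ∈ X, x ≠ y → (G ⊔ K).Adj x y := fun x hx y hy hxy =>
      Or.inr ⟨hxy, Or.inl ⟨hx, hy⟩⟩
    have hne : X.toList ≠ [] := by
      intro h
      rw [Finset.toList_eq_nil] at h
      simp [h] at hX
    refine ⟨G ⊔ K, le_sup_left, ?_, X.toList, ⟨X.nodup_toList, ?_, hne, ?_⟩, by simp⟩
    · intro x y h1 h2
      rcases h1 with h1 | h1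
      · exact absurd h1 h2
      · rcases h1.2 with h | h
        · exact h
        · exact h.symm
    · apply List.Pairwise.isChain
      have := X.nodup_toList
      refine List.Pairwise.imp_of_mem ?_ this
      intro a b ha hb hab
      exact hK a (by simpa using ha) b (by simpa using hb) hab
    · apply hK
      · exact Finset.mem_toList.1 (List.getLast_mem hne)
      · exact Finset.mem_toList.1 (List.head_mem hne)
      · have hl : X.toList.length = X.card := by simp
        rw [List.getLast_eq_getElem, List.head_eq_getElem, Ne, X.nodup_toList.getElem_inj_iff]
        omega
  obtain ⟨H, hH⟩ := (Set.toFinite S).exists_minimal hS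
  obtain ⟨⟨hGH, hHX, l, hl, hXl⟩, hmin⟩ := hH
  by_cases hle : H ≤ G
  · obtain rfl := le_antisymm hle hGH
    exact ⟨l, hl, hXl⟩
  exfalso
  have : ∃ u v, H.Adj u v ∧ ¬ G.Adj u v := by
    by_contra! hcon
    exact hle fun u v h => hcon u v h
  obtain ⟨u, v, huv, hnuv⟩ := this
  obtain ⟨hu, hv⟩ := hHX u v huv hnuv
  obtain ⟨H', hHdef⟩ : ∃ H', H' = H.deleteEdges {s(u, v)} := ⟨_, rfl⟩
  have hlt : H' ≤ H := hHdef ▸ SimpleGraph.deleteEdges_le _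
  have hGH' : G ≤ H' := by
    intro x y h
    simp only [hHdef, SimpleGraph.deleteEdges_adj, Set.mem_singleton_iff]
    refine ⟨hGH h, fun he => hnuv ?_⟩
    rw [← SimpleGraph.mem_edgeSet, ← he]
    exact h
  have hlen : 3 ≤ l.length := by
    refine hX.trans ?_
    rw [← List.toFinset_card_of_nodup hl.1]
    exact Finset.card_le_card fun x hx => by simpa using hXl x hx
  have hcyc : ∃ l, Cyc H' l ∧ ∀ x ∈ X, x ∈ l := by
    rcases del_edge H H' u v (by
      intro x y h1 h2
      by_contra hcon
      exact h2 (by simp [hHdef, SimpleGraph.deleteEdges_adj, h1, hcon])) l hl hlen with h | ⟨l', hp, hch, hne, he⟩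
    · exact ⟨l, h, hXl⟩
    · have hdeg := hd u hu v hv huv.ne hnuv
      have h1 : G.degree u ≤ H'.degree u := SimpleGraph.degree_le_of_le hGH'
      have h2 : G.degree v ≤ H'.degree v := SimpleGraph.degree_le_of_le hGH'
      obtain ⟨l'', hl'', hm⟩ := ore H' l' (hp.nodup_iff.2 hl.1) hch hne (by
        rw [Sym2.eq_iff] at he
        rcases he with ⟨h3, h4⟩ | ⟨h3, h4⟩ <;> rw [h3, h4] <;> omega)
      exact ⟨l'', hl'', fun x hx => hm x (hp.mem_iff.2 (hXl x hx))⟩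
  have hmem : H' ∈ S := ⟨hGH', fun x y h => hHX x y (hlt h), hcyc⟩
  have := hmin hmem hlt huv
  simp [hHdef, SimpleGraph.deleteEdges_adj] at this

open Classical in
theorem cover {V : Type*} [Fintype V] (G : SimpleGraph V) (hG : G.Connected)
    (X : Finset V) (hX : Even X.card)
    (hd : ∀ u ∈ X, ∀ v ∈ X, u ≠ v → ¬ G.Adj u v → Fintype.card V ≤ G.degree u + G.degree v) :
    ∃ (r : V) (w : G.Walk r r), w.length ≤ w.support.toFinset.card ∧ ∀ x ∈ X, x ∈ w.support := by
  by_cases h3 : 3 ≤ X.card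
  · obtain ⟨l, hl, hm⟩ := shi G X h3 hd
    obtain ⟨r, w, h1, h2⟩ := cyc_walk hl
    exact ⟨r, w, h1, fun x hx => h2 x (hm x hx)⟩
  have : X.card = 0 ∨ X.card = 2 := by
    obtain ⟨k, hk⟩ := hX; omega
  rcases this with h0 | h2
  · obtain ⟨r⟩ := hG.nonempty
    refine ⟨r, .nil, by simp, ?_⟩
    rw [Finset.card_eq_zero] at h0
    simp [h0]
  · obtain ⟨u, v, huv, rfl⟩ := Finset.card_eq_two.1 h2
    have : ∃ l, Cyc G l ∧ ∀ x ∈ ({u, v} : Finset V), x ∈ l := by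
      by_cases ha : G.Adj u v
      · exact ⟨[u, v], ⟨by simp [huv], by simp [ha], by simp, by simpa using ha.symm⟩, by simp⟩
      · obtain ⟨p, hp⟩ := hG.exists_isPath u v
        obtain ⟨l, hl, hm⟩ := ore G p.support hp.support_nodup p.isChain_adj_support p.support_ne_nil
          (by
            rw [SimpleGraph.Walk.head_support, SimpleGraph.Walk.getLast_support]
            exact hd u (by simp) v (by simp) huv ha)
        refine ⟨l, hl, ?_⟩
        simp [hm]
    obtain ⟨l, hl, hm⟩ := this
    obtain ⟨r, w, h1, h2⟩ := cyc_walk hl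
    exact ⟨r, w, h1, fun x hx => h2 x (hm x hx)⟩

end TSPAux

/-- Let `G` be a 2-vertex-connected simple graph on `n` vertices
and `T` a spanning tree of `G` such that every pair of distinct non-adjacent
vertices both having odd degree in `T` has degree sum (in `G`) at least `n`.
Then `G` has a TSP tour of length at most `4n/3`. -/
theorem graphTSP_of_degree_sum_condition {V : Type*} [Fintype V]
    (G : SimpleGraph V)
    (hcard : 3 ≤ Fintype.card V)
    (h2conn : ∀ v : V, (G.induce {v}ᶜ).Connected)
    (T : SimpleGraph V) (hTG : T ≤ G) (hT : T.IsTree)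
    (hdeg : ∀ u v : V, u ≠ v → ¬G.Adj u v →
      Odd (T.neighborSet u).ncard → Odd (T.neighborSet v).ncard →
      Fintype.card V ≤ (G.neighborSet u).ncard + (G.neighborSet v).ncard) :
    ∃ (r : V) (w : G.Walk r r), (∀ x : V, x ∈ w.support) ∧
      (w.length : ℚ) ≤ 4 * (Fintype.card V) / 3 := by
  classical
  have hN : ∀ (H : SimpleGraph V) (x : V), (H.neighborSet x).ncard = H.degree x := fun H x => by
    rw [Set.ncard_eq_toFinset_card', ← SimpleGraph.card_neighborFinset_eq_degree]
    rfl
  simp only [hN] at hdeg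
  obtain ⟨r, w, h1, h2⟩ := TSPAux.cover G (hT.connected.mono hTG)
    (Finset.univ.filter fun x => Odd (T.degree x)) T.even_card_odd_degree_vertices (by
      intro u hu v hv huv hadj
      simp only [Finset.mem_filter, Finset.mem_univ, true_and] at hu hv
      exact hdeg u v huv hadj hu hv)
  obtain ⟨r', w', h3, h4⟩ := TSPAux.final G T hTG hT r w h1 (fun x hx => h2 x (by simpa using hx))
  refine ⟨r', w', h3, ?_⟩
  rw [le_div_iff₀ (by norm_num)]
  have : w'.length * 3 ≤ 4 * Fintype.card V := by omega
  exact_mod_cast this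
end

section
/- Let G be a 2-vertex-connected simple graph on n vertices with vertex connectivity κ(G), and let T be a spanning tree of G. Let X be the set of vertices having odd degree in T, and suppose that every subset of X that is an independent set in G has size at most κ(G). Then G has a TSP tour of length at most 4n/3. -/
/-- The vertex connectivity of a finite simple graph: the least cardinality of a set
`S` of vertices such that deleting `S` disconnects the graph or leaves at most one
vertex (so `κ(Kₙ) = n - 1`). -/
noncomputable def vertexConnectivity {V : Type*} [Fintype V] (G : SimpleGraph V) : ℕ :=
  sInf {m : ℕ | ∃ s : Finset V, s.card = m ∧
    (¬(G.induce (↑s : Set V)ᶜ).Preconnected ∨ ((↑s : Set V)ᶜ).ncard ≤ 1)}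


section Part1
open SimpleGraph Classical

lemma two_zmod2 : (2 : ZMod 2) = 0 := rfl

lemma walk_parity {V : Type*} {G : SimpleGraph V} {a b : V} (p : G.Walk a b) (v : V) :
    ((Multiset.countP (v ∈ ·) (p.edges : Multiset (Sym2 V)) : ℕ) : ZMod 2)
      = (if v = a then 1 else 0) + (if v = b then 1 else 0) := by
  induction p with
  | nil => split_ifs <;> simp <;> rfl
  | @cons a a' b h p ih =>
    have hne := h.ne
    rw [Walk.edges_cons, ← Multiset.cons_coe, Multiset.countP_cons]
    push_cast
    rw [ih]
    by_cases h1 : v = a <;> by_cases h2 : v = a' <;> by_cases h3 : v = b <;>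
      simp [h1, h2, h3] <;> first | (subst h1; exact absurd h2 hne) | skip
    all_goals first | (exfalso; grind) | skip
    all_goals try simp_all
    all_goals grind [two_zmod2]

lemma walk_splice {V : Type*} {G : SimpleGraph V} {r u : V} (w : G.Walk r r) (hu : u ∈ w.support)
    (c : G.Walk u u) : ∃ w' : G.Walk r r, w'.length = w.length + c.length ∧
      (∀ x, x ∈ w'.support ↔ x ∈ w.support ∨ x ∈ c.support) ∧
      (w'.edges : Multiset (Sym2 V)) = w.edges + c.edges := by
  obtain ⟨p, q, rfl⟩ := Walk.mem_support_iff_exists_append.1 hu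
  refine ⟨p.append (c.append q), ?_, ?_, ?_⟩
  · simp only [Walk.length_append]; omega
  · intro x
    simp only [Walk.mem_support_append_iff]
    tauto
  · simp only [Walk.edges_append, ← Multiset.coe_add]
    abel

lemma exists_mem_of_odd {V : Type*} (M : Multiset (Sym2 V)) (v : V)
    (h : ((Multiset.countP (v ∈ ·) M : ℕ) : ZMod 2) ≠ 0) : ∃ v', s(v, v') ∈ M := by
  have : Multiset.countP (v ∈ ·) M ≠ 0 := by
    intro h0; simp [h0] at h
  obtain ⟨e, he, hv⟩ := Multiset.countP_pos.1 (Nat.pos_of_ne_zero this)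
  obtain ⟨v', rfl⟩ := hv
  exact ⟨v', he⟩

lemma closed_trail {V : Type*} {G : SimpleGraph V} (M : Multiset (Sym2 V))
    (hM : ∀ e ∈ M, e ∈ G.edgeSet)
    (hev : ∀ v, ((Multiset.countP (v ∈ ·) M : ℕ) : ZMod 2) = 0) (u u' : V) (hu : s(u, u') ∈ M) :
    ∃ c : G.Walk u u, 0 < c.length ∧ (c.edges : Multiset (Sym2 V)) ≤ M := by
  by_contra hcon
  push Not at hcon
  have key : ∀ n : ℕ, ∃ (b : V) (p : G.Walk u b), p.length = n + 1 ∧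
      (p.edges : Multiset (Sym2 V)) ≤ M := by
    intro n
    induction n with
    | zero =>
      have : G.Adj u u' := hM _ hu
      exact ⟨u', Walk.cons this Walk.nil, by simp, by simpa using hu⟩
    | succ n ih =>
      obtain ⟨b, p, hp, hle⟩ := ih
      have hb : b ≠ u := by
        rintro rfl
        exact hcon p (by omega) hle
      obtain ⟨b', hb'⟩ := exists_mem_of_odd (M - (p.edges : Multiset (Sym2 V))) b (by
        have h1 := hev b
        rw [← Multiset.sub_add_cancel hle, Multiset.countP_add] at h1
        push_cast at h1
        rw [walk_parity] at h1
        simp only [hb, if_false, if_true] at h1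
        intro h2
        rw [h2] at h1
        simp at h1)
      have hadj : G.Adj b b' := hM _ (Multiset.mem_of_le (Multiset.sub_le_self _ _) hb')
      refine ⟨b', p.concat hadj, by simp [hp], ?_⟩
      rw [Walk.edges_concat, List.concat_eq_append, ← Multiset.coe_add]
      calc (p.edges : Multiset (Sym2 V)) + ([s(b, b')] : List _) ≤ p.edges + (M - p.edges) := by
            gcongr
            simpa using hb'
        _ = M := by rw [add_comm, Multiset.sub_add_cancel hle]
  obtain ⟨b, p, hp, hle⟩ := key (Multiset.card M)
  have := Multiset.card_le_card hle
  simp at this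
  omega

lemma euler_tour {V : Type*} {G : SimpleGraph V} (M : Multiset (Sym2 V))
    (hM : ∀ e ∈ M, e ∈ G.edgeSet)
    (hev : ∀ v, ((Multiset.countP (v ∈ ·) M : ℕ) : ZMod 2) = 0) (r : V)
    (hconn : ∀ S : Set V, r ∈ S → (∃ x, x ∉ S) → ∃ u u', u ∈ S ∧ u' ∉ S ∧ s(u, u') ∈ M) :
    ∃ w : G.Walk r r, (∀ x, x ∈ w.support) ∧ w.length ≤ Multiset.card M := by
  by_contra hcon
  push Not at hcon
  have key : ∀ n : ℕ, ∃ (w : G.Walk r r), n ≤ w.length ∧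
      (w.edges : Multiset (Sym2 V)) ≤ M := by
    intro n
    induction n with
    | zero => exact ⟨Walk.nil, by simp, by simp⟩
    | succ n ih =>
      obtain ⟨w, hn, hle⟩ := ih
      have hlen := Multiset.card_le_card hle
      simp only [Multiset.coe_card, Walk.length_edges] at hlen
      have hx : ∃ x, x ∉ w.support := by
        by_contra hx
        push Not at hx
        have := hcon w hx
        omega
      obtain ⟨u, u', hu, hu', he⟩ := hconn {x | x ∈ w.support} (by simp) hx
      have he' : s(u, u') ∈ M - (w.edges : Multiset (Sym2 V)) := by
        rw [← Multiset.sub_add_cancel hle, Multiset.mem_add] at he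
        rcases he with he | he
        · exact he
        · exact absurd (w.snd_mem_support_of_mem_edges (by simpa using he)) hu'
      obtain ⟨c, hc, hcle⟩ := closed_trail (G := G) (M - (w.edges : Multiset (Sym2 V)))
        (fun e he => hM _ (Multiset.mem_of_le (Multiset.sub_le_self _ _) he)) (by
          intro v
          have h1 := hev v
          rw [← Multiset.sub_add_cancel hle, Multiset.countP_add] at h1
          push_cast at h1
          rw [walk_parity] at h1
          have h2 : ((if v = r then 1 else 0) + (if v = r then 1 else 0) : ZMod 2) = 0 := by
            split_ifs <;> rfl
          rw [h2, add_zero] at h1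
          exact h1) u u' he'
      obtain ⟨w', h1, h2, h3⟩ := walk_splice w hu c
      refine ⟨w', by omega, ?_⟩
      rw [h3]
      calc _ ≤ (w.edges : Multiset (Sym2 V)) + (M - w.edges) := by gcongr
        _ = M := by rw [add_comm, Multiset.sub_add_cancel hle]
  obtain ⟨p, hp, hle⟩ := key (Multiset.card M + 1)
  have := Multiset.card_le_card hle
  simp at this
  omega

lemma crossing {V : Type*} {G : SimpleGraph V} (hG : G.Preconnected) (r : V) (S : Set V)
    (hr : r ∈ S) (hx : ∃ x, x ∉ S) : ∃ u u', u ∈ S ∧ u' ∉ S ∧ G.Adj u u' := by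
  obtain ⟨x, hx⟩ := hx
  obtain ⟨p⟩ := hG r x
  obtain ⟨d, _, h1, h2⟩ := p.exists_boundary_dart S hr hx
  exact ⟨d.fst, d.snd, h1, h2, d.adj⟩

lemma extend_tour {V : Type*} [Fintype V] {G : SimpleGraph V} (hG : G.Preconnected) (r : V) :
    ∀ (k : ℕ) (w : G.Walk r r), (Finset.univ.filter (· ∉ w.support)).card = k →
      ∃ w' : G.Walk r r, (∀ x, x ∈ w'.support) ∧ w'.length ≤ w.length + 2 * k := by
  intro k
  induction k with
  | zero =>
    intro w hw
    refine ⟨w, ?_, by omega⟩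
    simpa using hw
  | succ k ih =>
    intro w hw
    have hne : (Finset.univ.filter (· ∉ w.support)).Nonempty := by
      rw [← Finset.card_pos]; omega
    obtain ⟨x, hx⟩ := hne
    obtain ⟨u, u', hu, hu', hadj⟩ := crossing hG r {x | x ∈ w.support} (by simp)
      ⟨x, by simpa using hx⟩
    obtain ⟨w', h1, h2, -⟩ := walk_splice w hu (Walk.cons hadj (Walk.cons hadj.symm Walk.nil))
    simp at h1 hu' hu
    have hcard : (Finset.univ.filter (· ∉ w'.support)).card ≤ k := by
      have : Finset.univ.filter (· ∉ w'.support) ⊆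
          (Finset.univ.filter (· ∉ w.support)).erase u' := by
        intro y hy
        simp [h2] at hy ⊢
        tauto
      have := Finset.card_le_card this
      rw [Finset.card_erase_of_mem (by simpa using hu')] at this
      omega
    have hcard' : (Finset.univ.filter (· ∉ w'.support)).card = k := by
      have : (Finset.univ.filter (· ∉ w.support)) ⊆
          insert u' (Finset.univ.filter (· ∉ w'.support)) := by
        intro y hy
        simp [h2] at hy ⊢
        by_cases hyu : y = u
        · subst hyu; exact absurd hu hy
        · tauto
      have := Finset.card_le_card this
      have := Finset.card_insert_le u' (Finset.univ.filter (· ∉ w'.support))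
      omega
    obtain ⟨w'', h3, h4⟩ := ih w' hcard'
    exact ⟨w'', h3, by omega⟩

lemma split_walk {V : Type*} {G : SimpleGraph V} (X : Set V) {a b : V} (p : G.Walk a b) :
    ∃ J₁ J₂ : Multiset (Sym2 V), J₁ + J₂ = p.edges ∧
      ∀ v, ((Multiset.countP (v ∈ ·) J₁ : ℕ) : ZMod 2) =
        (if v = a then 1 else 0) + (if v ∈ X then (p.support.tail.count v : ZMod 2) else 0)
          + (if v = b then (1 + (p.support.tail.countP (· ∈ X) : ZMod 2)) else 0) := by
  induction p with
  | nil =>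
    refine ⟨0, 0, by simp, ?_⟩
    intro v
    simp
    split_ifs <;> rfl
  | @cons a a' b h p ih =>
    obtain ⟨J₁, J₂, hJ, hd⟩ := ih
    have hne := h.ne
    have htot : ∀ v, ((Multiset.countP (v ∈ ·) J₁ : ℕ) : ZMod 2)
        + ((Multiset.countP (v ∈ ·) J₂ : ℕ) : ZMod 2)
         = (if v = a' then 1 else 0) + (if v = b then 1 else 0) := by
      intro v
      rw [← walk_parity p v, ← hJ, Multiset.countP_add]
      push_cast; rfl
    have he : ∀ v, (if v ∈ s(a, a') then 1 else 0 : ZMod 2)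
       = (if v = a then 1 else 0) + (if v = a' then 1 else 0) := by
      intro v
      by_cases h1 : v = a <;> by_cases h2 : v = a' <;> simp [h1, h2] 
      · exact absurd (h1.symm.trans h2) hne
      · subst h1; simp [h2]
      · subst h2; simp [h1]
    have hs : p.support = a' :: p.support.tail := (Walk.cons_tail_support p).symm
    by_cases hX : a' ∈ X
    · refine ⟨s(a, a') ::ₘ J₂, J₁, ?_, ?_⟩
      · rw [Walk.edges_cons, ← Multiset.cons_coe, ← hJ, Multiset.cons_add, add_comm]
      · intro v
        rw [Multiset.countP_cons, Walk.support_cons, List.tail_cons, hs, List.countP_cons,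
          List.count_cons]
        have h1 := hd v
        have h2 := htot v
        have h3 := he v
        push_cast
        rw [h3]
        simp only [hX, decide_true, if_true]
        by_cases h5 : v = a'
        · subst h5
          simp [hX] at h1 h2 ⊢
          split_ifs at h1 h2 ⊢ <;> grind [two_zmod2]
        · have h6 : ¬ a' = v := fun h => h5 h.symm
          simp [h5, h6] at h1 h2 ⊢
          split_ifs at h1 h2 ⊢ <;> grind [two_zmod2]
    · refine ⟨s(a, a') ::ₘ J₁, J₂, ?_, ?_⟩
      · rw [Walk.edges_cons, ← Multiset.cons_coe, ← hJ, Multiset.cons_add]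
      · intro v
        rw [Multiset.countP_cons, Walk.support_cons, List.tail_cons, hs, List.countP_cons,
          List.count_cons]
        have h1 := hd v
        have h3 := he v
        push_cast
        rw [h3]
        by_cases h5 : v = a'
        · subst h5
          simp [hX] at h1 ⊢
          split_ifs at h1 ⊢ <;> grind [two_zmod2]
        · have h6 : ¬ a' = v := fun h => h5 h.symm
          simp [h5, h6, hX] at h1 ⊢
          split_ifs at h1 ⊢ <;> grind [two_zmod2]

end Part1

section Part2
open SimpleGraph Classical

lemma exists_walk_of_chain {V : Type*} {G : SimpleGraph V} (L : List V) (hne : L ≠ [])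
    (hch : List.IsChain G.Adj L) (a b : V) (ha : L.head hne = a) (hb : L.getLast hne = b) :
    ∃ w : G.Walk a b, w.support = L := by
  subst ha hb
  exact ⟨Walk.ofSupport L hne hch, Walk.support_ofSupport hne hch⟩

lemma tour_of_cycle {V : Type*} [Fintype V] (G T : SimpleGraph V) (hTG : T ≤ G) (hT : T.IsTree)
    (r : V) (l : List V) (hnd : (r :: l).Nodup) (hch : List.IsChain G.Adj (r :: l ++ [r]))
    (hX : ∀ v, Odd (T.neighborSet v).ncard → v ∈ r :: l) :
    ∃ (r : V) (w : G.Walk r r), (∀ x : V, x ∈ w.support) ∧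
      (w.length : ℚ) ≤ 4 * (Fintype.card V) / 3 := by
  obtain ⟨w, hw⟩ : ∃ w : G.Walk r r, w.support = r :: l ++ [r] :=
    exists_walk_of_chain _ (by simp) hch r r (by simp) (by simp)
  have hwlen : w.length = l.length + 1 := by
    have := w.length_support
    rw [hw] at this
    simp at this
    omega
  have hcle : l.length + 1 ≤ Fintype.card V := by
    simpa using hnd.length_le_card
  have hdeg : ∀ v, (T.neighborSet v).ncard = T.degree v := by
    intro v
    rw [Set.ncard_eq_toFinset_card']
    simp [SimpleGraph.degree, SimpleGraph.neighborFinset]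
  by_cases hbig : 2 * Fintype.card V ≤ 3 * (l.length + 1)
  · have hc : (Finset.univ.filter (· ∉ w.support)).card = Fintype.card V - (l.length + 1) := by
      have h1 : (Finset.univ.filter (· ∉ w.support)) = ((r :: l).toFinset)ᶜ := by
        ext x; simp [hw]; tauto
      rw [h1, Finset.card_compl, List.toFinset_card_of_nodup hnd]
      simp
    obtain ⟨w', h1, h2⟩ := extend_tour (hT.connected.preconnected.mono hTG) r _ w hc
    refine ⟨r, w', h1, ?_⟩
    rw [le_div_iff₀ (by norm_num)]
    exact_mod_cast (by omega : w'.length * 3 ≤ 4 * Fintype.card V)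
  · obtain ⟨X, hXd⟩ : ∃ X : Set V, ∀ v, v ∈ X ↔ Odd (T.neighborSet v).ncard :=
      ⟨{v | Odd (T.neighborSet v).ncard}, fun v => Iff.rfl⟩
    obtain ⟨J₁, J₂, hJ, hd⟩ := split_walk X w
    have htail : w.support.tail = l ++ [r] := by rw [hw]; simp
    have hnd' : (l ++ [r]).Nodup := by
      rw [List.nodup_append_comm]; simpa using hnd
    have hcnt : ∀ v, Odd (T.neighborSet v).ncard → (l ++ [r]).count v = 1 := by
      intro v hv
      apply List.count_eq_one_of_mem hnd'
      have := hX v hv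
      simp at this ⊢
      tauto
    have heven : (((l ++ [r]).countP (· ∈ X) : ℕ) : ZMod 2) = 0 := by
      rw [ZMod.natCast_eq_zero_iff_even]
      have h0 := T.even_card_odd_degree_vertices
      convert h0 using 1
      rw [List.countP_eq_length_filter, ← List.toFinset_card_of_nodup (hnd'.filter _)]
      congr 1
      ext v
      have := hX v
      simp [hXd, hdeg] at this ⊢
      tauto
    have hd1 : ∀ v, ((Multiset.countP (v ∈ ·) J₁ : ℕ) : ZMod 2) =
        if Odd (T.neighborSet v).ncard then 1 else 0 := by
      intro v
      rw [hd v, htail, heven]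
      by_cases hv : Odd (T.neighborSet v).ncard
      · simp only [hcnt v hv, hXd, hv, if_true]
        split_ifs <;> rfl
      · simp only [hXd, hv, if_false]
        split_ifs <;> rfl
    have hd2 : ∀ v, ((Multiset.countP (v ∈ ·) J₂ : ℕ) : ZMod 2) =
        if Odd (T.neighborSet v).ncard then 1 else 0 := by
      intro v
      have h1 := walk_parity w v
      rw [← hJ, Multiset.countP_add] at h1
      push_cast at h1
      rw [hd1 v] at h1
      split_ifs at h1 ⊢ <;> grind [two_zmod2]
    have hle : ∃ J : Multiset (Sym2 V), (∀ e ∈ J, e ∈ G.edgeSet) ∧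
        2 * Multiset.card J ≤ l.length + 1 ∧
        ∀ v, ((Multiset.countP (v ∈ ·) J : ℕ) : ZMod 2) =
          if Odd (T.neighborSet v).ncard then 1 else 0 := by
      have hc := congrArg Multiset.card hJ
      rw [Multiset.card_add, Multiset.coe_card, Walk.length_edges, hwlen] at hc
      have hmem : ∀ e ∈ J₁ + J₂, e ∈ G.edgeSet := by
        intro e he
        rw [hJ] at he
        exact w.edges_subset_edgeSet (by simpa using he)
      rcases le_total (Multiset.card J₁) (Multiset.card J₂) with h | h
      · exact ⟨J₁, fun e he => hmem e (Multiset.mem_add.2 (Or.inl he)), by omega, hd1⟩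
      · exact ⟨J₂, fun e he => hmem e (Multiset.mem_add.2 (Or.inr he)), by omega, hd2⟩
    obtain ⟨J, hJG, hJc, hJd⟩ := hle
    have hTd : ∀ v, Multiset.countP (v ∈ ·) T.edgeFinset.val = T.degree v := by
      intro v
      rw [← T.card_incidenceFinset_eq_degree, T.incidenceFinset_eq_filter,
        Multiset.countP_eq_card_filter]
      rfl
    obtain ⟨w', h1, h2⟩ := euler_tour (G := G) (T.edgeFinset.val + J)
      (by
        intro e he
        rcases Multiset.mem_add.1 he with he | he
        · have : e ∈ T.edgeSet := by simpa using he
          exact SimpleGraph.edgeSet_mono hTG this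
        · exact hJG e he)
      (by
        intro v
        rw [Multiset.countP_add, hTd]
        push_cast
        rw [hJd, hdeg]
        split_ifs with h
        · rw [(ZMod.natCast_eq_one_iff_odd).2 h]; rfl
        · rw [(ZMod.natCast_eq_zero_iff_even).2 (by simpa using h)]; rfl)
      r
      (by
        intro S hr hx
        obtain ⟨u, u', hu, hu', ha⟩ := crossing hT.connected.preconnected r S hr hx
        exact ⟨u, u', hu, hu', Multiset.mem_add.2 (Or.inl (by simpa using ha))⟩)
    refine ⟨r, w', h1, ?_⟩
    rw [Multiset.card_add] at h2
    have h3 := hT.card_edgeFinset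
    have h4 : Multiset.card T.edgeFinset.val = T.edgeFinset.card := rfl
    rw [le_div_iff₀ (by norm_num)]
    exact_mod_cast (by omega : w'.length * 3 ≤ 4 * Fintype.card V)

lemma vertexConnectivity_le {V : Type*} [Fintype V] (G : SimpleGraph V) (s : Finset V)
    (h : ¬(G.induce (↑s : Set V)ᶜ).Preconnected ∨ ((↑s : Set V)ᶜ).ncard ≤ 1) :
    vertexConnectivity G ≤ s.card :=
  Nat.sInf_le ⟨s, rfl, h⟩

lemma two_le_vertexConnectivity {V : Type*} [Fintype V] (G : SimpleGraph V)
    (hcard : 3 ≤ Fintype.card V) (hG : G.Connected)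
    (h2conn : ∀ v : V, (G.induce {v}ᶜ).Connected) : 2 ≤ vertexConnectivity G := by
  have hmem : vertexConnectivity G ∈ {m : ℕ | ∃ s : Finset V, s.card = m ∧
    (¬(G.induce (↑s : Set V)ᶜ).Preconnected ∨ ((↑s : Set V)ᶜ).ncard ≤ 1)} :=
    Nat.sInf_mem ⟨_, Finset.univ, rfl, Or.inr (by simp)⟩
  obtain ⟨s, hs, h⟩ := hmem
  by_contra hlt
  have hc : ((↑s : Set V)ᶜ).ncard = Fintype.card V - s.card := by
    rw [← Finset.coe_compl, Set.ncard_coe_finset, Finset.card_compl]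
  rcases h with h | h
  · have h01 : s.card = 0 ∨ s.card = 1 := by omega
    rcases h01 with h0 | h0
    · rw [Finset.card_eq_zero] at h0
      subst h0
      apply h
      rw [Finset.coe_empty, Set.compl_empty]
      exact (SimpleGraph.induceUnivIso G).symm.connected_iff.1 hG |>.preconnected
    · obtain ⟨v, rfl⟩ := Finset.card_eq_one.1 h0
      apply h
      rw [Finset.coe_singleton]
      exact (h2conn v).preconnected
  · omega

/-- Boundary of a set containing `x`. -/
lemma boundary_card {V : Type*} [Fintype V] (G : SimpleGraph V) (W B : Finset V) (x : V)
    (hx : x ∈ W) (hB : ∀ v, v ∈ B ↔ v ∉ W ∧ ∃ u ∈ W, G.Adj u v) (t : ℕ)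
    (ht : t ≤ vertexConnectivity G) (htW : t ≤ Wᶜ.card) : t ≤ B.card := by
  by_cases h : ∃ y, y ∉ W ∧ y ∉ B
  · obtain ⟨y, hyW, hyB⟩ := h
    refine ht.trans (vertexConnectivity_le G B (Or.inl ?_))
    intro hp
    have hxB : x ∉ B := fun h => ((hB x).1 h).1 hx
    obtain ⟨u, u', hu, hu', ha⟩ := crossing hp ⟨x, by simpa using hxB⟩
      {v | (v : V) ∈ W} hx ⟨⟨y, by simpa using hyB⟩, hyW⟩
    have : (u' : V) ∈ B := (hB _).2 ⟨hu', u, hu, ha⟩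
    exact u'.2 (by simpa using this)
  · push Not at h
    refine htW.trans (Finset.card_le_card ?_)
    intro v hv
    exact h v (by simpa using hv)

lemma fan_injection {V : Type*} [Fintype V] (G : SimpleGraph V) (S : Finset V) (x : V)
    (hxS : x ∉ S) (t : ℕ) (ht : t ≤ vertexConnectivity G) (htS : t ≤ S.card) :
    ∃ f : Fin t ⊕ {v : V // v ∉ S ∧ v ≠ x} → V, Function.Injective f ∧
      (∀ i, G.Adj x (f (Sum.inl i))) ∧
      (∀ v, f (Sum.inr v) ≠ x ∧ (f (Sum.inr v) = v ∨ G.Adj v (f (Sum.inr v)))) := by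
  let N : Fin t ⊕ {v : V // v ∉ S ∧ v ≠ x} → Finset V := fun z =>
    match z with
    | Sum.inl _ => Finset.univ.filter (fun w => G.Adj x w)
    | Sum.inr v => Finset.univ.filter (fun w => w ≠ x ∧ (w = v ∨ G.Adj v w))
  obtain ⟨f, hf, hfN⟩ := (Finset.all_card_le_biUnion_card_iff_exists_injective N).1 (by
    intro Q
    set U : Finset V := Finset.univ.filter (fun v => ∃ h, (Sum.inr ⟨v, h⟩ : Fin t ⊕ {v : V // v ∉ S ∧ v ≠ x}) ∈ Q) with hU
    have hUmem : ∀ v, v ∈ U ↔ ∃ h, (Sum.inr ⟨v, h⟩ : Fin t ⊕ {v : V // v ∉ S ∧ v ≠ x}) ∈ Q := by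
      intro v; simp [hU]
    have hUsub : U ⊆ Q.biUnion N := by
      intro v hv
      obtain ⟨h, hQ⟩ := (hUmem v).1 hv
      rw [Finset.mem_biUnion]
      exact ⟨_, hQ, by simp [N, h.2]⟩
    have hRU : Q.toRight.card = U.card := by
      have : U = Q.toRight.map (Function.Embedding.subtype _) := by
        ext v; simp [hU]
      rw [this, Finset.card_map]
    have hQc : Q.card = Q.toLeft.card + U.card := by
      rw [← hRU, Finset.card_toLeft_add_card_toRight]
    have hL : Q.toLeft.card ≤ t := by
      simpa using Finset.card_le_univ Q.toLeft
    by_cases hne : Q.toLeft.Nonempty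
    · obtain ⟨i, hi⟩ := hne
      rw [Finset.mem_toLeft] at hi
      have hxU : x ∉ U := fun h => by
        obtain ⟨h, _⟩ := (hUmem x).1 h
        exact h.2 rfl
      have hUS : ∀ v ∈ S, v ∉ U := fun v hv h => by
        obtain ⟨h, _⟩ := (hUmem v).1 h
        exact h.1 hv
      set B : Finset V := Finset.univ.filter (fun v => v ∉ insert x U ∧ ∃ u ∈ insert x U, G.Adj u v) with hBdef
      have hB := boundary_card G (insert x U) B x (by simp) (by intro v; simp [hBdef]) t ht
        (htS.trans (Finset.card_le_card (by
          intro v hv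
          have := hUS v hv
          simp [this]
          rintro rfl; exact hxS hv)))
      have hBsub : B ⊆ Q.biUnion N := by
        intro v hv
        simp only [hBdef, Finset.mem_filter, Finset.mem_univ, true_and, Finset.mem_insert,
          not_or] at hv
        obtain ⟨⟨hv1, hv2⟩, u, hu, huv⟩ := hv
        rw [Finset.mem_biUnion]
        rcases hu with rfl | hu
        · exact ⟨_, hi, by simpa [N] using huv⟩
        · obtain ⟨h, hQ⟩ := (hUmem u).1 hu
          exact ⟨_, hQ, by simp [N, hv1, huv]⟩
      have hdisj : Disjoint B U := by
        rw [Finset.disjoint_left]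
        intro v hv hvU
        simp [hBdef, hvU] at hv
      have h1 := Finset.card_le_card (Finset.union_subset hBsub hUsub)
      rw [Finset.card_union_of_disjoint hdisj] at h1
      omega
    · have : Q.toLeft.card = 0 := by
        rw [Finset.card_eq_zero]; simpa [Finset.not_nonempty_iff_eq_empty] using hne
      have := Finset.card_le_card hUsub
      omega)
  refine ⟨f, hf, ?_, ?_⟩
  · intro i
    simpa [N] using hfN (Sum.inl i)
  · intro v
    simpa [N] using hfN (Sum.inr v)

lemma fan {V : Type*} [Fintype V] (G : SimpleGraph V) (S : Finset V) (x : V)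
    (hxS : x ∉ S) (t : ℕ) (ht : t ≤ vertexConnectivity G) (htS : t ≤ S.card) :
    ∃ (y : Fin t → V) (q : Fin t → List V),
      (∀ i, y i ∈ S) ∧ (∀ i, ∀ v ∈ q i, v ∉ S ∧ v ≠ x) ∧
      (∀ i, List.IsChain G.Adj (x :: q i ++ [y i])) ∧ (∀ i, (q i).Nodup) ∧
      (∀ i j, i ≠ j → y i ≠ y j ∧ List.Disjoint (q i) (q j)) := by
  obtain ⟨f, hf, hfl, hfr⟩ := fan_injection G S x hxS t ht htS
  let F : V → V := fun v => if h : v ∉ S ∧ v ≠ x then f (Sum.inr ⟨v, h⟩) else v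
  let o : Fin t → ℕ → V := fun i n => F^[n] (f (Sum.inl i))
  have ho : ∀ i n, o i (n + 1) = F (o i n) := fun i n => Function.iterate_succ_apply' _ _ _
  have hox : ∀ i n, o i n ≠ x := by
    intro i n
    induction n with
    | zero => exact (hfl i).ne'
    | succ n ih =>
      rw [ho]
      by_cases h : o i n ∉ S ∧ o i n ≠ x
      · simp only [F, h]; simpa [h] using (hfr ⟨o i n, h⟩).1
      · simp only [F, h]; simpa using ih
  have hstep : ∀ i n (h : o i n ∉ S), o i (n + 1) = f (Sum.inr ⟨o i n, h, hox i n⟩) := by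
    intro i n h
    rw [ho]
    have h' : o i n ∉ S ∧ o i n ≠ x := ⟨h, hox i n⟩
    simp only [F]
    rw [dif_pos h']
  have hinj : ∀ n m i j, (∀ k < n, o i k ∉ S) → (∀ k < m, o j k ∉ S) → o i n = o j m →
      i = j ∧ n = m := by
    intro n
    induction n with
    | zero =>
      intro m i j _ hm h
      cases m with
      | zero =>
        have : f (Sum.inl i) = f (Sum.inl j) := h
        have := hf this
        simp at this
        exact ⟨this, rfl⟩
      | succ m =>
        rw [hstep j m (hm m (by omega))] at h
        have : f (Sum.inl i) = _ := h
        have := hf this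
        simp at this
    | succ n ih =>
      intro m i j hn hm h
      cases m with
      | zero =>
        rw [hstep i n (hn n (by omega))] at h
        have : _ = f (Sum.inl j) := h
        have := hf this
        simp at this
      | succ m =>
        rw [hstep i n (hn n (by omega)), hstep j m (hm m (by omega))] at h
        have := hf h
        simp at this
        obtain ⟨h1, h2⟩ := ih m i j (fun k hk => hn k (by omega)) (fun k hk => hm k (by omega)) this
        exact ⟨h1, by omega⟩
  have hex : ∀ i, ∃ n, o i n ∈ S := by
    intro i
    by_contra hcon
    push Not at hcon
    exact not_injective_infinite_finite (o i) (fun n m h =>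
      (hinj n m i i (fun k _ => hcon k) (fun k _ => hcon k) h).2)
  let L : Fin t → ℕ := fun i => Nat.find (hex i)
  have hL : ∀ i, o i (L i) ∈ S := fun i => Nat.find_spec (hex i)
  have hLm : ∀ i k, k < L i → o i k ∉ S := fun i k hk => Nat.find_min (hex i) hk
  refine ⟨fun i => o i (L i), fun i => (List.range (L i)).map (o i), hL, ?_, ?_, ?_, ?_⟩
  · intro i v hv
    simp only [List.mem_map, List.mem_range] at hv
    obtain ⟨k, hk, rfl⟩ := hv
    exact ⟨hLm i k hk, hox i k⟩
  · intro i
    have h1 : x :: (List.range (L i)).map (o i) ++ [o i (L i)]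
        = x :: (List.range (L i + 1)).map (o i) := by
      rw [List.range_succ]; simp
    rw [h1, List.isChain_cons]
    refine ⟨?_, ?_⟩
    · intro y hy
      rw [List.range_succ_eq_map] at hy
      simp at hy
      subst hy
      exact hfl i
    · rw [List.isChain_iff_getElem]
      intro k hk
      simp at hk ⊢
      have hkL : k < L i := by omega
      have h2 := hstep i k (hLm i k hkL)
      rcases (hfr ⟨o i k, hLm i k hkL, hox i k⟩).2 with h3 | h3
      · rw [← h2] at h3
        have := (hinj (k+1) k i i (fun m hm => hLm i m (by omega)) (fun m hm => hLm i m (by omega)) h3).2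
        omega
      · rw [h2]; exact h3
  · intro i
    refine List.Nodup.map_on ?_ List.nodup_range
    intro n hn m hm h
    simp at hn hm
    exact (hinj n m i i (fun k hk => hLm i k (by omega)) (fun k hk => hLm i k (by omega)) h).2
  · intro i j hij
    refine ⟨?_, ?_⟩
    · intro h
      exact hij (hinj _ _ i j (fun k hk => hLm i k hk) (fun k hk => hLm j k hk) h).1
    · intro v hv hv'
      simp only [List.mem_map, List.mem_range] at hv hv'
      obtain ⟨n, hn, rfl⟩ := hv
      obtain ⟨m, hm, h⟩ := hv'
      exact hij (hinj n m i j (fun k hk => hLm i k (by omega)) (fun k hk => hLm j k (by omega)) h.symm).1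

end Part2

section Part3
open SimpleGraph Classical

/-- A cyclic list of distinct vertices, consecutive ones adjacent. -/
def IsCyc {V : Type*} (G : SimpleGraph V) (l : List V) : Prop :=
  l.Nodup ∧ 2 ≤ l.length ∧ Cycle.Chain G.Adj (l : Cycle V)

lemma IsCyc.rot {V : Type*} {G : SimpleGraph V} {l l' : List V} (h : IsCyc G l) (hr : l ~r l') :
    IsCyc G l' := by
  refine ⟨hr.nodup_iff.1 h.1, hr.perm.length_eq ▸ h.2.1, ?_⟩
  rw [← Cycle.coe_eq_coe.2 hr]
  exact h.2.2

lemma isChain_rev {V : Type*} {G : SimpleGraph V} {l : List V} (h : List.IsChain G.Adj l) :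
    List.IsChain G.Adj l.reverse := by
  rw [List.isChain_reverse]
  exact h.imp (fun _ _ h => h.symm)

lemma rot_cons_eq {V : Type*} {y : V} {l l' : List V} (hnd : (y :: l).Nodup)
    (h : (y :: l) ~r (y :: l')) : l = l' := by
  obtain ⟨n, hn, h⟩ := List.isRotated_iff_mod.1 h
  rcases Nat.eq_or_lt_of_le hn with hn | hn
  · rw [hn, List.rotate_length] at h
    simpa using h
  · have h1 : ((y :: l).rotate n)[0]'(by simp) = y := by simp only [h]; rfl
    rw [List.getElem_rotate] at h1
    simp only [zero_add, Nat.mod_eq_of_lt hn] at h1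
    have h2 : (y :: l)[n] = (y :: l)[0]'(by simp) := by rw [h1]; rfl
    have := (hnd.getElem_inj_iff).1 h2
    subst this
    simpa using h

/-- A path of the fan. -/
def GoodPath {V : Type*} (G : SimpleGraph V) (C : List V) (x : V) (q : List V) (y : V) : Prop :=
  List.IsChain G.Adj (x :: q ++ [y]) ∧ q.Nodup ∧ ∀ v ∈ q, v ∉ C ∧ v ≠ x

lemma surgeryA {V : Type*} {G : SimpleGraph V} {C : List V} (hC : IsCyc G C) {x : V} (hx : x ∉ C)
    {y z : V} {a b q₁ q₂ : List V} (hrot : C ~r (y :: a ++ z :: b))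
    (h₁ : GoodPath G C x q₁ y) (h₂ : GoodPath G C x q₂ z) (hd : List.Disjoint q₁ q₂) :
    IsCyc G (x :: (q₂ ++ z :: (b ++ y :: q₁.reverse))) := by
  have hC' := hC.rot hrot
  have hmem : ∀ v, v ∈ C ↔ v ∈ y :: a ++ z :: b := fun v => hrot.mem_iff
  obtain ⟨c1, n1, m1⟩ := h₁
  obtain ⟨c2, n2, m2⟩ := h₂
  simp only [hmem] at m1 m2 hx
  obtain ⟨hn, -, hc⟩ := hC'
  refine ⟨?_, by simp; omega, ?_⟩
  · clear hrot hC hmem c1 c2 hc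
    simp only [List.nodup_cons, List.nodup_append, List.mem_append, List.mem_cons, List.mem_reverse,
      List.nodup_reverse, List.cons_append, List.Disjoint] at *
    grind
  · rw [Cycle.chain_coe_cons] at *
    have e1 : a ++ z :: b ++ [y] = a ++ z :: (b ++ [y]) := by simp
    have hc : List.IsChain G.Adj (y :: a ++ z :: (b ++ [y])) := by simpa using hc
    have h1 := (List.isChain_split.1 hc).2
    have h2 := isChain_rev c1
    have : x :: ((q₂ ++ z :: (b ++ y :: q₁.reverse)) ++ [x])
      = (x :: q₂) ++ z :: (b ++ y :: (q₁.reverse ++ [x])) := by simp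
    rw [this, List.isChain_split]
    refine ⟨c2, ?_⟩
    rw [← List.cons_append, List.isChain_split]
    exact ⟨by simpa using h1, by simpa using h2⟩

lemma surgeryB {V : Type*} {G : SimpleGraph V} {C : List V} (hC : IsCyc G C) {x : V} (hx : x ∉ C)
    {y z y' z' : V} {a b a' d q₁ q₂ : List V}
    (hrot : C ~r (y :: (a ++ z :: (b ++ y' :: (a' ++ z' :: d)))))
    (h₁ : GoodPath G C x q₁ y) (h₂ : GoodPath G C x q₂ y') (hd : List.Disjoint q₁ q₂)
    (hzz : G.Adj z z') :
    IsCyc G (x :: (q₂ ++ y' :: (b.reverse ++ z :: z' :: (d ++ y :: q₁.reverse)))) := by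
  have hC' := hC.rot hrot
  have hmem : ∀ v, v ∈ C ↔ v ∈ (y :: (a ++ z :: (b ++ y' :: (a' ++ z' :: d)))) :=
    fun v => hrot.mem_iff
  obtain ⟨c1, n1, m1⟩ := h₁
  obtain ⟨c2, n2, m2⟩ := h₂
  simp only [hmem] at m1 m2 hx
  obtain ⟨hn, -, hc⟩ := hC'
  refine ⟨?_, by simp; omega, ?_⟩
  · clear hrot hC hmem c1 c2 hc hzz
    simp only [List.nodup_cons, List.nodup_append, List.mem_append, List.mem_cons, List.mem_reverse,
      List.nodup_reverse, List.Disjoint] at *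
    grind
  · rw [Cycle.chain_coe_cons] at *
    have hc : List.IsChain G.Adj ((y :: a) ++ z :: (b ++ y' :: (a' ++ z' :: (d ++ [y])))) := by
      simpa using hc
    have h1 := (List.isChain_split.1 hc).2
    rw [← List.cons_append, List.isChain_split] at h1
    obtain ⟨k1, k0⟩ := h1
    rw [← List.cons_append] at k0
    have k2 := (List.isChain_split.1 k0).2
    have h2 := isChain_rev c1
    have h3 := isChain_rev k1
    have : x :: ((q₂ ++ y' :: (b.reverse ++ z :: z' :: (d ++ y :: q₁.reverse))) ++ [x])
      = (x :: q₂) ++ y' :: (b.reverse ++ z :: z' :: (d ++ y :: (q₁.reverse ++ [x]))) := by simp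
    rw [this, List.isChain_split]
    refine ⟨c2, ?_⟩
    rw [← List.cons_append, List.isChain_split]
    refine ⟨by simpa using h3, ?_⟩
    rw [List.isChain_cons_cons]
    refine ⟨hzz, ?_⟩
    rw [← List.cons_append, List.isChain_split]
    exact ⟨by simpa using k2, by simpa using h2⟩

lemma exists_first {V : Type*} (X : Set V) (l : List V) (h : ∃ v ∈ l, v ∈ X) :
    ∃ a z b, l = a ++ z :: b ∧ z ∈ X ∧ ∀ v ∈ a, v ∉ X := by
  induction l with
  | nil => simp at h
  | cons u l ih =>
    by_cases hu : u ∈ X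
    · exact ⟨[], u, l, rfl, hu, by simp⟩
    · obtain ⟨a, z, b, rfl, hz, ha⟩ := ih (by
        obtain ⟨v, hv, hvX⟩ := h
        rcases List.mem_cons.1 hv with rfl | hv
        · exact absurd hvX hu
        · exact ⟨v, hv, hvX⟩)
      exact ⟨u :: a, z, b, rfl, hz, by simpa [hu] using ha⟩

lemma cycle_step {V : Type*} [Fintype V] (G : SimpleGraph V) (X : Set V)
    (hκ : 2 ≤ vertexConnectivity G)
    (hindep : ∀ Y : Set V, Y ⊆ X →
      (∀ u ∈ Y, ∀ v ∈ Y, u ≠ v → ¬G.Adj u v) → Y.ncard ≤ vertexConnectivity G)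
    (C : List V) (hC : IsCyc G C) (x : V) (hxX : x ∈ X) (hx : x ∉ C) :
    ∃ C', IsCyc G C' ∧ x ∈ C' ∧ ∀ v ∈ X, v ∈ C → v ∈ C' := by
  by_contra hcon
  have hcon : ∀ C', IsCyc G C' → x ∈ C' → (∀ v ∈ X, v ∈ C → v ∈ C') → False :=
    fun C' h1 h2 h3 => hcon ⟨C', h1, h2, h3⟩
  have hCcard : C.toFinset.card = C.length := List.toFinset_card_of_nodup hC.1
  obtain ⟨t, htdef⟩ : ∃ t, t = min (vertexConnectivity G) C.length := ⟨_, rfl⟩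
  have ht2 : 2 ≤ t := by have := hC.2.1; omega
  obtain ⟨y, q, hyS, hqS, hqc, hqn, hdis⟩ := fan G C.toFinset x (by simpa using hx) t (by omega)
    (by omega)
  simp only [List.mem_toFinset] at hyS hqS
  have hgood : ∀ i, GoodPath G C x (q i) (y i) := fun i => ⟨hqc i, hqn i, hqS i⟩
  have lemA : ∀ (y z : V) (a b q₁ q₂ : List V), C ~r (y :: a ++ z :: b) → GoodPath G C x q₁ y →
      GoodPath G C x q₂ z → List.Disjoint q₁ q₂ → (∀ v ∈ a, v ∉ X) → False := by
    intro y z a b q₁ q₂ hrot h1 h2 hd ha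
    refine hcon _ (surgeryA hC hx hrot h1 h2 hd) (by simp) ?_
    intro v hv hvC
    rw [hrot.mem_iff] at hvC
    have := ha v
    simp at hvC ⊢
    tauto
  have hother : ∀ i : Fin t, ∃ j, j ≠ i := by
    intro i
    have : Nontrivial (Fin t) := Fin.nontrivial_iff_two_le.2 ht2
    exact exists_ne i
  have hz : ∀ i, ∃ a z b, C ~r (y i :: (a ++ z :: b)) ∧ z ∈ X ∧ ∀ v ∈ a, v ∉ X := by
    intro i
    obtain ⟨l1, l2, hl⟩ := List.append_of_mem (hyS i)
    have hrot : C ~r (y i :: (l2 ++ l1)) := by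
      rw [hl]; exact List.isRotated_append
    have hex : ∃ v ∈ l2 ++ l1, v ∈ X := by
      by_contra hno
      push Not at hno
      obtain ⟨j, hj⟩ := hother i
      have hm : y j ∈ y i :: (l2 ++ l1) := hrot.mem_iff.1 (hyS j)
      rcases List.mem_cons.1 hm with hm | hm
      · exact (hdis j i hj).1 hm
      · obtain ⟨a, b, hab⟩ := List.append_of_mem hm
        rw [hab] at hrot hno
        exact lemA (y i) (y j) a b (q i) (q j) hrot (hgood i) (hgood j) (hdis i j hj.symm).2
          (fun v hv => hno v (by simp [hv]))
    obtain ⟨a, z, b, hab, hzX, ha⟩ := exists_first X _ hex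
    exact ⟨a, z, b, hab ▸ hrot, hzX, ha⟩
  choose a z b hrot hzX haX using hz
  have hzC : ∀ i, z i ∈ C := fun i => (hrot i).mem_iff.2 (by simp)
  have hya : ∀ i j, i ≠ j → y j ∉ a i ∧ y j ≠ z i := by
    intro i j hij
    refine ⟨?_, ?_⟩
    · intro hm
      obtain ⟨u, v, huv⟩ := List.append_of_mem hm
      have h1 := hrot i
      have h2 := haX i
      rw [huv] at h1 h2
      exact lemA (y i) (y j) u (v ++ z i :: b i) (q i) (q j) (by simpa using h1) (hgood i) (hgood j)
        (hdis i j hij).2 (fun w hw => h2 w (by simp [hw]))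
    · intro hm
      exact lemA (y i) (y j) (a i) (b i) (q i) (q j) (by rw [hm]; exact hrot i) (hgood i)
        (hgood j) (hdis i j hij).2 (haX i)
  have hdecomp : ∀ i j, i ≠ j → ∃ c d, C ~r (y i :: (a i ++ z i :: (c ++ y j :: (a j ++ z j :: d)))) := by
    intro i j hij
    obtain ⟨n1, n2⟩ := hya i j hij
    obtain ⟨n3, n4⟩ := hya j i hij.symm
    have hm : y j ∈ y i :: (a i ++ z i :: b i) := (hrot i).mem_iff.1 (hyS j)
    have hm' : y j ∈ b i := by
      have := (hdis j i hij.symm).1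
      simp at hm
      tauto
    obtain ⟨c, v, hcv⟩ := List.append_of_mem hm'
    have hr1 : C ~r (y i :: (a i ++ z i :: (c ++ y j :: v))) := hcv ▸ hrot i
    have hr2 : C ~r (y j :: (v ++ y i :: (a i ++ z i :: c))) := by
      refine hr1.trans ?_
      have : (y i :: (a i ++ z i :: (c ++ y j :: v))) = (y i :: (a i ++ z i :: c)) ++ (y j :: v) := by
        simp
      rw [this]
      exact List.isRotated_append
    have heq := rot_cons_eq (hC.rot hr2).1 (hr2.symm.trans (hrot j))
    have hv : ∃ d, v = a j ++ z j :: d := by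
      have heq' : v ++ y i :: (a i ++ z i :: c) = (a j ++ [z j]) ++ b j := by simpa using heq
      rcases List.append_eq_append_iff.1 heq' with ⟨e, he1, he2⟩ | ⟨e, he1, he2⟩
      · cases e with
        | nil => exact ⟨[], by simpa using he1.symm⟩
        | cons e0 e =>
          simp at he2
          have : y i ∈ a j ++ [z j] := by rw [he1, he2.1]; simp
          simp at this
          tauto
      · exact ⟨e, by simpa using he1⟩
    obtain ⟨d, rfl⟩ := hv
    exact ⟨c, d, hr1⟩
  have hzinj : Function.Injective z := by
    intro i j h
    by_contra hij
    obtain ⟨c, d, hr⟩ := hdecomp i j hij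
    have := (hC.rot hr).1
    rw [h] at this
    simp [List.nodup_append] at this
  have hxz : ∀ i, ¬ G.Adj x (z i) := by
    intro i h
    exact lemA (y i) (z i) (a i) (b i) (q i) [] (hrot i) (hgood i) ⟨by simpa using h, by simp, by simp⟩
      (by simp) (haX i)
  have hzz : ∀ i j, i ≠ j → ¬ G.Adj (z i) (z j) := by
    intro i j hij h
    obtain ⟨c, d, hr⟩ := hdecomp i j hij
    refine hcon _ (surgeryB hC hx hr (hgood i) (hgood j) (hdis i j hij).2 h) (by simp) ?_
    intro v hv hvC
    rw [hr.mem_iff] at hvC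
    have h1 := haX i v
    have h2 := haX j v
    simp at hvC ⊢
    tauto
  have hxr : x ∉ Set.range z := by
    rintro ⟨i, rfl⟩
    exact hx (hzC i)
  have hcount := hindep (insert x (Set.range z)) (by
      rintro v (rfl | ⟨i, rfl⟩)
      · exact hxX
      · exact hzX i) (by
      rintro u (rfl | ⟨i, rfl⟩) v (rfl | ⟨j, rfl⟩) huv
      · exact absurd rfl huv
      · exact hxz j
      · exact fun h => hxz i h.symm
      · exact hzz i j (fun h => huv (h ▸ rfl)))
  rw [Set.ncard_insert_of_notMem hxr (Set.toFinite _), ← Set.image_univ,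
    Set.ncard_image_of_injective _ hzinj, Set.ncard_univ] at hcount
  simp at hcount
  have htC : t = C.length := by omega
  have hyinj : Function.Injective y := by
    intro i j h
    by_contra hij
    exact (hdis i j hij).1 h
  have himg : Finset.univ.image y = C.toFinset := by
    apply Finset.eq_of_subset_of_card_le
    · intro v hv
      simp at hv ⊢
      obtain ⟨i, rfl⟩ := hv
      exact hyS i
    · rw [Finset.card_image_of_injective _ hyinj]
      simp
      omega
  let i : Fin t := ⟨0, by omega⟩
  have : z i ∈ Finset.univ.image y := by rw [himg]; simpa using hzC i
  simp at this
  obtain ⟨j, hj⟩ := this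
  by_cases hij : i = j
  · have := (hC.rot (hrot i)).1
    rw [← hj, hij] at this
    simp at this
  · exact (hya i j hij).2 hj

end Part3


/-- Let `G` be a 2-vertex-connected simple graph on `n` vertices,
`T` a spanning tree of `G`, and `X` the set of vertices of odd degree in `T`.
If every independent subset of `X` has size at most `κ(G)`, then `G` has a TSP
tour of length at most `4n/3`. -/
theorem graphTSP_of_independence_condition {V : Type*} [Fintype V]
    (G : SimpleGraph V)
    (hcard : 3 ≤ Fintype.card V)
    (h2conn : ∀ v : V, (G.induce {v}ᶜ).Connected)
    (T : SimpleGraph V) (hTG : T ≤ G) (hT : T.IsTree)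
    (hindep : ∀ Y : Set V, Y ⊆ {v : V | Odd (T.neighborSet v).ncard} →
      (∀ u ∈ Y, ∀ v ∈ Y, u ≠ v → ¬G.Adj u v) → Y.ncard ≤ vertexConnectivity G) :
    ∃ (r : V) (w : G.Walk r r), (∀ x : V, x ∈ w.support) ∧
      (w.length : ℚ) ≤ 4 * (Fintype.card V) / 3 := by
  classical
  have hG : G.Connected := hT.connected.mono hTG
  have hκ := two_le_vertexConnectivity G hcard hG h2conn
  obtain ⟨X, hX⟩ : ∃ X : Finset V, ∀ v, v ∈ X ↔ Odd (T.neighborSet v).ncard :=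
    ⟨Finset.univ.filter (fun v => Odd (T.neighborSet v).ncard), fun v => by simp⟩
  have hset : {v : V | Odd (T.neighborSet v).ncard} = (X : Set V) := by
    ext v; simp [hX]
  rw [hset] at hindep
  have key : ∀ m ≤ X.card, ∃ C, IsCyc G C ∧ m ≤ (X.filter (· ∈ C)).card := by
    intro m
    induction m with
    | zero =>
      intro _
      obtain ⟨r⟩ := hG.nonempty
      have hx : ∃ x, x ∉ ({r} : Set V) := by
        by_contra h
        push Not at h
        have : Fintype.card V ≤ 1 := Fintype.card_le_one_iff.2 (fun a b => (h a).trans (h b).symm)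
        omega
      obtain ⟨u, u', hu, hu', ha⟩ := crossing hG.preconnected r {r} rfl hx
      refine ⟨[u, u'], ⟨by simpa using ha.ne, by simp, ?_⟩, by simp⟩
      rw [Cycle.chain_coe_cons]
      simp [ha, ha.symm]
    | succ m ih =>
      intro hm
      obtain ⟨C, hC, hmC⟩ := ih (by omega)
      by_cases hall : ∀ x ∈ X, x ∈ C
      · refine ⟨C, hC, ?_⟩
        rw [Finset.filter_true_of_mem hall]
        exact hm
      · push Not at hall
        obtain ⟨x, hxX, hxC⟩ := hall
        obtain ⟨C', hC', hx', hsub⟩ := cycle_step G (X : Set V) hκ hindep C hC x hxX hxC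
        refine ⟨C', hC', ?_⟩
        have h1 : insert x (X.filter (· ∈ C)) ⊆ X.filter (· ∈ C') := by
          intro v hv
          simp at hv ⊢
          rcases hv with rfl | hv
          · exact ⟨hxX, hx'⟩
          · exact ⟨hv.1, hsub v hv.1 hv.2⟩
        have h2 := Finset.card_le_card h1
        rw [Finset.card_insert_of_notMem (by simp [hxC])] at h2
        omega
  obtain ⟨C, hC, hcC⟩ := key X.card le_rfl
  have hfil : X.filter (· ∈ C) = X := Finset.eq_of_subset_of_card_le (Finset.filter_subset _ _) hcC
  have hall : ∀ v ∈ X, v ∈ C := fun v hv => by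
    rw [← hfil] at hv
    exact (Finset.mem_filter.1 hv).2
  cases C with
  | nil => exact absurd hC.2.1 (by simp)
  | cons r l =>
    have hch := hC.2.2
    rw [Cycle.chain_coe_cons] at hch
    exact tour_of_cycle G T hTG hT r l hC.1 (by simpa using hch) (fun v hv => hall v ((hX v).2 hv))
end

section
/- Let G be a 2-vertex-connected simple graph on n vertices that has a depth-first-search spanning tree with at most k leaves. Then G has a TSP tour of length at most 4n/3 + 2k/3. -/
namespace TSPAux
open scoped Classical in
noncomputable def bd {E N : Type*} [Fintype E] (a b : E → N) (J : E → ZMod 2) (v : N) : ZMod 2 :=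
  ∑ e, J e * ((if a e = v then 1 else 0) + (if b e = v then 1 else 0))

open scoped Classical in
noncomputable def wt {E : Type*} [Fintype E] (w : E → ℝ) (J : E → ZMod 2) : ℝ :=
  ∑ e, if J e = 0 then 0 else w e

open scoped Classical in
noncomputable def pt {N : Type*} (u : N) : N → ZMod 2 := fun v => if u = v then 1 else 0

def ERel {E N : Type*} (a b : E → N) (P : E → Prop) (u v : N) : Prop :=
  ∃ e, P e ∧ ((a e = u ∧ b e = v) ∨ (a e = v ∧ b e = u))

lemma z2 (x : ZMod 2) : x = 0 ∨ x = 1 := by revert x; decide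
lemma z2add (x : ZMod 2) : x + x = 0 := by revert x; decide

section
variable {E N : Type*} [Fintype E] (a b : E → N)

lemma bd_add (J K : E → ZMod 2) : bd a b (J + K) = bd a b J + bd a b K := by
  funext v
  simp [bd, add_mul, Finset.sum_add_distrib]

lemma bd_pt (e : E) : bd a b (pt e) = pt (a e) + pt (b e) := by
  classical
  funext v
  simp [bd, pt]

lemma pt_add (u : N) : pt u + pt u = 0 := by
  funext v; simp [z2add]

lemma fadd (f : N → ZMod 2) : f + f = 0 := by
  funext v; simp [z2add]

lemma pairing [Fintype N] (J : E → ZMod 2) (s : N → ZMod 2) :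
    ∑ v, s v * bd a b J v = ∑ e, J e * (s (a e) + s (b e)) := by
  classical
  simp only [bd, Finset.mul_sum]
  rw [Finset.sum_comm]
  refine Finset.sum_congr rfl fun e _ => ?_
  simp only [mul_left_comm, ← Finset.mul_sum, mul_add, Finset.sum_add_distrib]
  simp

lemma wt_le (w : E → ℝ) (hw : ∀ e, 0 ≤ w e) (J : E → ZMod 2) : 0 ≤ wt w J := by
  classical
  refine Finset.sum_nonneg fun e _ => ?_
  split_ifs
  · exact le_rfl
  · exact hw e

lemma wt_zero_add (w : E → ℝ) (K X : E → ZMod 2) (h : ∀ e, X e ≠ 0 → w e = 0) :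
    wt w (K + X) = wt w K := by
  classical
  refine Finset.sum_congr rfl fun e _ => ?_
  by_cases hX : X e = 0
  · simp [hX]
  · simp [h e hX]

lemma wt_pt (w : E → ℝ) (K : E → ZMod 2) (e : E) (he : K e ≠ 0) :
    wt w (K + pt e) = wt w K - w e := by
  classical
  have : wt w K - wt w (K + pt e) = ∑ e', if e' = e then w e else 0 := by
    unfold wt
    rw [← Finset.sum_sub_distrib]
    refine Finset.sum_congr rfl fun e' _ => ?_
    by_cases h : e' = e
    · subst h
      have h1 : K e' = 1 := (z2 _).resolve_left he
      have : (1 + 1 : ZMod 2) = 0 := by decide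
      simp [pt, h1, this]
    · simp [pt, h, Ne.symm h]
  simp at this
  linarith

lemma wt_exch (w : E → ℝ) (J K P : E → ZMod 2) (h : ∀ e, P e ≠ 0 → (J + K) e ≠ 0) :
    wt w (J + P) + wt w (K + P) = wt w J + wt w K := by
  classical
  unfold wt
  rw [← Finset.sum_add_distrib, ← Finset.sum_add_distrib]
  refine Finset.sum_congr rfl fun e _ => ?_
  have h := h e
  simp only [Pi.add_apply] at *
  have h11 : (1 + 1 : ZMod 2) = 0 := by decide
  rcases z2 (J e) with h1 | h1 <;> rcases z2 (K e) with h2 | h2 <;> rcases z2 (P e) with h3 | h3 <;>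
    simp [h1, h2, h3, h11] at h ⊢

lemma reach_join {P : E → Prop} {u v : N} (h : Relation.ReflTransGen (ERel a b P) u v) :
    ∃ X : E → ZMod 2, (∀ e, X e ≠ 0 → P e) ∧ bd a b X = pt u + pt v := by
  classical
  induction h with
  | refl => exact ⟨0, by simp, by rw [pt_add]; funext v; simp [bd]⟩
  | @tail y z _ hyz ih =>
    obtain ⟨X, hX, hb⟩ := ih
    obtain ⟨e, he, h⟩ := hyz
    refine ⟨X + pt e, ?_, ?_⟩
    · intro e' he'
      by_cases h' : e = e'
      · exact h' ▸ he
      · apply hX; simpa [pt, h'] using he'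
    · rw [bd_add, hb, bd_pt]
      have := pt_add y
      rcases h with ⟨h1, h2⟩ | ⟨h1, h2⟩ <;> rw [h1, h2]
      · linear_combination this
      · linear_combination this

lemma step [Fintype N] (w : E → ℝ) (hw : ∀ e, 0 ≤ w e) (T : N → ZMod 2) (J0 : E → ZMod 2)
    (hJ0 : bd a b J0 = T) (hmin : ∀ J, bd a b J = T → wt w J0 ≤ wt w J) (hpos : 0 < wt w J0) :
    ∃ s : N → ZMod 2, (∀ e, s (a e) + s (b e) ≠ 0 → 0 < w e) ∧
      ∀ J, bd a b J = T → wt w J = wt w J0 →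
        ∃ e1, s (a e1) + s (b e1) ≠ 0 ∧ J e1 ≠ 0 ∧
          ∀ e, s (a e) + s (b e) ≠ 0 → J e ≠ 0 → e = e1 := by
  classical
  obtain ⟨e0, he0, hwe0⟩ : ∃ e, J0 e ≠ 0 ∧ 0 < w e := by
    by_contra! hcon
    have : wt w J0 ≤ 0 := by
      refine Finset.sum_nonpos fun e _ => ?_
      split_ifs with h
      · exact le_rfl
      · exact hcon e h
    linarith
  set x0 := a e0 with hx0
  let Q : Set (N × (E → ZMod 2)) := {p | bd a b p.2 = T + pt x0 + pt p.1}
  have hQ : (b e0, J0 + pt e0) ∈ Q := by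
    show bd a b (J0 + pt e0) = _
    rw [bd_add, bd_pt, hJ0, add_assoc]
  obtain ⟨⟨b0, K⟩, hKQ, hKmin⟩ := Set.exists_min_image Q (fun p => wt w p.2) (Set.toFinite _) ⟨_, hQ⟩
  have hK : bd a b K = T + pt x0 + pt b0 := hKQ
  have hKm : ∀ v K', bd a b K' = T + pt x0 + pt v → wt w K ≤ wt w K' :=
    fun v K' h => hKmin (v, K') h
  have hKJ : wt w K < wt w J0 := by
    have := hKm _ _ hQ
    rw [wt_pt w J0 e0 he0] at this
    linarith
  let B : N → Prop := fun v => Relation.ReflTransGen (ERel a b (fun e => w e = 0)) b0 v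
  have hBj : ∀ v, B v → ∃ X : E → ZMod 2, (∀ e, X e ≠ 0 → w e = 0) ∧ bd a b X = pt b0 + pt v :=
    fun v hv => reach_join a b hv
  have hx0B : ¬ B x0 := by
    intro h
    obtain ⟨X, hX, hXb⟩ := hBj _ h
    have h1 := hmin (K + X) (by
      rw [bd_add, hK, hXb]
      linear_combination pt_add x0 + pt_add b0)
    rw [wt_zero_add w K X hX] at h1
    linarith
  have hb0B : B b0 := Relation.ReflTransGen.refl
  let s : N → ZMod 2 := fun v => if B v then 1 else 0
  have hs : ∀ u v, s u + s v ≠ 0 ↔ ((B u ∧ ¬ B v) ∨ (B v ∧ ¬ B u)) := by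
    intro u v
    have h11 : (1 + 1 : ZMod 2) = 0 := by decide
    by_cases h1 : B u <;> by_cases h2 : B v <;> simp [s, h1, h2, h11]
  have hcross : ∀ e, s (a e) + s (b e) ≠ 0 → 0 < w e := by
    intro e he
    refine lt_of_le_of_ne (hw e) fun h0 => ?_
    rcases (hs _ _).1 he with ⟨h1, h2⟩ | ⟨h1, h2⟩
    · exact h2 (h1.tail ⟨e, h0.symm, Or.inl ⟨rfl, rfl⟩⟩)
    · exact h2 (h1.tail ⟨e, h0.symm, Or.inr ⟨rfl, rfl⟩⟩)
  have hstar : ∀ u K', B u → bd a b K' = T + pt x0 + pt u → wt w K' ≤ wt w K →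
      ∀ e, s (a e) + s (b e) ≠ 0 → K' e = 0 := by
    intro u K' hu hK' hle e he
    by_contra hne
    have hwe := hcross e he
    obtain ⟨X1, hX1, hX1b⟩ := hBj _ hu
    rcases (hs _ _).1 he with ⟨h1, h2⟩ | ⟨h1, h2⟩
    · obtain ⟨X2, hX2, hX2b⟩ := hBj _ h1
      have := hKm (b e) (K' + pt e + X1 + X2) (by
        rw [bd_add, bd_add, bd_add, hK', hX1b, hX2b, bd_pt]
        linear_combination pt_add u + pt_add b0 + pt_add (a e))
      rw [wt_zero_add w _ X2 hX2, wt_zero_add w _ X1 hX1, wt_pt w _ e hne] at this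
      linarith
    · obtain ⟨X2, hX2, hX2b⟩ := hBj _ h1
      have := hKm (a e) (K' + pt e + X1 + X2) (by
        rw [bd_add, bd_add, bd_add, hK', hX1b, hX2b, bd_pt]
        linear_combination pt_add u + pt_add b0 + pt_add (b e))
      rw [wt_zero_add w _ X2 hX2, wt_zero_add w _ X1 hX1, wt_pt w _ e hne] at this
      linarith
  refine ⟨s, hcross, fun J hJ hJw => ?_⟩
  let P : E → Prop := fun e => (J + K) e ≠ 0 ∧ ¬ B (a e) ∧ ¬ B (b e)
  let C : N → Prop := fun v => Relation.ReflTransGen (ERel a b P) x0 v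
  have hCB : ∀ v, C v → ¬ B v := by
    intro v hv
    rcases Relation.ReflTransGen.cases_tail hv with h | ⟨y, _, e, he, h⟩
    · rw [h]; exact hx0B
    · rcases h with ⟨h1, h2⟩ | ⟨h1, h2⟩
      · rw [← h2]; exact he.2.2
      · rw [← h1]; exact he.2.1
  obtain ⟨e1, c, b', he1, hc, hb', hends⟩ : ∃ e1 c b', (J + K) e1 ≠ 0 ∧ C c ∧ B b' ∧
      ((a e1 = c ∧ b e1 = b') ∨ (a e1 = b' ∧ b e1 = c)) := by
    by_contra hcon
    push Not at hcon
    let sC : N → ZMod 2 := fun v => if C v then 1 else 0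
    have h1 := pairing a b (J + K) sC
    have h2 : bd a b (J + K) = pt x0 + pt b0 := by
      rw [bd_add, hJ, hK]; linear_combination fadd T
    have h3 : ∑ v, sC v * bd a b (J + K) v = 1 := by
      rw [h2]
      have hCx : C x0 := Relation.ReflTransGen.refl
      have hCb : ¬ C b0 := fun h => hCB _ h hb0B
      simp [pt, mul_add, Finset.sum_add_distrib, sC, hCx, hCb]
    have h4 : ∑ e, (J + K) e * (sC (a e) + sC (b e)) = 0 := by
      refine Finset.sum_eq_zero fun e _ => ?_
      by_cases hN : (J + K) e = 0
      · rw [hN, zero_mul]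
      have h11 : (1 + 1 : ZMod 2) = 0 := by decide
      by_cases ha : C (a e) <;> by_cases hb : C (b e)
      · simp [sC, ha, hb, h11]
      · exfalso
        have hnB : ¬ B (b e) := fun h => (hcon e _ _ hN ha h).1 rfl rfl
        exact hb (Relation.ReflTransGen.tail ha ⟨e, ⟨hN, hCB _ ha, hnB⟩, Or.inl ⟨rfl, rfl⟩⟩)
      · exfalso
        have hnB : ¬ B (a e) := fun h => (hcon e _ _ hN hb h).2 rfl rfl
        exact ha (Relation.ReflTransGen.tail hb ⟨e, ⟨hN, hnB, hCB _ hb⟩, Or.inr ⟨rfl, rfl⟩⟩)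
      · simp [sC, ha, hb]
    rw [h3, h4] at h1
    exact absurd h1 (by decide)
  have hcr1 : s (a e1) + s (b e1) ≠ 0 := by
    rw [hs]
    rcases hends with ⟨h1, h2⟩ | ⟨h1, h2⟩ <;> rw [h1, h2]
    · exact Or.inr ⟨hb', hCB _ hc⟩
    · exact Or.inl ⟨hb', hCB _ hc⟩
  obtain ⟨X, hX, hXb⟩ := reach_join a b hc
  have hXc : ∀ e, s (a e) + s (b e) ≠ 0 → X e = 0 := by
    intro e he
    by_contra hne
    have := hX e hne
    rcases (hs _ _).1 he with ⟨h1, h2⟩ | ⟨h1, h2⟩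
    · exact this.2.1 h1
    · exact this.2.2 h1
  have hPb : bd a b (X + pt e1) = pt x0 + pt b' := by
    rw [bd_add, hXb, bd_pt]
    rcases hends with ⟨h1, h2⟩ | ⟨h1, h2⟩ <;> rw [h1, h2] <;> linear_combination pt_add c
  have hsub : ∀ e, (X + pt e1) e ≠ 0 → (J + K) e ≠ 0 := by
    intro e he
    by_cases h : e1 = e
    · exact h ▸ he1
    · exact (hX e (by simpa [pt, h] using he)).1
  have hex := wt_exch w J K (X + pt e1) hsub
  obtain ⟨X2, hX2, hX2b⟩ := hBj _ hb'
  have hge := hmin (K + (X + pt e1) + X2) (by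
    rw [bd_add, bd_add, hK, hPb, hX2b]
    linear_combination pt_add x0 + pt_add b0 + pt_add b')
  rw [wt_zero_add w _ X2 hX2] at hge
  have hno := hstar b' (J + (X + pt e1)) hb' (by rw [bd_add, hJ, hPb, add_assoc]) (by linarith)
  refine ⟨e1, hcr1, ?_, ?_⟩
  · intro h
    have := hno e1 hcr1
    simp [h, hXc e1 hcr1, pt] at this
  · intro e he hJe
    by_contra hne
    have := hno e he
    simp [hXc e he, pt, Ne.symm hne] at this
    exact hJe this

theorem ej [Fintype N] (w : E → ℝ) (hw : ∀ e, 0 ≤ w e) (T : N → ZMod 2)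
    (x : E → ℝ) (hx : ∀ e, 0 ≤ x e) (hT : ∃ J, bd a b J = T)
    (hcut : ∀ s : N → ZMod 2, ∑ v, s v * T v = 1 →
      1 ≤ ∑ e, if s (a e) + s (b e) = 0 then 0 else x e) :
    ∃ J, bd a b J = T ∧ wt w J ≤ ∑ e, w e * x e := by
  classical
  by_contra hcon
  push Not at hcon
  obtain ⟨J1, hJ1, hJ1m⟩ := Set.exists_min_image {J | bd a b J = T} (wt w) (Set.toFinite _) hT
  set η := wt w J1 - ∑ e, w e * x e with hη
  have hηpos : 0 < η := sub_pos.2 (hcon J1 hJ1)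
  let S : Set (E → ℝ) := Set.Icc 0 w ∩ {w' | ∀ J, bd a b J = T → ∑ e, w' e * x e + η ≤ wt w' J}
  have hS : IsCompact S := by
    refine isCompact_Icc.inter_right ?_
    have : {w' : E → ℝ | ∀ J, bd a b J = T → ∑ e, w' e * x e + η ≤ wt w' J} =
        ⋂ J : E → ZMod 2, ⋂ (_ : bd a b J = T), {w' | ∑ e, w' e * x e + η ≤ wt w' J} := by
      ext; simp
    rw [this]
    refine isClosed_iInter fun J => isClosed_iInter fun _ => isClosed_le (by fun_prop) ?_
    unfold wt
    refine continuous_finsetSum _ fun e _ => ?_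
    split_ifs <;> fun_prop
  have hwS : w ∈ S := by
    refine ⟨⟨hw, le_rfl⟩, fun J hJ => ?_⟩
    have := hJ1m J hJ
    linarith
  obtain ⟨w', hw'S, hw'min⟩ := hS.exists_isMinOn ⟨w, hwS⟩
    (f := fun w' => ∑ e, w' e) (by fun_prop)
  obtain ⟨⟨hw'0, hw'w⟩, hw'J⟩ := hw'S
  have hw'0 : ∀ e, 0 ≤ w' e := hw'0
  obtain ⟨J0, hJ0, hJ0m⟩ := Set.exists_min_image {J | bd a b J = T} (wt w') (Set.toFinite _) hT
  have hJ0 : bd a b J0 = T := hJ0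
  have hpos : 0 < wt w' J0 := by
    have h1 := hw'J J0 hJ0
    have h2 : 0 ≤ ∑ e, w' e * x e := Finset.sum_nonneg fun e _ => mul_nonneg (hw'0 e) (hx e)
    linarith
  obtain ⟨s, hs1, hs2⟩ := step a b w' hw'0 T J0 hJ0 hJ0m hpos
  have hsT : ∑ v, s v * T v = 1 := by
    obtain ⟨e1, h1, h2, h3⟩ := hs2 J0 hJ0 rfl
    rw [← hJ0, pairing, Finset.sum_eq_single e1]
    · rw [(z2 _).resolve_left h1, (z2 _).resolve_left h2, one_mul]
    · intro e _ hne
      by_cases h : s (a e) + s (b e) = 0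
      · rw [h, mul_zero]
      · by_cases h' : J0 e = 0
        · rw [h', zero_mul]
        · exact absurd (h3 e h h') hne
    · simp
  have hx1 := hcut s hsT
  let d : E → ℝ := fun e => if s (a e) + s (b e) = 0 then 0 else 1
  let W : ℝ → E → ℝ := fun ε e => w' e - ε * d e
  have hWJ : ∀ ε J, wt (W ε) J = wt w' J - ε * wt d J := by
    intro ε J
    simp only [wt, W, Finset.mul_sum]
    rw [← Finset.sum_sub_distrib]
    refine Finset.sum_congr rfl fun e _ => ?_
    split_ifs <;> simp
  have hev1 : ∀ e, ∀ᶠ ε in nhdsWithin (0 : ℝ) (Set.Ioi 0), 0 ≤ W ε e := by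
    intro e
    by_cases h : s (a e) + s (b e) = 0
    · refine Filter.Eventually.of_forall fun ε => ?_
      simp [W, d, h, hw'0 e]
    · have := hs1 e h
      have hc : Filter.Tendsto (fun ε => W ε e) (nhdsWithin (0 : ℝ) (Set.Ioi 0)) (nhds (W 0 e)) :=
        (Continuous.tendsto (by fun_prop) 0).mono_left nhdsWithin_le_nhds
      have h0 : 0 < W 0 e := by simpa [W] using this
      filter_upwards [hc.eventually (lt_mem_nhds h0)] with ε hε using hε.le
  have hev2 : ∀ J, ∀ᶠ ε in nhdsWithin (0 : ℝ) (Set.Ioi 0), bd a b J = T → wt w' J0 - ε ≤ wt (W ε) J := by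
    intro J
    by_cases hJ : bd a b J = T
    swap
    · exact Filter.Eventually.of_forall fun _ h => absurd h hJ
    rcases (hJ0m J hJ).lt_or_eq with hlt | heq
    · have hc : Filter.Tendsto (fun ε => wt w' J - ε * wt d J + ε) (nhdsWithin (0 : ℝ) (Set.Ioi 0))
          (nhds (wt w' J - 0 * wt d J + 0)) :=
        (Continuous.tendsto (f := fun ε => wt w' J - ε * wt d J + ε) (by fun_prop) 0).mono_left nhdsWithin_le_nhds
      have h0 : wt w' J0 < wt w' J - 0 * wt d J + 0 := by simpa using hlt
      filter_upwards [hc.eventually (lt_mem_nhds h0)] with ε hε _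
      rw [hWJ]; linarith
    · obtain ⟨e1, h1, h2, h3⟩ := hs2 J hJ heq.symm
      have : wt d J = 1 := by
        unfold wt
        rw [Finset.sum_eq_single e1]
        · simp [d, h1, h2]
        · intro e _ hne
          by_cases h : s (a e) + s (b e) = 0
          · simp [d, h]
          · by_cases h' : J e = 0
            · simp [h']
            · exact absurd (h3 e h h') hne
        · simp
      refine Filter.Eventually.of_forall fun ε _ => ?_
      rw [hWJ, this, ← heq]; linarith
  obtain ⟨ε, ⟨hε1, hε2⟩, hε0⟩ := (((Filter.eventually_all.2 hev1).and (Filter.eventually_all.2 hev2)).and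
    self_mem_nhdsWithin).exists
  have hε0 : 0 < ε := hε0
  have hd0 : ∀ e, 0 ≤ d e := by intro e; simp only [d]; split_ifs <;> norm_num
  have hWS : W ε ∈ S := by
    refine ⟨⟨hε1, fun e => ?_⟩, fun J hJ => ?_⟩
    · have := mul_nonneg hε0.le (hd0 e)
      have := hw'w e
      simp only [W]; linarith
    · have h1 := hε2 J hJ
      have h2 := hw'J J0 hJ0
      have h3 : ∑ e, W ε e * x e = ∑ e, w' e * x e - ε * ∑ e, (if s (a e) + s (b e) = 0 then 0 else x e) := by
        rw [Finset.mul_sum, ← Finset.sum_sub_distrib]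
        refine Finset.sum_congr rfl fun e _ => ?_
        simp only [W, d]
        split_ifs <;> ring
      nlinarith
  have hle : ∑ e, w' e ≤ ∑ e, W ε e := hw'min hWS
  have hsum : ∑ e, W ε e = ∑ e, w' e - ε * ∑ e, d e := by
    rw [Finset.mul_sum, ← Finset.sum_sub_distrib]
  have hdp : 0 < ∑ e, d e := by
    obtain ⟨e1, h1, -, -⟩ := hs2 J0 hJ0 rfl
    refine Finset.sum_pos' (fun e _ => hd0 e) ⟨e1, Finset.mem_univ _, ?_⟩
    simp [d, h1]
  nlinarith [mul_pos hε0 hdp]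
end
end TSPAux

namespace TSPAux
section
variable {E N : Type*} [Fintype E] (a b : E → N)

open scoped Classical in
theorem signed [Fintype N]
    (hbr : ∀ s : N → ZMod 2, (Finset.univ.filter fun e => s (a e) + s (b e) ≠ 0).card ≠ 1)
    (c : E → ℝ) : ∃ J, bd a b J = bd a b 1 ∧ wt c J ≤ (∑ e, c e) / 3 := by
  let n : E → ZMod 2 := fun e => if c e < 0 then 1 else 0
  let x : E → ℝ := fun e => if c e < 0 then 2/3 else 1/3
  obtain ⟨J, hJ, hJw⟩ := ej a b (fun e => |c e|) (fun e => abs_nonneg _) (bd a b (1 + n)) x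
    (by intro e; simp only [x]; split_ifs <;> norm_num) ⟨_, rfl⟩ (by
      intro s hs
      rw [pairing] at hs
      set D := Finset.univ.filter fun e => s (a e) + s (b e) ≠ 0 with hD
      set D' := D.filter fun e => c e < 0 with hD'
      have h1 : (∑ e, (1 + n) e * (s (a e) + s (b e))) = ((D.card + D'.card : ℕ) : ZMod 2) := by
        rw [Finset.card_eq_sum_ones D, hD', Finset.card_filter, ← Finset.sum_add_distrib, hD, Finset.sum_filter]
        push_cast
        refine Finset.sum_congr rfl fun e _ => ?_
        rcases z2 (s (a e) + s (b e)) with h | h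
        · simp [h]
        · simp [h, n]
      have h2 : (∑ e, if s (a e) + s (b e) = 0 then 0 else x e) = ((D.card + D'.card : ℕ) : ℝ) / 3 := by
        rw [Finset.card_eq_sum_ones D, hD', Finset.card_filter, ← Finset.sum_add_distrib, hD, Finset.sum_filter]
        push_cast
        rw [Finset.sum_div]
        refine Finset.sum_congr rfl fun e _ => ?_
        rcases z2 (s (a e) + s (b e)) with h | h
        · simp [h]
        · simp only [h, x]
          norm_num
          split_ifs <;> norm_num
      have hle : D'.card ≤ D.card := Finset.card_filter_le _ _
      have hne : D.card ≠ 1 := hbr s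
      rw [h1] at hs
      have hodd : (D.card + D'.card) % 2 = 1 := by
        have : ((D.card + D'.card : ℕ) : ZMod 2) = ((1 : ℕ) : ZMod 2) := by rw [hs]; simp
        exact (ZMod.natCast_eq_natCast_iff' _ _ _).1 this
      have h3 : 3 ≤ D.card + D'.card := by omega
      rw [h2]
      have : (3 : ℝ) ≤ ((D.card + D'.card : ℕ) : ℝ) := by exact_mod_cast h3
      linarith)
  refine ⟨J + n, ?_, ?_⟩
  · rw [bd_add, hJ, bd_add]; linear_combination fadd (bd a b n)
  · have h1 : wt c (J + n) = wt (fun e => |c e|) J + ∑ e, if c e < 0 then c e else 0 := by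
      unfold wt
      rw [← Finset.sum_add_distrib]
      refine Finset.sum_congr rfl fun e _ => ?_
      have h11 : (1 + 1 : ZMod 2) = 0 := by decide
      by_cases h : c e < 0
      · rcases z2 (J e) with h' | h' <;> simp [n, h, h', h11, abs_of_neg h]
      · rcases z2 (J e) with h' | h' <;> simp [n, h, h', abs_of_nonneg (not_lt.1 h)]
    have h2 : (∑ e, c e) / 3 = ∑ e, |c e| * x e + ∑ e, if c e < 0 then c e else 0 := by
      rw [← Finset.sum_add_distrib, Finset.sum_div]
      refine Finset.sum_congr rfl fun e _ => ?_
      by_cases h : c e < 0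
      · simp only [x, h, if_true, abs_of_neg h]; ring
      · simp only [x, h, if_false, abs_of_nonneg (not_lt.1 h)]; ring
    rw [h1, h2]; linarith

open scoped Classical in
noncomputable def inc (v : N) (e : E) : ℕ := (if a e = v then 1 else 0) + (if b e = v then 1 else 0)

open scoped Classical in
theorem cubic [Fintype N]
    (hbr : ∀ s : N → ZMod 2, (Finset.univ.filter fun e => s (a e) + s (b e) ≠ 0).card ≠ 1)
    (c : E → ℝ) (W : Finset N) (hW : ∀ v ∈ W, ∑ e, inc a b v e = 3) :
    ∃ J, bd a b J = bd a b 1 ∧ wt c J ≤ (∑ e, c e) / 3 ∧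
      ∀ v ∈ W, ∑ e, (if J e = 0 then 0 else inc a b v e) = 1 := by
  set M : ℝ := 2 * ∑ e, |c e| + 1 with hM
  have hM0 : 0 ≤ ∑ e, |c e| := Finset.sum_nonneg fun e _ => abs_nonneg _
  obtain ⟨J, hJ, hJw⟩ := signed a b hbr (fun e => c e + M * ∑ v ∈ W, (inc a b v e : ℝ))
  set cnt : N → ℕ := fun v => ∑ e, (if J e = 0 then 0 else inc a b v e) with hcnt
  have hpar : ∀ v ∈ W, cnt v % 2 = 1 := by
    intro v hv
    have h1 : ((cnt v : ℕ) : ZMod 2) = ((3 : ℕ) : ZMod 2) := by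
      rw [← hW v hv]
      have := congrFun hJ v
      have e1 : bd a b J v = (cnt v : ZMod 2) := by
        simp only [bd, hcnt]
        push_cast
        refine Finset.sum_congr rfl fun e _ => ?_
        rcases z2 (J e) with h | h <;> simp [h, inc]
      have e2 : bd a b 1 v = ((∑ e, inc a b v e : ℕ) : ZMod 2) := by
        simp only [bd]
        push_cast
        refine Finset.sum_congr rfl fun e _ => ?_
        simp [inc]
      rw [← e1, ← e2, this]
    exact (ZMod.natCast_eq_natCast_iff' _ _ _).1 h1
  have hL : wt (fun e => c e + M * ∑ v ∈ W, (inc a b v e : ℝ)) J = wt c J + M * ((∑ v ∈ W, cnt v : ℕ) : ℝ) := by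
    simp only [wt, hcnt]
    rw [Finset.sum_comm]
    push_cast
    rw [Finset.mul_sum, ← Finset.sum_add_distrib]
    refine Finset.sum_congr rfl fun e _ => ?_
    split_ifs <;> simp
  have hR : (∑ e, (c e + M * ∑ v ∈ W, (inc a b v e : ℝ))) = ∑ e, c e + M * (3 * W.card) := by
    rw [Finset.sum_add_distrib, ← Finset.mul_sum, Finset.sum_comm]
    congr 2
    have : ∀ v ∈ W, ∑ e, (inc a b v e : ℝ) = 3 := by
      intro v hv
      have := hW v hv
      exact_mod_cast this
    rw [Finset.sum_congr rfl this]
    simp [mul_comm]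
  rw [hL, hR] at hJw
  have hcardle : W.card ≤ ∑ v ∈ W, cnt v := by
    rw [Finset.card_eq_sum_ones]
    exact Finset.sum_le_sum fun v hv => by have := hpar v hv; omega
  have hcJ : -(∑ e, |c e|) ≤ wt c J := by
    unfold wt
    rw [← Finset.sum_neg_distrib]
    refine Finset.sum_le_sum fun e _ => ?_
    split_ifs
    · simp
    · exact neg_abs_le _
  have hcE : ∑ e, c e ≤ ∑ e, |c e| := Finset.sum_le_sum fun e _ => le_abs_self _
  have hall : ∑ v ∈ W, cnt v ≤ W.card := by
    by_contra hlt
    have h1 : W.card + 1 ≤ ∑ v ∈ W, cnt v := by omega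
    have h2 : (W.card : ℝ) + 1 ≤ ((∑ v ∈ W, cnt v : ℕ) : ℝ) := by exact_mod_cast h1
    have h3 := mul_le_mul_of_nonneg_left h2 (by linarith : 0 ≤ M)
    nlinarith
  refine ⟨J, hJ, ?_, ?_⟩
  · have h2 : (W.card : ℝ) ≤ ((∑ v ∈ W, cnt v : ℕ) : ℝ) := by exact_mod_cast hcardle
    have h3 := mul_le_mul_of_nonneg_left h2 (by linarith : 0 ≤ M)
    linarith
  · intro v hv
    have h1 : ∀ u ∈ W, 1 ≤ cnt u := fun u hu => by have := hpar u hu; omega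
    have h2 : ∑ u ∈ W, 1 = ∑ u ∈ W, cnt u := by
      rw [← Finset.card_eq_sum_ones]; omega
    exact ((Finset.sum_eq_sum_iff_of_le h1).1 h2 v hv).symm
end

/-! Euler walks -/
section
variable {E V : Type*} [Fintype E] (a b : E → V)

lemma reach_mono {P Q : E → Prop} (h : ∀ e, P e → Q e) {u v : V}
    (hr : Relation.ReflTransGen (ERel a b P) u v) : Relation.ReflTransGen (ERel a b Q) u v :=
  Relation.ReflTransGen.mono (fun _ _ ⟨e, he, h'⟩ => ⟨e, h e he, h'⟩) _ _ hr

lemma erel_symm {P : E → Prop} {u v : V} (h : ERel a b P u v) : ERel a b P v u := by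
  obtain ⟨e, he, h⟩ := h
  exact ⟨e, he, h.symm⟩

lemma reach_symm {P : E → Prop} {u v : V} (h : Relation.ReflTransGen (ERel a b P) u v) :
    Relation.ReflTransGen (ERel a b P) v u := by
  induction h with
  | refl => exact .refl
  | tail _ h ih => exact Relation.ReflTransGen.head (erel_symm a b h) ih

open scoped Classical in
noncomputable def ind (S : Finset E) : E → ZMod 2 := fun e => if e ∈ S then 1 else 0

theorem euler_s10 (G : SimpleGraph V) :
    ∀ (n : ℕ) (S : Finset E) (v u : V), S.card = n → (∀ e ∈ S, G.Adj (a e) (b e)) → bd a b (ind S) = pt v + pt u →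
    ∃ W : G.Walk v u, W.length ≤ S.card ∧
      ∀ z, Relation.ReflTransGen (ERel a b (· ∈ S)) v z → z ∈ W.support := by
  classical
  intro n
  induction n using Nat.strong_induction_on with
  | _ n ih =>
  intro S v u hn hG hS
  by_cases hex : ∃ e ∈ S, a e = v ∨ b e = v
  swap
  · push Not at hex
    have h0 : bd a b (ind S) v = 0 := by
      refine Finset.sum_eq_zero fun e _ => ?_
      by_cases he : e ∈ S
      · have := hex e he; simp [this.1, this.2]
      · simp [ind, he]
    have huv : u = v := by
      by_contra hne
      rw [hS] at h0
      simp [pt, hne] at h0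
    subst huv
    refine ⟨.nil, by simp, fun z hz => ?_⟩
    rcases Relation.ReflTransGen.cases_head hz with h | ⟨y, ⟨e, he, h⟩, _⟩
    · simp [h]
    · exfalso
      have := hex e he
      rcases h with h | h
      · exact this.1 h.1
      · exact this.2 h.2
  obtain ⟨e, heS, y, hye⟩ : ∃ e ∈ S, ∃ y, (a e = v ∧ b e = y) ∨ (a e = y ∧ b e = v) := by
    obtain ⟨e, he, h | h⟩ := hex
    · exact ⟨e, he, _, Or.inl ⟨h, rfl⟩⟩
    · exact ⟨e, he, _, Or.inr ⟨rfl, h⟩⟩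
  have hvy : G.Adj v y := by
    rcases hye with ⟨h1, h2⟩ | ⟨h1, h2⟩
    · rw [← h1, ← h2]; exact hG e heS
    · rw [← h1, ← h2]; exact (hG e heS).symm
  set S' := S.erase e with hS'
  have hcard : S'.card + 1 = S.card := Finset.card_erase_add_one heS
  have hind : ind S = ind S' + pt e := by
    funext e'
    by_cases h : e' = e
    · subst h; simp [ind, pt, hS', heS]
    · simp [ind, pt, hS', h, Ne.symm h]
  have hbS' : bd a b (ind S') = pt y + pt u := by
    rw [hind, bd_add, bd_pt] at hS
    rcases hye with ⟨h1, h2⟩ | ⟨h1, h2⟩ <;> rw [h1, h2] at hS <;>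
      linear_combination hS - pt_add y
  have hsplit : ∀ z, Relation.ReflTransGen (ERel a b (· ∈ S)) v z →
      Relation.ReflTransGen (ERel a b (· ∈ S')) v z ∨ Relation.ReflTransGen (ERel a b (· ∈ S')) y z := by
    intro z hz
    induction hz with
    | refl => exact Or.inl .refl
    | @tail p q _ hpq ih' =>
      obtain ⟨e', he', h⟩ := hpq
      by_cases hee : e' = e
      · subst hee
        rcases hye with ⟨h1, h2⟩ | ⟨h1, h2⟩ <;> rcases h with ⟨h3, h4⟩ | ⟨h3, h4⟩
        · right; rw [← h4, h2]
        · left; rw [← h3, h1]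
        · left; rw [← h4, h2]
        · right; rw [← h3, h1]
      · have hr : ERel a b (· ∈ S') p q := ⟨e', by simp [hS', hee, he'], h⟩
        rcases ih' with h' | h'
        · exact Or.inl (h'.tail hr)
        · exact Or.inr (h'.tail hr)
  let C : V → Prop := fun z => Relation.ReflTransGen (ERel a b (· ∈ S')) y z
  by_cases hvC : C v
  · obtain ⟨W, hW1, hW2⟩ := ih S'.card (by omega) S' y u rfl (fun e he => hG e (Finset.mem_of_mem_erase he)) hbS'
    refine ⟨.cons hvy W, by simp; omega, fun z hz => ?_⟩
    rw [SimpleGraph.Walk.support_cons]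
    refine List.mem_cons_of_mem _ (hW2 z ?_)
    rcases hsplit z hz with h | h
    · exact Relation.ReflTransGen.trans hvC h
    · exact h
  · have hCe : ∀ e ∈ S', (C (a e) ↔ C (b e)) := fun e he =>
      ⟨fun h => h.tail ⟨e, he, Or.inl ⟨rfl, rfl⟩⟩, fun h => h.tail ⟨e, he, Or.inr ⟨rfl, rfl⟩⟩⟩
    set Sy := S'.filter (fun e => C (a e)) with hSy
    set Sv := S'.filter (fun e => ¬ C (a e)) with hSv
    have hc2 : Sy.card + Sv.card = S'.card := Finset.card_filter_add_card_filter_not _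
    have hby : ∀ z, bd a b (ind Sy) z = if C z then bd a b (ind S') z else 0 := by
      intro z
      by_cases hz : C z
      · rw [if_pos hz]
        refine Finset.sum_congr rfl fun e _ => ?_
        by_cases he : e ∈ S'
        · by_cases hCa : C (a e)
          · simp [ind, hSy, he, hCa]
          · have h1 : a e ≠ z := fun h => hCa (h ▸ hz)
            have h2 : b e ≠ z := fun h => hCa ((hCe e he).2 (h ▸ hz))
            simp [h1, h2]
        · simp [ind, hSy, he]
      · rw [if_neg hz]
        refine Finset.sum_eq_zero fun e _ => ?_
        by_cases he : e ∈ Sy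
        · rw [hSy, Finset.mem_filter] at he
          have h1 : a e ≠ z := fun h => hz (h ▸ he.2)
          have h2 : b e ≠ z := fun h => hz (h ▸ (hCe e he.1).1 he.2)
          simp [h1, h2]
        · simp [ind, he]
    have huC : C u := by
      by_contra hu
      have hl := fun (z : V) => hby z
      have hfin : ∀ e, (if C (a e) then (1 : ZMod 2) else 0) * ind Sy e = ind Sy e := by
        intro e
        by_cases he : e ∈ Sy
        · have := (Finset.mem_filter.1 he).2
          simp [this]
        · simp [ind, he]
      -- parity on the finite set of endpoints
      let F : Finset V := insert y (Finset.univ.image a ∪ Finset.univ.image b)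
      have hs0 : ∑ z ∈ F, bd a b (ind Sy) z = 0 := by
        simp only [bd]
        rw [Finset.sum_comm]
        refine Finset.sum_eq_zero fun e _ => ?_
        rw [← Finset.mul_sum, Finset.sum_add_distrib]
        have h1 : a e ∈ F := by simp [F]
        have h2 : b e ∈ F := by simp [F]
        rw [Finset.sum_ite_eq, Finset.sum_ite_eq, if_pos h1, if_pos h2]
        have h11 : (1 + 1 : ZMod 2) = 0 := by decide
        rw [h11, mul_zero]
      have hs1 : ∑ z ∈ F, bd a b (ind Sy) z = 1 := by
        rw [Finset.sum_eq_single y]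
        · have hyC : C y := .refl
          have huy : u ≠ y := fun h => hu (h ▸ hyC)
          rw [hby, if_pos hyC, hbS']
          simp [pt, huy]
        · intro z _ hzy
          rw [hby]
          split_ifs with hz
          · have huz : u ≠ z := fun h => hu (h ▸ hz)
            rw [hbS']; simp [pt, huz, Ne.symm hzy]
          · rfl
        · intro h; simp [F] at h
      rw [hs0] at hs1
      exact absurd hs1 (by decide)
    have hbSy : bd a b (ind Sy) = pt y + pt u := by
      funext z
      rw [hby]
      split_ifs with hz
      · rw [hbS']
      · have hyC : C y := .refl
        have h1 : y ≠ z := fun h => hz (h ▸ hyC)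
        have h2 : u ≠ z := fun h => hz (h ▸ huC)
        simp [pt, h1, h2]
    have hbSv : bd a b (ind Sv) = pt v + pt v := by
      have : ind S' = ind Sy + ind Sv := by
        funext e
        by_cases h1 : e ∈ S' <;> by_cases h2 : C (a e) <;> simp [ind, hSy, hSv, h1, h2]
      have h3 := hbS'
      rw [this, bd_add, hbSy] at h3
      rw [pt_add]
      linear_combination h3
    obtain ⟨W1, hW1, hW1'⟩ := ih Sv.card (by omega) Sv v v rfl
      (fun e he => hG e (Finset.mem_of_mem_erase (Finset.mem_filter.1 he).1)) hbSv
    obtain ⟨W2, hW2, hW2'⟩ := ih Sy.card (by omega) Sy y u rfl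
      (fun e he => hG e (Finset.mem_of_mem_erase (Finset.mem_filter.1 he).1)) hbSy
    refine ⟨W1.append (.cons hvy W2), by simp; omega, fun z hz => ?_⟩
    rw [SimpleGraph.Walk.mem_support_append_iff]
    rcases hsplit z hz with h | h
    · left
      apply hW1'
      have : Relation.ReflTransGen (ERel a b (· ∈ Sv)) v z ∧ ¬ C z := by
        clear hz
        induction h with
        | refl => exact ⟨.refl, hvC⟩
        | @tail p q _ hpq ih' =>
          obtain ⟨e', he', h'⟩ := hpq
          have hnC : ¬ C (a e') := by
            rcases h' with ⟨h3, h4⟩ | ⟨h3, h4⟩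
            · rw [h3]; exact ih'.2
            · rw [hCe e' he', h4]; exact ih'.2
          refine ⟨ih'.1.tail ⟨e', by simp [hSv, he', hnC], h'⟩, ?_⟩
          rcases h' with ⟨h3, h4⟩ | ⟨h3, h4⟩
          · rw [← h4, ← hCe e' he']; exact hnC
          · rw [← h3]; exact hnC
      exact this.1
    · right
      rw [SimpleGraph.Walk.support_cons]
      refine List.mem_cons_of_mem _ (hW2' z ?_)
      have : Relation.ReflTransGen (ERel a b (· ∈ Sy)) y z ∧ C z := by
        clear hz
        induction h with
        | refl => exact ⟨.refl, .refl⟩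
        | @tail p q _ hpq ih' =>
          refine ⟨?_, ih'.2.tail hpq⟩
          obtain ⟨e', he', h'⟩ := hpq
          refine ih'.1.tail ⟨e', ?_, h'⟩
          have hC : C (a e') := by
            rcases h' with ⟨h3, h4⟩ | ⟨h3, h4⟩
            · rw [h3]; exact ih'.2
            · rw [hCe e' he', h4]; exact ih'.2
          simp [hSy, he', hC]
      exact this.1
end
end TSPAux

namespace TSPAux

structure RT (V : Type*) where
  r : V
  par : V → V
  dep : V → ℕ
  par_r : par r = r
  dep_par : ∀ v, v ≠ r → dep (par v) + 1 = dep v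

namespace RT
variable {V : Type*} (t : RT V)

def Anc (u v : V) : Prop := ∃ i, t.par^[i] v = u

lemma anc_refl (v : V) : t.Anc v v := ⟨0, rfl⟩

variable {t}
lemma anc_trans {u v x : V} (h1 : t.Anc u v) (h2 : t.Anc v x) : t.Anc u x := by
  obtain ⟨i, rfl⟩ := h1
  obtain ⟨j, rfl⟩ := h2
  exact ⟨i + j, Function.iterate_add_apply _ _ _ _⟩

variable (t) in
lemma anc_par (v : V) : t.Anc (t.par v) v := ⟨1, rfl⟩

lemma anc_cases {u v : V} (h : t.Anc u v) : u = v ∨ t.Anc u (t.par v) := by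
  obtain ⟨i, hi⟩ := h
  cases i with
  | zero => exact Or.inl hi.symm
  | succ i => exact Or.inr ⟨i, hi⟩

lemma anc_r {u : V} (h : t.Anc u t.r) : u = t.r := by
  obtain ⟨i, rfl⟩ := h
  induction i with
  | zero => rfl
  | succ i ih => rw [Function.iterate_succ_apply, t.par_r, ih]

lemma anc_dep_aux (n : ℕ) : ∀ u v : V, t.dep v = n → t.Anc u v → u = v ∨ t.dep u < t.dep v := by
  induction n with
  | zero =>
    intro u v hv h
    left
    by_cases hr : v = t.r
    · subst hr; exact anc_r h
    · have := t.dep_par v hr; omega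
  | succ n ih =>
    intro u v hv h
    by_cases hr : v = t.r
    · subst hr; exact Or.inl (anc_r h)
    have hd := t.dep_par v hr
    rcases anc_cases h with h | h
    · exact Or.inl h
    · rcases ih u (t.par v) (by omega) h with h | h
      · right; rw [h]; omega
      · right; omega

lemma anc_dep {u v : V} (h : t.Anc u v) : u = v ∨ t.dep u < t.dep v := anc_dep_aux _ u v rfl h

lemma anc_le {u v : V} (h : t.Anc u v) : t.dep u ≤ t.dep v := by
  rcases anc_dep h with h | h
  · rw [h]
  · exact h.le

lemma anc_total {u v x : V} (h1 : t.Anc u x) (h2 : t.Anc v x) : t.Anc u v ∨ t.Anc v u := by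
  obtain ⟨i, rfl⟩ := h1
  obtain ⟨j, rfl⟩ := h2
  rcases le_total i j with h | h
  · right
    exact ⟨j - i, by rw [← Function.iterate_add_apply]; congr 1; congr 1; omega⟩
  · left
    exact ⟨i - j, by rw [← Function.iterate_add_apply]; congr 1; congr 1; omega⟩

lemma dep_ind {P : V → Prop} (h0 : P t.r) (hs : ∀ v, v ≠ t.r → P (t.par v) → P v) (v : V) : P v := by
  have : ∀ n v, t.dep v = n → P v := by
    intro n
    induction n with
    | zero =>
      intro v hv
      by_cases hr : v = t.r
      · subst hr; exact h0
      · have := t.dep_par v hr; omega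
    | succ n ih =>
      intro v hv
      by_cases hr : v = t.r
      · subst hr; exact h0
      · have := t.dep_par v hr; exact hs v hr (ih _ (by omega))
  exact this _ v rfl

variable (t) in
lemma anc_root (v : V) : t.Anc t.r v :=
  dep_ind (t := t) (P := fun v => t.Anc t.r v) (anc_refl _ _) (fun v _ h => anc_trans h (anc_par t v)) v

lemma anc_child {u v : V} (h : t.Anc u v) (hne : u ≠ v) : ∃ c, c ≠ t.r ∧ t.par c = u ∧ t.Anc c v := by
  revert h hne
  refine dep_ind (t := t) (P := fun v => t.Anc u v → u ≠ v → ∃ c, c ≠ t.r ∧ t.par c = u ∧ t.Anc c v) ?_ ?_ v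
  · intro h hne; exact absurd (anc_r h) hne
  · intro v hv ih h hne
    have h := (anc_cases h).resolve_left hne
    by_cases h' : u = t.par v
    · exact ⟨v, hv, h'.symm, anc_refl _ _⟩
    · obtain ⟨c, h1, h2, h3⟩ := ih h h'
      exact ⟨c, h1, h2, anc_trans h3 (anc_par t v)⟩

variable (t) in
def good (u w : V) : Prop := (t.Anc u (t.par w) ∧ u ≠ t.par w) ∨ (t.par w = t.r ∧ u = t.r)

end RT

open RT
structure Data {V : Type*} (G : SimpleGraph V) extends RT V where
  Z : V → V
  U : V → V
  hZ : ∀ w, w ≠ r → toRT.Anc w (Z w)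
  hU : ∀ w, w ≠ r → toRT.good (U w) w
  hadj : ∀ w, w ≠ r → G.Adj (Z w) (U w)
  hmax : ∀ w, w ≠ r → ∀ z u, toRT.Anc w z → G.Adj z u → toRT.good u w → dep z ≤ dep (Z w)
  hpar : ∀ w, w ≠ r → G.Adj (par w) w

namespace Data
variable {V : Type*} {G : SimpleGraph V} (D : Data G)

open scoped Classical in
noncomputable def own (w : V) : V :=
  if h : w = D.r then w else if D.par w = D.r then w else
    if D.Anc w (D.Z (own (D.par w))) then own (D.par w) else w
termination_by D.dep w
decreasing_by
  have := D.dep_par w h; omega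

open scoped Classical in
noncomputable def des (v : V) : V := if h : ∃ c, c ≠ D.r ∧ D.par c = v then h.choose else D.r

def HasChild (v : V) : Prop := ∃ c, c ≠ D.r ∧ D.par c = v

lemma des_spec {v : V} (h : D.HasChild v) : D.des v ≠ D.r ∧ D.par (D.des v) = v := by
  have h' : ∃ c, c ≠ D.r ∧ D.par c = v := h
  unfold des
  rw [dif_pos h']
  exact h'.choose_spec

def Req (q : V) : Prop := q ≠ D.r ∧ D.own q = q

lemma own_spec (w : V) : w ≠ D.r → D.Req (D.own w) ∧ D.Anc (D.own w) w ∧ D.Anc w (D.Z (D.own w)) := by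
  refine dep_ind (t := D.toRT) (P := fun w => w ≠ D.r →
    D.Req (D.own w) ∧ D.Anc (D.own w) w ∧ D.Anc w (D.Z (D.own w))) (fun h => absurd rfl h) ?_ w
  intro w hw ih _
  by_cases h1 : D.par w = D.r
  · have : D.own w = w := by rw [own, dif_neg hw, if_pos h1]
    unfold Req
    rw [this, this]
    exact ⟨⟨hw, rfl⟩, anc_refl _ _, D.hZ w hw⟩
  · by_cases h2 : D.Anc w (D.Z (D.own (D.par w)))
    · have : D.own w = D.own (D.par w) := by
        rw [own, dif_neg hw, if_neg h1, if_pos h2]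
      have ih := ih h1
      rw [this]
      exact ⟨ih.1, anc_trans ih.2.1 (anc_par _ w), h2⟩
    · have : D.own w = w := by rw [own, dif_neg hw, if_neg h1, if_neg h2]
      unfold Req
      rw [this, this]
      exact ⟨⟨hw, rfl⟩, anc_refl _ _, D.hZ w hw⟩

lemma own_eq {q : V} (hq : D.Req q) (x : V) : D.Anc q x → D.Anc x (D.Z q) → D.own x = q := by
  refine dep_ind (t := D.toRT) (P := fun x => D.Anc q x → D.Anc x (D.Z q) → D.own x = q) ?_ ?_ x
  · intro h; exact absurd (anc_r h) hq.1
  · intro x hx ih h1 h2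
    rcases anc_cases h1 with h | h
    · rw [← h]; exact hq.2
    · have hp : D.par x ≠ D.r := by
        intro h'; rw [h'] at h; exact hq.1 (anc_r h)
      have := ih h (anc_trans (anc_par _ x) h2)
      rw [own, dif_neg hx, if_neg hp, this, if_pos h2]

def Pd (q : V) : Prop :=
  D.Req q ∧ D.par q ≠ D.r ∧ D.par q = D.Z (D.own (D.par q)) ∧ q = D.des (D.par q)

lemma pi_ex {q : V} (h : D.Pd q) : ∃ x, x ≠ D.r ∧ D.par x = D.U q ∧ D.own x = D.own (D.par q) ∧ D.Anc x (D.par q) := by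
  obtain ⟨hq, hp, hpz, -⟩ := h
  set q' := D.own (D.par q) with hq'
  obtain ⟨hRq', hA1, hA2⟩ := D.own_spec (D.par q) hp
  rw [← hq'] at hRq' hA1 hA2
  have hg := D.hU q hq.1
  obtain ⟨hU1, hU2⟩ : D.Anc (D.U q) (D.par q) ∧ D.U q ≠ D.par q := by
    rcases hg with h | h
    · exact h
    · exact absurd h.1 hp
  obtain ⟨x, hx1, hx2, hx3⟩ := anc_child hU1 hU2
  refine ⟨x, hx1, hx2, ?_, hx3⟩
  have hxq : D.Anc q' x := by
    rcases anc_total hA1 hx3 with h | h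
    · exact h
    · by_cases hne : x = q'
      · rw [hne]; exact anc_refl _ _
      exfalso
      have h' := (anc_cases h).resolve_left hne
      have hgood : D.good (D.U q) q' := by
        left
        rw [← hx2]
        refine ⟨anc_trans (anc_par _ x) h', fun he => ?_⟩
        have h1 := anc_le h'
        have h2 := D.dep_par x hx1
        rw [he] at h2; omega
      have h1 := D.hmax q' hRq'.1 (D.Z q) (D.U q)
        (anc_trans hA1 (anc_trans (anc_par _ q) (D.hZ q hq.1))) (D.hadj q hq.1) hgood
      have h2 := anc_le (D.hZ q hq.1)
      have h3 := D.dep_par q hq.1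
      rw [← hpz] at h1; omega
  exact D.own_eq hRq' x hxq (hpz ▸ hx3)

open scoped Classical in
noncomputable def pi (q : V) : V := if h : D.Pd q then (D.pi_ex h).choose else D.r

lemma pi_spec {q : V} (h : D.Pd q) : D.pi q ≠ D.r ∧ D.par (D.pi q) = D.U q ∧
    D.own (D.pi q) = D.own (D.par q) ∧ D.Anc (D.pi q) (D.par q) := by
  unfold pi
  rw [dif_pos h]
  exact (D.pi_ex h).choose_spec

lemma pi_inj {q q' : V} (h : D.Pd q) (h' : D.Pd q') (he : D.pi q = D.pi q') : q = q' := by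
  have h1 := (D.pi_spec h).2.2.1
  have h2 := (D.pi_spec h').2.2.1
  rw [he, h2] at h1
  rw [h.2.2.2, h'.2.2.2, h.2.2.1, h'.2.2.1, h1]

lemma next_Pd {q : V} (h : D.Req q) (hc : D.HasChild (D.Z q)) : D.Pd (D.des (D.Z q)) ∧
    D.own (D.pi (D.des (D.Z q))) = q := by
  obtain ⟨h1, h2⟩ := D.des_spec hc
  have hzq := D.hZ q h.1
  have hz : D.Z q ≠ D.r := fun he => h.1 (anc_r (he ▸ hzq))
  have hoz : D.own (D.Z q) = q := D.own_eq h _ hzq (anc_refl _ _)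
  have hPd : D.Pd (D.des (D.Z q)) := by
    unfold Pd Req
    rw [h2, hoz]
    refine ⟨⟨h1, ?_⟩, hz, rfl, rfl⟩
    rw [own, dif_neg h1, h2, if_neg hz, hoz, if_neg]
    intro ha
    have := anc_le ha
    have := D.dep_par _ h1
    rw [h2] at this; omega
  refine ⟨hPd, ?_⟩
  rw [(D.pi_spec hPd).2.2.1, h2, hoz]

/-- the request owning `w` covers `w` -/
lemma cover_U {w : V} (hw : w ≠ D.r) : D.Anc (D.U (D.own w)) (D.par w) := by
  obtain ⟨hR, hA, -⟩ := D.own_spec w hw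
  have h1 : D.Anc (D.U (D.own w)) (D.par (D.own w)) := by
    rcases D.hU _ hR.1 with h | h
    · exact h.1
    · rw [h.1, h.2]; exact anc_refl _ _
  rcases anc_cases hA with h | h
  · rw [h] at h1; rw [h]; exact h1
  · exact anc_trans h1 (anc_trans (anc_par _ _) h)

lemma cover_ne {w : V} (hw : w ≠ D.r) (hP : D.Pd (D.own w)) : D.pi (D.own w) ≠ w := by
  intro he
  obtain ⟨hR, hA, -⟩ := D.own_spec w hw
  obtain ⟨h1, h2, h3, h4⟩ := D.pi_spec hP
  rw [he] at h4
  have h5 := anc_le h4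
  have h6 := anc_le hA
  have h7 := D.dep_par _ hR.1
  omega

open scoped Classical in
noncomputable def ea : V ⊕ V ⊕ V → V × Bool
  | .inl w => (D.par w, false)
  | .inr (.inl w) => (w, true)
  | .inr (.inr q) => if D.Req q then (D.Z q, false) else (q, false)

open scoped Classical in
noncomputable def eb : V ⊕ V ⊕ V → V × Bool
  | .inl w => (w, true)
  | .inr (.inl w) => (w, false)
  | .inr (.inr q) => if D.Req q then (if D.Pd q then (D.pi q, true) else (D.U q, false)) else (q, false)

lemma path_const (s : V × Bool → ZMod 2) (v y : V) (h : D.Anc v y)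
    (hs : ∀ x, x ≠ D.r → D.Anc x y → D.dep v < D.dep x → s (D.par x, false) = s (x, false)) :
    s (y, false) = s (v, false) := by
  revert h hs
  refine dep_ind (t := D.toRT) (P := fun y => D.Anc v y → (∀ x, x ≠ D.r → D.Anc x y →
    D.dep v < D.dep x → s (D.par x, false) = s (x, false)) → s (y, false) = s (v, false)) ?_ ?_ y
  · intro h _; rw [anc_r h]
  · intro y hy ih h hs
    rcases anc_cases h with h' | h'
    · rw [h']
    · have h1 := anc_le h'
      have h2 := D.dep_par y hy
      rw [← hs y hy (anc_refl _ _) (by omega)]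
      exact ih h' fun x hx hxy => hs x hx (anc_trans hxy (anc_par _ y))

lemma bridgeless [Fintype V] (s : V × Bool → ZMod 2) (e0 : V ⊕ V ⊕ V)
    (h0 : s (D.ea e0) ≠ s (D.eb e0)) (hs : ∀ e, e ≠ e0 → s (D.ea e) = s (D.eb e)) : False := by
  classical
  have hup : ∀ x, e0 ≠ .inl x → s (D.par x, false) = s (x, true) := fun x h => hs (.inl x) h.symm
  have hlo : ∀ x, e0 ≠ .inr (.inl x) → s (x, true) = s (x, false) := fun x h => hs (.inr (.inl x)) h.symm
  have hba : ∀ q, D.Req q → e0 ≠ .inr (.inr q) →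
      s (D.Z q, false) = s (if D.Pd q then (D.pi q, true) else (D.U q, false)) := by
    intro q hq h
    have := hs (.inr (.inr q)) h.symm
    simpa [ea, eb, hq] using this
  have key : ∀ w, w ≠ D.r → (e0 = .inl w ∨ e0 = .inr (.inl w)) →
      s (D.par w, false) = s (w, false) := by
    intro w hw he
    have hother : ∀ x, x ≠ w → s (D.par x, false) = s (x, false) := by
      intro x hx
      rw [hup x, hlo x]
      · rintro rfl; simp at he; exact hx he
      · rintro rfl; simp at he; exact hx he
    obtain ⟨hR, hA, hAz⟩ := D.own_spec w hw
    have h1 : s (D.Z (D.own w), false) = s (w, false) :=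
      D.path_const s w _ hAz fun x _ _ hx => hother x (by rintro rfl; omega)
    have h2 : s (D.par w, false) = s (D.U (D.own w), false) :=
      D.path_const s _ _ (D.cover_U hw) fun x _ hx _ => hother x (by
        rintro rfl
        have := anc_le hx
        have := D.dep_par x hw
        omega)
    have h3 := hba _ hR (by rintro rfl; simp at he)
    by_cases hP : D.Pd (D.own w)
    · rw [if_pos hP] at h3
      have h4 := hup (D.pi (D.own w)) (by
        rintro rfl
        simp at he
        exact D.cover_ne hw hP he)
      rw [(D.pi_spec hP).2.1] at h4
      rw [h2, h4, ← h3, h1]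
    · rw [if_neg hP] at h3
      rw [h2, ← h3, h1]
  rcases e0 with w | w | q
  · have h0 : s (D.par w, false) ≠ s (w, true) := h0
    rw [hlo w (by simp)] at h0
    by_cases hw : w = D.r
    · rw [hw, D.par_r] at h0; exact h0 rfl
    · exact h0 (key w hw (Or.inl rfl))
  · have h0 : s (w, true) ≠ s (w, false) := h0
    rw [← hup w (by simp)] at h0
    by_cases hw : w = D.r
    · rw [hw, D.par_r] at h0; exact h0 rfl
    · exact h0 (key w hw (Or.inr rfl))
  · by_cases hq : D.Req q
    · have hall : ∀ y, s (y, false) = s (D.r, false) := fun y =>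
        D.path_const s _ _ (anc_root _ y) fun x _ _ _ => by rw [hup x (by simp), hlo x (by simp)]
      apply h0
      simp only [ea, eb, if_pos hq]
      split_ifs
      · rw [← hup _ (by simp), hall, hall (D.par _)]
      · rw [hall, hall (D.U q)]
    · simp [ea, eb, hq] at h0

end Data
end TSPAux

namespace TSPAux
open RT
namespace Data
variable {V : Type*} {G : SimpleGraph V} (D : Data G)

def Rt (w : V) : Prop := ∃ q, D.Pd q ∧ D.pi q = w

open scoped Classical in
lemma count [Fintype V] : (Finset.univ.filter D.Req).card ≤ (Finset.univ.filter D.Rt).card +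
    (Finset.univ.filter fun v => v ≠ D.r ∧ ¬ D.HasChild v).card := by
  rw [← Finset.card_filter_add_card_filter_not (s := Finset.univ.filter D.Req) (fun q => D.HasChild (D.Z q))]
  refine add_le_add ?_ ?_
  · refine Finset.card_le_card_of_injOn (fun q => D.pi (D.des (D.Z q))) ?_ ?_
    · intro q hq
      simp only [Finset.coe_filter, Finset.mem_filter, Finset.mem_univ, true_and, Set.mem_ofPred_eq] at hq ⊢
      exact ⟨_, (D.next_Pd hq.1 hq.2).1, rfl⟩
    · intro q hq q' hq' he
      simp only [Finset.coe_filter, Finset.mem_filter, Finset.mem_univ, true_and, Set.mem_ofPred_eq] at hq hq'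
      have he : D.pi (D.des (D.Z q)) = D.pi (D.des (D.Z q')) := he
      rw [← (D.next_Pd hq.1 hq.2).2, he, (D.next_Pd hq'.1 hq'.2).2]
  · refine Finset.card_le_card_of_injOn D.Z ?_ ?_
    · intro q hq
      simp only [Finset.coe_filter, Finset.mem_filter, Finset.mem_univ, true_and, Set.mem_ofPred_eq] at hq ⊢
      refine ⟨fun he => hq.1.1 (anc_r (t := D.toRT) ?_), hq.2⟩
      rw [← he]; exact D.hZ q hq.1.1
    · intro q hq q' hq' he
      simp only [Finset.coe_filter, Finset.mem_filter, Finset.mem_univ, true_and, Set.mem_ofPred_eq] at hq hq'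
      rw [← D.own_eq hq.1 (D.Z q) (D.hZ q hq.1.1) (anc_refl _ _), he,
        D.own_eq hq'.1 (D.Z q') (D.hZ q' hq'.1.1) (anc_refl _ _)]

open scoped Classical in
noncomputable def cc : V ⊕ V ⊕ V → ℝ
  | .inl _ => 0
  | .inr (.inl w) => if w = D.r then 0 else if D.Rt w then -1 else 1
  | .inr (.inr q) => if D.Req q then -1 else 0

lemma Rt_ne {w : V} (h : D.Rt w) : w ≠ D.r := by
  obtain ⟨q, hq, rfl⟩ := h
  exact (D.pi_spec hq).1

open scoped Classical in
lemma sum_cc [Fintype V] : ∑ e, D.cc e =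
    (Fintype.card V : ℝ) - 1 - 2 * (Finset.univ.filter D.Rt).card - (Finset.univ.filter D.Req).card := by
  have h1 : ∑ w, D.cc (.inr (.inl w)) = ∑ w, ((1 : ℝ) - (if w = D.r then 1 else 0) - 2 * (if D.Rt w then 1 else 0)) := by
    refine Finset.sum_congr rfl fun w _ => ?_
    by_cases h : w = D.r
    · have : ¬ D.Rt w := fun h' => D.Rt_ne h' h
      simp [cc, h, h ▸ this]
    · by_cases h' : D.Rt w
      · simp [cc, h, h']; norm_num
      · simp [cc, h, h']
  have h2 : ∑ q, D.cc (.inr (.inr q)) = - ((Finset.univ.filter D.Req).card : ℝ) := by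
    simp [cc, Finset.sum_ite]
  have h0 : ∑ w, D.cc (.inl w) = 0 := by simp [cc]
  rw [Fintype.sum_sum_type, Fintype.sum_sum_type, h0, h1, h2]
  rw [Finset.sum_sub_distrib, Finset.sum_sub_distrib, ← Finset.mul_sum]
  simp
  ring

noncomputable def ra : V ⊕ V ⊕ V → V
  | .inl w => D.par w
  | .inr (.inl w) => D.par w
  | .inr (.inr q) => D.Z q

noncomputable def rb : V ⊕ V ⊕ V → V
  | .inl w => w
  | .inr (.inl w) => w
  | .inr (.inr q) => D.U q

def sel (J : V ⊕ V ⊕ V → ZMod 2) : V ⊕ V ⊕ V → Prop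
  | .inl w => w ≠ D.r ∧ ¬ (J (.inr (.inl w)) ≠ 0 ∧ D.Rt w)
  | .inr (.inl w) => w ≠ D.r ∧ J (.inr (.inl w)) ≠ 0 ∧ ¬ D.Rt w
  | .inr (.inr q) => D.Req q ∧ J (.inr (.inr q)) = 0

open scoped Classical in
noncomputable def selS [Fintype V] (J : V ⊕ V ⊕ V → ZMod 2) : Finset (V ⊕ V ⊕ V) :=
  Finset.univ.filter (D.sel J)

open scoped Classical in
lemma card_sel [Fintype V] (J : V ⊕ V ⊕ V → ZMod 2) : ((D.selS J).card : ℝ) =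
    (Fintype.card V : ℝ) - 1 + (Finset.univ.filter D.Req).card + wt D.cc J := by
  have e1 : ((D.selS J).card : ℝ) = ∑ e, if D.sel J e then (1 : ℝ) else 0 := by
    simp [selS]
  rw [e1]
  unfold wt
  simp only [Fintype.sum_sum_type]
  have hn : (Fintype.card V : ℝ) - 1 = ∑ w : V, ((1 : ℝ) - if w = D.r then 1 else 0) := by
    rw [Finset.sum_sub_distrib]; simp
  have hA : ((Finset.univ.filter D.Req).card : ℝ) = ∑ q, if D.Req q then (1 : ℝ) else 0 := by simp
  rw [hn, hA]
  have h0 : (∑ w : V, if J (.inl w) = 0 then (0 : ℝ) else D.cc (.inl w)) = 0 := by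
    simp [cc]
  rw [h0, zero_add]
  have h1 : (∑ w : V, if D.sel J (.inl w) then (1 : ℝ) else 0) + (∑ w : V, if D.sel J (.inr (.inl w)) then (1 : ℝ) else 0)
      = ∑ w : V, ((1 : ℝ) - if w = D.r then 1 else 0) +
        ∑ w : V, if J (.inr (.inl w)) = 0 then (0 : ℝ) else D.cc (.inr (.inl w)) := by
    rw [← Finset.sum_add_distrib, ← Finset.sum_add_distrib]
    refine Finset.sum_congr rfl fun w _ => ?_
    by_cases ha : w = D.r <;> by_cases hb : J (.inr (.inl w)) = 0 <;> by_cases hc : D.Rt w <;>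
      simp [sel, cc, ha, hb, hc] <;> simp_all
  have h2 : (∑ q : V, if D.sel J (.inr (.inr q)) then (1 : ℝ) else 0)
      = (∑ q, if D.Req q then (1 : ℝ) else 0) +
        ∑ q : V, if J (.inr (.inr q)) = 0 then (0 : ℝ) else D.cc (.inr (.inr q)) := by
    rw [← Finset.sum_add_distrib]
    refine Finset.sum_congr rfl fun q _ => ?_
    by_cases ha : D.Req q <;> by_cases hb : J (.inr (.inr q)) = 0 <;> simp [sel, cc, ha, hb]
  linarith

lemma bd_sel [Fintype V] (J : V ⊕ V ⊕ V → ZMod 2) (hJ : bd D.ea D.eb J = bd D.ea D.eb 1) :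
    bd D.ra D.rb (ind (D.selS J)) = 0 := by
  classical
  funext v
  let κ : V × Bool → V := fun y => if y.2 then D.par y.1 else y.1
  let s : V × Bool → ZMod 2 := fun y => if κ y = v then 1 else 0
  have h1 := pairing D.ea D.eb (J + 1) s
  have h2 : bd D.ea D.eb (J + 1) = 0 := by rw [bd_add, hJ, fadd]
  rw [h2] at h1
  simp only [Pi.zero_apply, mul_zero, Finset.sum_const_zero] at h1
  rw [Pi.zero_apply, h1]
  unfold bd
  simp only [Fintype.sum_sum_type]
  have hu : ∑ w : V, (J + 1) (.inl w) * (s (D.ea (.inl w)) + s (D.eb (.inl w))) = 0 := by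
    refine Finset.sum_eq_zero fun w _ => ?_
    simp [ea, eb, s, κ, z2add]
  rw [hu, zero_add, ← add_assoc, ← Finset.sum_add_distrib]
  have h11 : (1 + 1 : ZMod 2) = 0 := by decide
  congr 1
  · refine Finset.sum_congr rfl fun w _ => ?_
    rw [show D.ra (.inl w) = D.par w from rfl, show D.ra (.inr (.inl w)) = D.par w from rfl,
      show D.rb (.inl w) = w from rfl, show D.rb (.inr (.inl w)) = w from rfl]
    rw [show s (D.ea (.inr (.inl w))) = if D.par w = v then 1 else 0 from rfl,
      show s (D.eb (.inr (.inl w))) = if w = v then 1 else 0 from rfl, ← add_mul]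
    by_cases ha : w = D.r
    · rw [ha, D.par_r, z2add, mul_zero, mul_zero]
    · congr 1
      rcases z2 (J (.inr (.inl w))) with hb | hb <;> by_cases hc : D.Rt w <;>
        simp [ind, selS, sel, ha, hb, hc, h11]
  · refine Finset.sum_congr rfl fun q _ => ?_
    by_cases hq : D.Req q
    · have hk : s (D.eb (.inr (.inr q))) = if D.U q = v then 1 else 0 := by
        by_cases hP : D.Pd q
        · simp [eb, hq, hP, s, κ, (D.pi_spec hP).2.1]
        · simp [eb, hq, hP, s, κ]
      have hk2 : s (D.ea (.inr (.inr q))) = if D.Z q = v then 1 else 0 := by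
        simp [ea, hq, s, κ]
      rw [hk, hk2]
      show _ * ((if D.Z q = v then 1 else 0) + (if D.U q = v then 1 else 0)) = _
      congr 1
      rcases z2 (J (.inr (.inr q))) with hb | hb <;> simp [ind, selS, sel, hq, hb, h11]
    · simp [ind, selS, sel, hq, ea, eb, z2add]

lemma conn [Fintype V] (J : V ⊕ V ⊕ V → ZMod 2)
    (hJ : ∀ q, D.Pd q → J (.inr (.inl (D.pi q))) = 0 ∨ J (.inr (.inr q)) = 0) :
    ∀ w z, D.Anc w z → Relation.ReflTransGen (ERel D.ra D.rb (· ∈ D.selS J)) w z := by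
  classical
  obtain ⟨m, hm⟩ : ∃ m, ∀ v, D.dep v ≤ m :=
    ⟨Finset.univ.sup D.dep, fun v => Finset.le_sup (Finset.mem_univ v)⟩
  have : ∀ n w z, m - D.dep w = n → D.Anc w z →
      Relation.ReflTransGen (ERel D.ra D.rb (· ∈ D.selS J)) w z := by
    intro n
    induction n using Nat.strong_induction_on with
    | _ n ih =>
    intro w z hn h
    by_cases hwz : w = z
    · rw [hwz]
    obtain ⟨c, hc1, hc2, hc3⟩ := anc_child h hwz
    have hd := D.dep_par c hc1
    rw [hc2] at hd
    have hmc := hm c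
    have ihc : ∀ y, D.Anc c y → Relation.ReflTransGen (ERel D.ra D.rb (· ∈ D.selS J)) c y :=
      fun y hy => ih (m - D.dep c) (by omega) c y rfl hy
    refine Relation.ReflTransGen.trans ?_ (ihc z hc3)
    by_cases hr : J (.inr (.inl c)) ≠ 0 ∧ D.Rt c
    · obtain ⟨hr1, q, hq, rfl⟩ := hr
      have hb := (hJ q hq).resolve_left hr1
      obtain ⟨h1, h2, h3, h4⟩ := D.pi_spec hq
      refine Relation.ReflTransGen.head (b := D.Z q) ?_ (reach_symm _ _ (ihc _ ?_))
      · refine ⟨.inr (.inr q), ?_, Or.inr ⟨rfl, ?_⟩⟩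
        · simp [selS, sel, hb, hq.1]
        · rw [← hc2, h2]; rfl
      · exact anc_trans h4 (anc_trans (anc_par _ q) (D.hZ q hq.1.1))
    · refine Relation.ReflTransGen.single ⟨.inl c, ?_, Or.inl ⟨hc2, rfl⟩⟩
      simp only [selS, Finset.mem_filter, Finset.mem_univ, true_and]
      exact ⟨hc1, hr⟩
  exact fun w z h => this _ w z rfl h

open scoped Classical in
theorem tour [Fintype V] : ∃ W : G.Walk D.r D.r, (∀ x, x ∈ W.support) ∧
    (W.length : ℝ) ≤ 4 * (Fintype.card V : ℝ) / 3 +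
      2 * ((Finset.univ.filter fun v => v ≠ D.r ∧ ¬ D.HasChild v).card : ℝ) / 3 := by
  obtain ⟨J, hJ1, hJ2, hJ3⟩ := cubic D.ea D.eb (by
      intro s hs
      obtain ⟨e0, he0⟩ := Finset.card_eq_one.1 hs
      have hiff : ∀ e, s (D.ea e) + s (D.eb e) ≠ 0 ↔ e = e0 := by
        intro e
        have := Finset.ext_iff.1 he0 e
        simpa using this
      refine D.bridgeless s e0 ?_ ?_
      · intro h
        apply (hiff e0).2 rfl
        rw [h, z2add]
      · intro e he
        have h1 : s (D.ea e) + s (D.eb e) = 0 := by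
          by_contra h; exact he ((hiff e).1 h)
        linear_combination h1 - z2add (s (D.eb e))) D.cc
    (Finset.univ.filter fun y : V × Bool => y.2 = true ∧ D.Rt y.1) (by
      rintro ⟨x, i⟩ hv
      simp only [Finset.mem_filter, Finset.mem_univ, true_and] at hv
      obtain ⟨rfl, q0, hq0, rfl⟩ := hv
      simp only [Fintype.sum_sum_type]
      have h1 : ∑ w, inc D.ea D.eb (D.pi q0, true) (.inl w) = 1 := by
        simp [inc, ea, eb]
      have h2 : ∑ w, inc D.ea D.eb (D.pi q0, true) (.inr (.inl w)) = 1 := by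
        simp [inc, ea, eb]
      have h3 : ∑ q, inc D.ea D.eb (D.pi q0, true) (.inr (.inr q)) = 1 := by
        rw [Finset.sum_eq_single q0]
        · simp [inc, ea, eb, hq0, hq0.1]
        · intro q _ hne
          by_cases hR : D.Req q
          · by_cases hP : D.Pd q
            · have : D.pi q ≠ D.pi q0 := fun h => hne (D.pi_inj hP hq0 h)
              simp [inc, ea, eb, hR, hP, this]
            · simp [inc, ea, eb, hR, hP]
          · simp [inc, ea, eb, hR]
        · simp
      omega)
  have hconn := D.conn J (by
    intro q hq
    by_contra! hcon
    have h := hJ3 (D.pi q, true) (by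
      simp only [Finset.mem_filter, Finset.mem_univ, true_and]
      exact ⟨q, hq, rfl⟩)
    have h2 : ∑ e ∈ ({.inr (.inl (D.pi q)), .inr (.inr q)} : Finset (V ⊕ V ⊕ V)),
        (if J e = 0 then 0 else inc D.ea D.eb (D.pi q, true) e) ≤ 1 := by
      rw [← h]
      exact Finset.sum_le_sum_of_subset (Finset.subset_univ _)
    rw [Finset.sum_pair (by simp)] at h2
    simp [hcon.1, hcon.2, inc, ea, eb, hq, hq.1] at h2)
  obtain ⟨W, hW1, hW2⟩ := euler_s10 D.ra D.rb G _ (D.selS J) D.r D.r rfl (by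
    intro e he
    simp only [selS, Finset.mem_filter, Finset.mem_univ, true_and] at he
    rcases e with w | w | q
    · exact D.hpar w he.1
    · exact D.hpar w he.1
    · exact D.hadj q he.1.1) (by rw [D.bd_sel J hJ1, pt_add])
  refine ⟨W, fun x => hW2 x (hconn _ _ (anc_root _ x)), ?_⟩
  have h1 := D.card_sel J
  have h2 := D.sum_cc
  have h3 : ((Finset.univ.filter D.Req).card : ℝ) ≤ (Finset.univ.filter D.Rt).card +
    (Finset.univ.filter fun v => v ≠ D.r ∧ ¬ D.HasChild v).card := by exact_mod_cast D.count
  have h4 : (W.length : ℝ) ≤ ((D.selS J).card : ℝ) := by exact_mod_cast hW1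
  linarith

end Data
end TSPAux

namespace TSPAux
open RT

lemma parent_exists {V : Type*} {T : SimpleGraph V} (hT : T.Connected) (r v : V) (hv : v ≠ r) :
    ∃ u, T.Adj u v ∧ T.dist r u + 1 = T.dist r v := by
  obtain ⟨p, hp⟩ := hT.exists_walk_length_eq_dist v r
  cases p with
  | nil => exact absurd rfl hv
  | @cons _ u _ h q =>
    refine ⟨u, h.symm, ?_⟩
    have h1 : T.dist u r ≤ q.length := T.dist_le q
    have h2 : T.dist v r ≤ T.dist v u + T.dist u r := hT.dist_triangle
    rw [SimpleGraph.dist_eq_one_iff_adj.2 h] at h2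
    rw [SimpleGraph.Walk.length_cons] at hp
    rw [T.dist_comm (u := r) (v := u), T.dist_comm (u := r) (v := v)]
    omega

theorem final_s10 {V : Type*} [Fintype V]
    (G : SimpleGraph V)
    (h2conn : ∀ v : V, (G.induce {v}ᶜ).Connected)
    (T : SimpleGraph V) (hTG : T ≤ G) (hT : T.IsTree)
    (r₀ : V)
    (hdfs : ∀ u v : V, G.Adj u v →
      (∃ p : T.Walk r₀ v, p.IsPath ∧ u ∈ p.support) ∨
      (∃ p : T.Walk r₀ u, p.IsPath ∧ v ∈ p.support))
    (k : ℕ)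
    (hleaves : {v : V | (T.neighborSet v).ncard = 1}.ncard ≤ k) :
    ∃ (r : V) (w : G.Walk r r), (∀ x : V, x ∈ w.support) ∧
      (w.length : ℚ) ≤ 4 * (Fintype.card V) / 3 + 2 * (k : ℚ) / 3 := by
  classical
  choose! par0 hp1 hp2 using parent_exists hT.connected r₀
  let t : RT V :=
    { r := r₀
      par := fun v => if v = r₀ then r₀ else par0 v
      dep := fun v => T.dist r₀ v
      par_r := by simp
      dep_par := by
        intro v hv
        simp only [if_neg hv]
        exact hp2 v hv }
  have htadj : ∀ v, v ≠ t.r → T.Adj (t.par v) v := by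
    intro v hv
    have : t.par v = par0 v := if_neg hv
    rw [this]; exact hp1 v hv
  have hpath : ∀ v, ∃ p : T.Walk t.r v, p.IsPath ∧ ∀ u ∈ p.support, t.Anc u v := by
    intro v
    refine dep_ind (t := t) (P := fun v => ∃ p : T.Walk t.r v, p.IsPath ∧ ∀ u ∈ p.support, t.Anc u v) ?_ ?_ v
    · refine ⟨.nil, .nil, ?_⟩
      intro u hu
      simp at hu
      rw [hu]; exact anc_refl _ _
    · rintro v hv ⟨p, hp, hs⟩
      refine ⟨p.concat (htadj v hv), hp.concat ?_ _, ?_⟩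
      · intro h
        have h1 := anc_le (hs v h)
        have h2 := t.dep_par v hv
        omega
      · intro u hu
        rw [SimpleGraph.Walk.support_concat] at hu
        simp at hu
        rcases hu with hu | rfl
        · exact anc_trans (hs u hu) (anc_par t v)
        · exact anc_refl _ _
  have huniq : ∀ {v : V} (p q : T.Walk t.r v), p.IsPath → q.IsPath → p = q := by
    intro v p q hp hq
    exact congrArg Subtype.val ((hT.isAcyclic.subsingleton_path _ _).elim ⟨p, hp⟩ ⟨q, hq⟩)
  have hcomp : ∀ u v, G.Adj u v → t.Anc u v ∨ t.Anc v u := by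
    intro u v h
    rcases hdfs u v h with ⟨p, hp, hu⟩ | ⟨p, hp, hu⟩
    · obtain ⟨q, hq, hs⟩ := hpath v
      left; apply hs; rw [huniq q p hq hp]; exact hu
    · obtain ⟨q, hq, hs⟩ := hpath u
      right; apply hs; rw [huniq q p hq hp]; exact hu
  have htree : ∀ u v, T.Adj u v → t.Anc u v → u = t.par v := by
    intro u v h ha
    have hlt : t.dep u < t.dep v := (anc_dep ha).resolve_left h.ne
    have hv : v ≠ t.r := by
      rintro rfl
      exact h.ne (anc_r ha)
    obtain ⟨p, hp, hs⟩ := hpath u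
    obtain ⟨q, hq, hs'⟩ := hpath (t.par v)
    have h1 : (p.concat h).IsPath := hp.concat (fun hm => by
      have := anc_le (hs v hm); omega) _
    have h2 : (q.concat (htadj v hv)).IsPath := hq.concat (fun hm => by
      have := anc_le (hs' v hm); have := t.dep_par v hv; omega) _
    obtain ⟨e, _⟩ := SimpleGraph.Walk.concat_inj (huniq _ _ h1 h2)
    exact e
  have hcover : ∀ w, w ≠ t.r → ∃ z u, t.Anc w z ∧ G.Adj z u ∧ t.good u w := by
    intro w hw
    by_cases hr : t.par w = t.r
    · refine ⟨w, t.r, anc_refl _ _, ?_, Or.inr ⟨hr, rfl⟩⟩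
      rw [← hr]; exact (hTG (htadj w hw)).symm
    · have hwp : w ≠ t.par w := (htadj w hw).ne.symm
      obtain ⟨p⟩ := (h2conn (t.par w)).preconnected ⟨w, hwp⟩ ⟨t.r, Ne.symm hr⟩
      obtain ⟨d, _, hd1, hd2⟩ := p.exists_boundary_dart {x | t.Anc w x.1} (anc_refl _ _)
        (fun h => hw (anc_r h))
      have hadj : G.Adj d.fst.1 d.snd.1 := d.adj
      have hd1' : t.Anc w d.fst.1 := hd1
      have hd2' : ¬ t.Anc w d.snd.1 := hd2
      refine ⟨d.fst.1, d.snd.1, hd1', hadj, Or.inl ?_⟩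
      have h1 : t.Anc d.snd.1 d.fst.1 := by
        rcases hcomp _ _ hadj with h | h
        · exact absurd (anc_trans hd1' h) hd2'
        · exact h
      have h2 : t.Anc d.snd.1 w := (anc_total h1 hd1').resolve_right hd2'
      refine ⟨(anc_cases h2).resolve_left ?_, d.snd.2⟩
      intro h; rw [h] at hd2'; exact hd2' (anc_refl _ _)
  have hbest : ∀ w, w ≠ t.r → ∃ z u, t.Anc w z ∧ G.Adj z u ∧ t.good u w ∧
      ∀ z' u', t.Anc w z' → G.Adj z' u' → t.good u' w → t.dep z' ≤ t.dep z := by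
    intro w hw
    obtain ⟨z, u, h⟩ := hcover w hw
    obtain ⟨x, hx, hm⟩ := Finset.exists_max_image
      (Finset.univ.filter fun x : V × V => t.Anc w x.1 ∧ G.Adj x.1 x.2 ∧ t.good x.2 w)
      (fun x => t.dep x.1) ⟨(z, u), by simpa using h⟩
    simp only [Finset.mem_filter, Finset.mem_univ, true_and] at hx hm
    exact ⟨x.1, x.2, hx.1, hx.2.1, hx.2.2, fun z' u' a b c => hm (z', u') ⟨a, b, c⟩⟩
  have : Nonempty V := ⟨r₀⟩
  choose! Z U hZ hadj hU hmax using hbest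
  let D : Data G :=
    { t with
      Z := Z
      U := U
      hZ := hZ
      hU := hU
      hadj := hadj
      hmax := hmax
      hpar := fun w hw => hTG (htadj w hw) }
  obtain ⟨W, hW1, hW2⟩ := D.tour
  refine ⟨D.r, W, hW1, ?_⟩
  have hl : (Finset.univ.filter fun v => v ≠ D.r ∧ ¬ D.HasChild v).card ≤ k := by
    refine le_trans ?_ hleaves
    rw [← Set.ncard_coe_finset]
    refine Set.ncard_le_ncard ?_ (Set.toFinite _)
    intro v hv
    have hv' : v ≠ t.r ∧ ¬ ∃ c, c ≠ t.r ∧ t.par c = v := by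
      have h0 : v ≠ D.r ∧ ¬ D.HasChild v := by simpa using hv
      exact h0
    obtain ⟨hv1, hv2⟩ := hv'
    change (T.neighborSet v).ncard = 1
    rw [Set.ncard_eq_one]
    refine ⟨t.par v, ?_⟩
    ext u
    rw [SimpleGraph.mem_neighborSet, Set.mem_singleton_iff]
    constructor
    · intro h
      rcases hcomp v u (hTG h) with ha | ha
      · refine absurd ⟨u, ?_, (htree _ _ h ha).symm⟩ hv2
        rintro rfl
        exact hv1 (anc_r ha)
      · exact htree _ _ h.symm ha
    · rintro rfl
      exact (htadj v hv1).symm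
  have h3 : (W.length : ℝ) ≤ 4 * (Fintype.card V : ℝ) / 3 + 2 * (k : ℝ) / 3 := by
    refine hW2.trans ?_
    have : ((Finset.univ.filter fun v => v ≠ D.r ∧ ¬ D.HasChild v).card : ℝ) ≤ k := by exact_mod_cast hl
    linarith
  have h4 : 3 * W.length ≤ 4 * Fintype.card V + 2 * k := by
    have : (3 * W.length : ℝ) ≤ 4 * Fintype.card V + 2 * k := by linarith
    exact_mod_cast this
  have h5 : (3 * W.length : ℚ) ≤ 4 * Fintype.card V + 2 * k := by exact_mod_cast h4
  linarith

end TSPAux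


/-- A 2-vertex-connected simple graph on `n` vertices having a
depth-first-search spanning tree (rooted at `r₀`, with every edge of `G` joining an
ancestor-descendant pair of the tree) with at most `k` leaves has a TSP tour of
length at most `4n/3 + 2k/3`. -/
theorem graphTSP_of_dfs_tree {V : Type*} [Fintype V]
    (G : SimpleGraph V)
    (hcard : 3 ≤ Fintype.card V)
    (h2conn : ∀ v : V, (G.induce {v}ᶜ).Connected)
    (T : SimpleGraph V) (hTG : T ≤ G) (hT : T.IsTree)
    (r₀ : V)
    (hdfs : ∀ u v : V, G.Adj u v →
      (∃ p : T.Walk r₀ v, p.IsPath ∧ u ∈ p.support) ∨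
      (∃ p : T.Walk r₀ u, p.IsPath ∧ v ∈ p.support))
    (k : ℕ)
    (hleaves : {v : V | (T.neighborSet v).ncard = 1}.ncard ≤ k) :
    ∃ (r : V) (w : G.Walk r r), (∀ x : V, x ∈ w.support) ∧
      (w.length : ℚ) ≤ 4 * (Fintype.card V) / 3 + 2 * (k : ℚ) / 3 := by
  exact TSPAux.final_s10 G h2conn T hTG hT r₀ hdfs k hleaves
end

section
/- Let G be a connected simple graph on n vertices, let T be a spanning tree of G, and let 0 ≤ γ ≤ 1. Suppose there is a closed walk C_T in G whose vertex set contains every vertex of odd degree in T, and whose length ℓ(C_T) (number of edges traversed, with multiplicity) satisfies ℓ(C_T) ≤ (1 + γ)·|C_T|, where |C_T| is the number of distinct vertices visited by C_T. Then G has a TSP tour of length at most 4n/(3 - γ). -/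
open SimpleGraph in
theorem tourA {V : Type*} [Fintype V] [DecidableEq V] (G : SimpleGraph V) (hG : G.Connected) (k : ℕ) :
    ∀ (u : V) (c : G.Walk u u), Fintype.card V - c.support.toFinset.card = k →
    ∃ (r : V) (w : G.Walk r r), (∀ x : V, x ∈ w.support) ∧
      w.length ≤ c.length + 2 * k := by
  induction k with
  | zero =>
    intro u c h
    refine ⟨u, c, fun x => ?_, by omega⟩
    have h1 : c.support.toFinset = Finset.univ := by
      apply Finset.eq_univ_of_card
      have := Finset.card_le_univ c.support.toFinset
      omega
    have := Finset.mem_univ x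
    rw [← h1] at this
    simpa using this
  | succ k ih =>
    intro u c h
    have : ∃ y, y ∉ c.support := by
      by_contra! hc
      have h1 : c.support.toFinset = Finset.univ := by ext x; simp [hc x]
      rw [h1, Finset.card_univ] at h
      omega
    obtain ⟨y, hy⟩ := this
    obtain ⟨p⟩ := hG.preconnected u y
    obtain ⟨d, hd, h1, h2⟩ := p.exists_boundary_dart {x | x ∈ c.support} (by simp) hy
    simp only [Set.mem_setOf_eq] at h1 h2
    let c' : G.Walk d.snd d.snd := Walk.cons d.adj.symm ((c.rotate d.fst h1).concat d.adj)
    have hs : c'.support.toFinset = insert d.snd c.support.toFinset := by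
      ext x
      simp only [c', Walk.support_cons, Walk.support_concat, List.mem_toFinset, List.mem_cons,
        List.concat_eq_append, List.mem_append, Finset.mem_insert, Walk.mem_support_rotate_iff]
      simp
      tauto
    obtain ⟨r, w, hw, hl⟩ := ih _ c' (by
      rw [hs, Finset.card_insert_of_notMem (by simpa using h2)]
      omega)
    refine ⟨r, w, hw, hl.trans ?_⟩
    simp [c']
    omega

/-- degree parity -/
def dg {V : Type*} [DecidableEq V] (M : Multiset (Sym2 V)) (x : V) : ZMod 2 :=
  (M.countP (fun e => x ∈ e) : ℕ)

theorem dg_add {V : Type*} [DecidableEq V] (M N : Multiset (Sym2 V)) (x : V) :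
    dg (M + N) x = dg M x + dg N x := by
  simp [dg]

theorem dg_cons {V : Type*} [DecidableEq V] (M : Multiset (Sym2 V)) (a b : V) (hab : a ≠ b) (x : V) :
    dg (s(a,b) ::ₘ M) x = dg M x + ((if x = a then 1 else 0) + (if x = b then 1 else 0)) := by
  simp only [dg, Multiset.countP_cons, Sym2.mem_iff]
  by_cases h1 : x = a
  · subst h1; simp [hab]
  · by_cases h2 : x = b <;> simp [h1, h2, hab.symm]

theorem two_add (a : ZMod 2) : a + a = 0 := CharTwo.add_self_eq_zero a

open SimpleGraph in
theorem dg_walk {V : Type*} [DecidableEq V] {G : SimpleGraph V} {u v : V} (w : G.Walk u v) (x : V) :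
    dg (w.edges : Multiset _) x = (if x = u then 1 else 0) + (if x = v then 1 else 0) := by
  induction w with
  | nil => rw [two_add]; simp [dg]
  | cons h p ih =>
    rw [Walk.edges_cons, ← Multiset.cons_coe, dg_cons _ _ _ h.ne, ih]
    rename_i u v w
    linear_combination two_add (if x = v then 1 else 0)

open SimpleGraph in
theorem euler {V : Type*} [DecidableEq V] [Nonempty V] {G T : SimpleGraph V} (hT : T.Connected)
    (M : Multiset (Sym2 V)) (hM : ∀ e ∈ M, e ∈ G.edgeSet) (hTM : ∀ e ∈ T.edgeSet, e ∈ M)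
    (hd : ∀ x, dg M x = 0) :
    ∃ (r : V) (w : G.Walk r r), (∀ x : V, x ∈ w.support) ∧ w.length ≤ M.card := by
  classical
  let P : ℕ → Prop := fun L => ∃ (u v : V) (w : G.Walk u v), (w.edges : Multiset _) ≤ M ∧ w.length = L
  have hbd : ∀ L, P L → L ≤ M.card := by
    rintro L ⟨u, v, w, h, rfl⟩
    simpa using Multiset.card_le_card h
  have h0 : P 0 := ⟨Classical.arbitrary V, _, Walk.nil, by simp, rfl⟩
  have hP := Nat.findGreatest_spec (P := P) (Nat.zero_le M.card) h0
  have hmax : ∀ L, P L → L ≤ Nat.findGreatest P M.card := fun L hL =>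
    Nat.le_findGreatest (hbd L hL) hL
  generalize Nat.findGreatest P M.card = L at hP hmax
  obtain ⟨u, v, w, hw, rfl⟩ := hP
  have huv : u = v := by
    by_contra hne
    obtain ⟨R, hR⟩ := Multiset.le_iff_exists_add.mp hw
    have h1 := hd u
    rw [hR, dg_add, dg_walk] at h1
    have : ∃ e ∈ R, u ∈ e := by
      by_contra! hc
      have : dg R u = 0 := by
        unfold dg
        rw [Multiset.countP_eq_zero.mpr hc]; rfl
      rw [this] at h1
      simp [hne] at h1
    obtain ⟨e, heR, hue⟩ := this
    obtain ⟨b, rfl⟩ := hue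
    have hadj : G.Adj u b := hM s(u,b) (by rw [hR]; simp [heR])
    have := hmax (w.length + 1) ⟨b, v, Walk.cons hadj.symm w, by
      rw [Walk.edges_cons, ← Multiset.cons_coe, hR, Sym2.eq_swap, ← Multiset.singleton_add, add_comm]
      gcongr
      simpa using heR, by simp⟩
    omega
  subst huv
  refine ⟨u, w, ?_, hbd _ ⟨u, u, w, hw, rfl⟩⟩
  by_contra! hc
  obtain ⟨y, hy⟩ := hc
  obtain ⟨p⟩ := hT.preconnected u y
  obtain ⟨d, hd, h1, h2⟩ := p.exists_boundary_dart {x | x ∈ w.support} (by simp) hy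
  simp only [Set.mem_setOf_eq] at h1 h2
  have heM : s(d.snd, d.fst) ∈ M := hTM _ (by simpa using d.adj.symm)
  have hadj : G.Adj d.snd d.fst := hM _ heM
  have := hmax (w.length + 1) ⟨d.snd, d.fst, Walk.cons hadj (w.rotate d.fst h1), by
    rw [Walk.edges_cons, ← Multiset.cons_coe]
    have hr : ((w.rotate d.fst h1).edges : Multiset (Sym2 V)) = (w.edges : Multiset (Sym2 V)) :=
      Multiset.coe_eq_coe.mpr (w.rotate_edges d.fst h1).perm
    rw [hr]
    rw [Multiset.cons_le_of_notMem]
    · exact ⟨heM, hw⟩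
    · intro hmem
      exact h2 (w.fst_mem_support_of_mem_edges (by simpa using hmem)), by simp⟩
  omega

open SimpleGraph in
theorem join {V : Type*} [Fintype V] [DecidableEq V] {G : SimpleGraph V} {u v : V} (w : G.Walk u v) :
    ∀ (p : V → ZMod 2), (∀ x, x ∉ w.support → p x = 0) → ∑ x, p x = 0 →
    ∃ J : Multiset (Sym2 V), J ≤ w.edges ∧ ∀ x, dg J x = p x := by
  induction w with
  | nil =>
    intro p hp hs
    rename_i u
    refine ⟨0, by simp, fun x => ?_⟩
    simp only [Walk.support_nil, List.mem_singleton] at hp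
    rw [Finset.sum_eq_single u (fun b _ hb => hp b hb) (by simp)] at hs
    by_cases hx : x = u
    · subst hx; simp [dg, hs]
    · simp [dg, hp x hx]
  | cons h w ih =>
    intro p hp hs
    rename_i u v t
    by_cases hu : p u = 0
    · obtain ⟨J, hJ, hd⟩ := ih p (fun x hx => by
        by_cases hxu : x = u
        · rw [hxu, hu]
        · exact hp x (by simp [hxu, hx])) hs
      refine ⟨J, hJ.trans ?_, hd⟩
      rw [Walk.edges_cons, ← Multiset.cons_coe]
      exact Multiset.le_cons_self _ _
    · have hu1 : p u = 1 := by
        generalize p u = a at hu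
        revert a; decide
      obtain ⟨J, hJ, hd⟩ := ih (fun x => p x + ((if x = u then 1 else 0) + (if x = v then 1 else 0)))
        (fun x hx => by
          have hxv : x ≠ v := by rintro rfl; simp at hx
          by_cases hxu : x = u
          · subst hxu; simp [hu1, hxv, two_add]
          · simp [hxu, hxv, hp x (by simp [hxu, hx])])
        (by simp [Finset.sum_add_distrib, hs, two_add])
      refine ⟨s(u,v) ::ₘ J, ?_, fun x => ?_⟩
      · rw [Walk.edges_cons, ← Multiset.cons_coe]
        exact Multiset.cons_le_cons _ hJ
      · rw [dg_cons _ _ _ h.ne, hd, add_assoc, two_add, add_zero]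

/-- Let `G` be a connected simple graph on `n` vertices, `T` a
spanning tree of `G`, and `0 ≤ γ ≤ 1`. If there is a closed walk containing all
vertices of odd degree in `T` whose length is at most `(1 + γ)` times its number of
distinct vertices, then `G` has a TSP tour of length at most `4n/(3 - γ)`. -/
theorem graphTSP_of_approx_steiner_cycle {V : Type*} [Fintype V] [DecidableEq V]
    (G : SimpleGraph V) (hG : G.Connected)
    (T : SimpleGraph V) (hTG : T ≤ G) (hT : T.IsTree)
    (γ : ℚ) (hγ0 : 0 ≤ γ) (hγ1 : γ ≤ 1)
    (u : V) (c : G.Walk u u)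
    (hodd : ∀ v : V, Odd (T.neighborSet v).ncard → v ∈ c.support)
    (hlen : (c.length : ℚ) ≤ (1 + γ) * (c.support.toFinset.card : ℚ)) :
    ∃ (r : V) (w : G.Walk r r), (∀ x : V, x ∈ w.support) ∧
      (w.length : ℚ) ≤ 4 * (Fintype.card V) / (3 - γ) := by
  classical
  have hne : Nonempty V := ⟨u⟩
  set n := Fintype.card V with hn
  set k := c.support.toFinset.card with hk
  have hkn : k ≤ n := Finset.card_le_univ _
  obtain ⟨r1, w1, hw1, hl1⟩ := tourA G hG (n - k) u c rfl
  have hdT : ∀ x, dg T.edgeFinset.val x = (T.degree x : ZMod 2) := by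
    intro x
    rw [dg, Multiset.countP_eq_card_filter, ← SimpleGraph.card_incidenceFinset_eq_degree,
      SimpleGraph.incidenceFinset_eq_filter]
    rfl
  obtain ⟨J0, hJ0, hd0⟩ := join c (fun x => (T.degree x : ZMod 2)) (fun x hx => by
      have h1 : ¬ Odd (T.degree x) := fun h => hx (hodd x (by
        rwa [Set.ncard_eq_toFinset_card', ← SimpleGraph.neighborFinset_def,
          SimpleGraph.card_neighborFinset_eq_degree]))
      rw [ZMod.natCast_eq_zero_iff_even]
      exact Nat.not_odd_iff_even.mp h1)
    (by
      rw [← Nat.cast_sum, T.sum_degrees_eq_twice_card_edges, ZMod.natCast_eq_zero_iff_even]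
      exact even_two_mul _)
  have hJ : ∃ J : Multiset (Sym2 V), J ≤ c.edges ∧ 2 * J.card ≤ c.length ∧
      ∀ x, dg J x = (T.degree x : ZMod 2) := by
    obtain ⟨R, hR⟩ := Multiset.le_iff_exists_add.mp hJ0
    have hcard := congrArg Multiset.card hR
    simp at hcard
    by_cases h : 2 * J0.card ≤ c.length
    · exact ⟨J0, hJ0, h, hd0⟩
    · refine ⟨R, by rw [hR]; simp, by omega, fun x => ?_⟩
      have h1 := dg_walk c x
      rw [hR, dg_add, two_add, hd0] at h1
      linear_combination h1 - two_add (T.degree x : ZMod 2)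
  obtain ⟨J, hJle, hJc, hJd⟩ := hJ
  obtain ⟨r2, w2, hw2, hl2⟩ := euler (G := G) hT.connected (T.edgeFinset.val + J) (by
      intro e he
      rcases Multiset.mem_add.mp he with he | he
      · exact SimpleGraph.edgeSet_mono hTG (by simpa using he)
      · exact c.edges_subset_edgeSet (by simpa using Multiset.mem_of_le hJle he))
    (by
      intro e he
      exact Multiset.mem_add.mpr (Or.inl (by simpa using he)))
    (by intro x; rw [dg_add, hdT, hJd, two_add])
  have hTc := hT.card_edgeFinset
  rw [Multiset.card_add, Finset.card_val] at hl2
  have hB : 2 * w2.length ≤ 2 * n + c.length := by omega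
  have hA : w1.length + 2 * k ≤ c.length + 2 * n := by omega
  have hA' : (w1.length : ℚ) + 2 * k ≤ c.length + 2 * n := by exact_mod_cast hA
  have hB' : 2 * (w2.length : ℚ) ≤ 2 * n + c.length := by exact_mod_cast hB
  have h3 : (0 : ℚ) < 3 - γ := by linarith
  by_cases hcase : (w1.length : ℚ) ≤ 4 * n / (3 - γ)
  · exact ⟨r1, w1, hw1, hcase⟩
  · refine ⟨r2, w2, hw2, ?_⟩
    rw [le_div_iff₀ h3] at hcase ⊢
    push Not at hcase
    have hA2 : (w1.length : ℚ) ≤ 2 * n - (1 - γ) * k := by linarith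
    have hB2 : 2 * (w2.length : ℚ) ≤ 2 * n + (1 + γ) * k := by linarith
    -- from A: (1-γ)(3-γ) k < 2n(1-γ)
    have h4 : (3 - γ) * ((1 - γ) * k) < (1 - γ) * (2 * n) := by nlinarith
    have hγ : 0 < 1 - γ := by
      rcases hγ1.lt_or_eq with h | h
      · linarith
      · subst h; norm_num at h4
    have h5 : (3 - γ) * (k : ℚ) < 2 * n := by
      have : (1 - γ) * ((3 - γ) * k) < (1 - γ) * (2 * n) := by linarith
      exact lt_of_mul_lt_mul_left this hγ.le
    nlinarith
end

section
/- Let G be a connected simple graph on n vertices, let 0 ≤ α ≤ 1, and suppose the minimum length OPT of a TSP tour of G satisfies OPT ≥ (1 + α)·n. Let T be a spanning tree of G and suppose there is a closed walk C_T in G whose vertex set contains every vertex of odd degree in T and whose length satisfies ℓ(C_T) ≤ (1 + 4α)·|C_T|/(1 + α), where |C_T| is the number of distinct vertices visited by C_T. Then G has a TSP tour of length at most (4/3)·OPT. -/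
theorem tsp_exists_adj {V : Type*} {H : SimpleGraph V} (hH : H.Connected) (S : Set V)
    (x y : V) (hx : x ∈ S) (hy : y ∉ S) : ∃ a b, a ∈ S ∧ b ∉ S ∧ H.Adj a b := by
  obtain ⟨p⟩ := hH.preconnected x y
  obtain ⟨d, -, h1, h2⟩ := p.exists_boundary_dart S hx hy
  exact ⟨d.fst, d.snd, h1, h2, d.adj⟩

/-- degree mod two of a vertex in a multiset of edges -/
def tspDeg {V : Type*} [DecidableEq V] (M : Multiset (Sym2 V)) (v : V) : ZMod 2 :=
  ((M.countP (fun e => v ∈ e) : ℕ) : ZMod 2)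

theorem tspDeg_add {V : Type*} [DecidableEq V] (M N : Multiset (Sym2 V)) (v : V) :
    tspDeg (M + N) v = tspDeg M v + tspDeg N v := by
  simp [tspDeg, Multiset.countP_add]

theorem tspDeg_cons {V : Type*} [DecidableEq V] (M : Multiset (Sym2 V)) (a b v : V)
    (h : a ≠ b) : tspDeg (s(a, b) ::ₘ M) v =
      (if v = a then 1 else 0) + (if v = b then 1 else 0) + tspDeg M v := by
  unfold tspDeg
  rw [Multiset.countP_cons]
  push_cast
  by_cases h1 : v = a
  · subst h1; simp [h]; ring
  · by_cases h2 : v = b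
    · subst h2; simp [h1]; ring
    · simp [h1, h2]

theorem tspDeg_walk {V : Type*} [DecidableEq V] {G : SimpleGraph V} {a b : V}
    (w : G.Walk a b) (v : V) : tspDeg (w.edges : Multiset (Sym2 V)) v =
      (if v = a then 1 else 0) + (if v = b then 1 else 0) := by
  induction w with
  | nil => simp only [CharTwo.add_self_eq_zero]; simp [tspDeg]
  | @cons a c b h p ih =>
    rw [SimpleGraph.Walk.edges_cons, ← Multiset.cons_coe, tspDeg_cons _ _ _ _ h.ne, ih]
    have := CharTwo.add_self_eq_zero (if v = c then (1 : ZMod 2) else 0)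
    linear_combination this

theorem tsp_euler {V : Type*} [Fintype V] [DecidableEq V] (G H : SimpleGraph V)
    (hH : H.Connected) (hHG : H ≤ G) (M : Multiset (Sym2 V))
    (hMG : ∀ e ∈ M, e ∈ G.edgeSet) (hHM : ∀ e ∈ H.edgeSet, e ∈ M)
    (hM : ∀ v, tspDeg M v = 0) :
    ∃ (r : V) (w : G.Walk r r), (∀ x : V, x ∈ w.support) ∧ w.length ≤ M.card := by
  let P : ℕ → Prop := fun L => ∃ (a b : V) (w : G.Walk a b),
    (w.edges : Multiset (Sym2 V)) ≤ M ∧ w.length = L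
  have hbd : ∀ L, P L → L ≤ M.card := by
    rintro L ⟨a, b, w, hw, rfl⟩
    have := Multiset.card_le_card hw
    simpa using this
  obtain ⟨r0⟩ := hH.nonempty
  have h0 : P 0 := ⟨r0, r0, .nil, by simp, rfl⟩
  classical
  have hg := Nat.findGreatest_spec (P := P) (Nat.zero_le M.card) h0
  have hmax : ∀ L, P L → L ≤ Nat.findGreatest P M.card :=
    fun L hL => Nat.le_findGreatest (hbd L hL) hL
  obtain ⟨a, b, w, hw, hwl⟩ := hg
  rw [← hwl] at hmax
  have hab : a = b := by
    by_contra hne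
    obtain ⟨N, hN⟩ := Multiset.le_iff_exists_add.1 hw
    have hd : tspDeg N b = 1 := by
      have h1 := hM b
      rw [hN, tspDeg_add, tspDeg_walk, if_neg (Ne.symm hne), if_pos rfl] at h1
      have h2 : (2 : ZMod 2) = 0 := rfl
      linear_combination h1 - h2
    have hpos : 0 < N.countP (fun e => b ∈ e) := by
      rcases Nat.eq_zero_or_pos (N.countP (fun e => b ∈ e)) with h | h
      · simp [tspDeg, h] at hd
      · exact h
    obtain ⟨e, heN, hbe⟩ := Multiset.countP_pos.1 hpos
    obtain ⟨z, rfl⟩ := hbe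
    have hadj : G.Adj b z := hMG _ (by rw [hN]; exact Multiset.mem_add.2 (Or.inr heN))
    have := hmax (w.length + 1) ⟨a, z, w.concat hadj, by
      rw [SimpleGraph.Walk.edges_concat, List.concat_eq_append, ← Multiset.coe_add, hN]
      simpa using heN, by simp⟩
    omega
  subst hab
  refine ⟨a, w, ?_, hbd _ ⟨a, a, w, hw, rfl⟩⟩
  by_contra hcon
  push Not at hcon
  obtain ⟨y, hy⟩ := hcon
  obtain ⟨p, q, hp, hq, hpq⟩ := tsp_exists_adj hH {x | x ∈ w.support} a y (by simp) hy
  have hp' : p ∈ w.support := hp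
  have hq' : q ∉ w.support := hq
  have hqp : G.Adj q p := (hHG hpq).symm
  have := hmax (w.length + 1) ⟨q, p, .cons hqp (w.rotate p hp'), by
    have he : ((w.rotate p hp').edges : Multiset (Sym2 V)) = w.edges :=
      Multiset.coe_eq_coe.2 (w.rotate_edges p hp').perm
    rw [SimpleGraph.Walk.edges_cons, ← Multiset.cons_coe, he]
    obtain ⟨N, hN⟩ := Multiset.le_iff_exists_add.1 hw
    have hm : s(q, p) ∈ M := hHM _ hpq.symm
    have hn : s(q, p) ∉ w.edges := fun h => hq' (w.fst_mem_support_of_mem_edges h)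
    rw [hN, Multiset.mem_add] at hm
    have : s(q, p) ∈ N := hm.resolve_left (by simpa using hn)
    rw [hN, ← Multiset.singleton_add, add_comm]
    simpa using this, by simp⟩
  omega

theorem tsp_join {V : Type*} [Fintype V] [DecidableEq V] {G : SimpleGraph V} {a b : V}
    (w : G.Walk a b) : ∀ (f : V → ZMod 2), (∀ v, f v ≠ 0 → v ∈ w.support) → ∑ v, f v = 0 →
    ∃ J K : Multiset (Sym2 V), J + K = w.edges ∧ ∀ v, tspDeg J v = f v := by
  induction w with
  | @nil a =>
    intro f hf hs
    refine ⟨0, 0, by simp, fun v => ?_⟩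
    have hz : ∀ v, v ≠ a → f v = 0 := fun v hv => by
      by_contra h
      exact hv (by simpa using hf v h)
    rw [Finset.sum_eq_single a (fun v _ hv => hz v hv) (by simp)] at hs
    by_cases hv : v = a
    · subst hv; simp [tspDeg, hs]
    · simp [tspDeg, hz v hv]
  | @cons a c b h p ih =>
    intro f hf hs
    by_cases ha : f a = 0
    · obtain ⟨J, K, hJK, hJ⟩ := ih f (fun v hv => by
        have := hf v hv
        rw [SimpleGraph.Walk.support_cons, List.mem_cons] at this
        rcases this with rfl | h'
        · exact absurd ha hv
        · exact h') hs
      exact ⟨J, s(a, c) ::ₘ K, by simp [← Multiset.cons_coe, ← hJK], hJ⟩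
    · have ha1 : f a = 1 := by
        generalize f a = t at *
        revert t; decide
      have h2 : (1 : ZMod 2) + 1 = 0 := rfl
      obtain ⟨J, K, hJK, hJ⟩ := ih
        (fun v => f v + ((if v = a then 1 else 0) + (if v = c then 1 else 0))) (fun v hv => by
        by_cases hvc : v = c
        · subst hvc; simp
        by_cases hva : v = a
        · subst hva
          simp [hvc, ha1, h2] at hv
        have := hf v (by simpa [hvc, hva] using hv)
        simpa [hva] using this) (by
        rw [Finset.sum_add_distrib, Finset.sum_add_distrib, hs]
        simp [h2])
      refine ⟨s(a, c) ::ₘ J, K, by simp [← Multiset.cons_coe, ← hJK], fun v => ?_⟩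
      rw [tspDeg_cons _ _ _ _ h.ne, hJ]
      have h3 := CharTwo.add_self_eq_zero (if v = a then (1 : ZMod 2) else 0)
      have h4 := CharTwo.add_self_eq_zero (if v = c then (1 : ZMod 2) else 0)
      linear_combination h3 + h4

theorem tsp_tree {V : Type*} [Fintype V] [DecidableEq V] (G T : SimpleGraph V)
    (hTG : T ≤ G) (hT : T.IsTree) (u : V) (c : G.Walk u u)
    (hodd : ∀ v : V, Odd (T.neighborSet v).ncard → v ∈ c.support) :
    ∃ (r : V) (w : G.Walk r r), (∀ x : V, x ∈ w.support) ∧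
      2 * w.length ≤ 2 * Fintype.card V + c.length := by
  classical
  have hdeg : ∀ v, tspDeg T.edgeFinset.val v = (T.degree v : ZMod 2) := by
    intro v
    rw [tspDeg, ← SimpleGraph.card_incidenceFinset_eq_degree,
      SimpleGraph.incidenceFinset_eq_filter, Finset.card_def, Finset.filter_val,
      Multiset.countP_eq_card_filter]
  have hcard := hT.card_edgeFinset
  have main : ∀ J : Multiset (Sym2 V), J ≤ c.edges → 2 * J.card ≤ c.length →
      (∀ v, tspDeg J v = (T.degree v : ZMod 2)) → ∃ (r : V) (w : G.Walk r r),
      (∀ x : V, x ∈ w.support) ∧ 2 * w.length ≤ 2 * Fintype.card V + c.length := by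
    intro J hJc hJ hd
    obtain ⟨r, w, h1, h2⟩ := tsp_euler G T hT.connected hTG (T.edgeFinset.val + J)
      (fun e he => by
        rcases Multiset.mem_add.1 he with h | h
        · exact SimpleGraph.edgeSet_mono hTG (by simpa using h)
        · exact c.edges_subset_edgeSet (by simpa using Multiset.mem_of_le hJc h))
      (fun e he => Multiset.mem_add.2 (Or.inl (by simpa using he)))
      (fun v => by rw [tspDeg_add, hdeg, hd, CharTwo.add_self_eq_zero])
    refine ⟨r, w, h1, ?_⟩
    rw [Multiset.card_add, Finset.card_val] at h2
    omega
  obtain ⟨J, K, hJK, hJ⟩ := tsp_join c (fun v => (T.degree v : ZMod 2)) (fun v hv => by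
    apply hodd
    rw [Set.ncard_eq_toFinset_card', ← SimpleGraph.neighborFinset_def,
      SimpleGraph.card_neighborFinset_eq_degree]
    by_contra h
    rw [Nat.not_odd_iff_even] at h
    exact hv ((ZMod.natCast_eq_zero_iff_even).2 h)) (by
    rw [← Nat.cast_sum, T.sum_degrees_eq_twice_card_edges, Nat.cast_mul]
    have h2 : ((2 : ℕ) : ZMod 2) = 0 := rfl
    rw [h2, zero_mul])
  have hK : ∀ v, tspDeg K v = (T.degree v : ZMod 2) := by
    intro v
    have h1 := tspDeg_walk c v
    rw [← hJK, tspDeg_add, hJ, CharTwo.add_self_eq_zero] at h1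
    have h2 := CharTwo.add_self_eq_zero (T.degree v : ZMod 2)
    linear_combination h1 - h2
  have hl : J.card + K.card = c.length := by
    rw [← Multiset.card_add, hJK]; simp
  rcases le_total J.card K.card with h | h
  · exact main J (hJK ▸ Multiset.le_add_right _ _) (by omega) hJ
  · exact main K (hJK ▸ Multiset.le_add_left _ _) (by omega) hK

theorem tsp_extend {V : Type*} [Fintype V] [DecidableEq V] (G : SimpleGraph V)
    (hG : G.Connected) (m : ℕ) : ∀ (u : V) (c : G.Walk u u),
    Fintype.card V ≤ c.support.toFinset.card + m →
    ∃ (r : V) (w : G.Walk r r), (∀ x : V, x ∈ w.support) ∧ w.length ≤ c.length + 2 * m := by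
  induction m with
  | zero =>
    intro u c h
    refine ⟨u, c, fun x => ?_, le_rfl⟩
    have hu := Finset.eq_univ_of_card c.support.toFinset
      (le_antisymm (Finset.card_le_univ _) (by simpa using h))
    have hx : x ∈ c.support.toFinset := by rw [hu]; exact Finset.mem_univ x
    simpa using hx
  | succ m ih =>
    intro u c h
    by_cases hall : ∀ x, x ∈ c.support
    · exact ⟨u, c, hall, by omega⟩
    push Not at hall
    obtain ⟨y, hy⟩ := hall
    obtain ⟨p, q, hp, hq, hpq⟩ := tsp_exists_adj hG {x | x ∈ c.support} u y (by simp) hy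
    have hp' : p ∈ c.support := hp
    have hq' : q ∉ c.support := hq
    let d : G.Walk q q := .cons hpq.symm ((c.rotate p hp').concat hpq)
    have hsub : insert q c.support.toFinset ⊆ d.support.toFinset := by
      intro x hx
      simp only [Finset.mem_insert, List.mem_toFinset] at hx
      simp only [List.mem_toFinset, d, SimpleGraph.Walk.support_cons,
        SimpleGraph.Walk.support_concat, List.mem_cons, List.concat_eq_append, List.mem_append,
        SimpleGraph.Walk.mem_support_rotate_iff]
      tauto
    have hc := Finset.card_le_card hsub
    rw [Finset.card_insert_of_notMem (by simpa using hq')] at hc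
    obtain ⟨r, w, h1, h2⟩ := ih q d (by omega)
    have hd : d.length = c.length + 2 := by simp [d]
    exact ⟨r, w, h1, by omega⟩


/-- Let `G` be a connected simple graph on `n` vertices whose
optimal TSP tour length `OPT` satisfies `OPT ≥ (1 + α)·n` for some `0 ≤ α ≤ 1`.
If `T` is a spanning tree of `G` and there is a closed walk containing all vertices
of odd degree in `T` whose length is at most `(1 + 4α)/(1 + α)` times its number of
distinct vertices, then `G` has a TSP tour of length at most `(4/3)·OPT`. -/
theorem graphTSP_four_thirds_of_LP_bound {V : Type*} [Fintype V] [DecidableEq V]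
    (G : SimpleGraph V) (hG : G.Connected)
    (α : ℚ) (hα0 : 0 ≤ α) (hα1 : α ≤ 1)
    (OPT : ℕ)
    (hOPT : IsLeast {L : ℕ | ∃ (r : V) (w : G.Walk r r),
      (∀ x : V, x ∈ w.support) ∧ w.length = L} OPT)
    (hlow : (1 + α) * (Fintype.card V : ℚ) ≤ (OPT : ℚ))
    (T : SimpleGraph V) (hTG : T ≤ G) (hT : T.IsTree)
    (u : V) (c : G.Walk u u)
    (hodd : ∀ v : V, Odd (T.neighborSet v).ncard → v ∈ c.support)
    (hlen : (c.length : ℚ) ≤ (1 + 4 * α) * (c.support.toFinset.card : ℚ) / (1 + α)) :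
    ∃ (r : V) (w : G.Walk r r), (∀ x : V, x ∈ w.support) ∧
      (w.length : ℚ) ≤ 4 / 3 * (OPT : ℚ) := by

  have hpos : (0 : ℚ) < 1 + α := by linarith
  have hk : c.support.toFinset.card ≤ Fintype.card V := Finset.card_le_univ _
  obtain ⟨r1, w1, hs1, hl1⟩ := tsp_tree G T hTG hT u c hodd
  obtain ⟨r2, w2, hs2, hl2⟩ := tsp_extend G hG
    (Fintype.card V - c.support.toFinset.card) u c (by omega)
  have hl2' : w2.length + 2 * c.support.toFinset.card ≤ c.length + 2 * Fintype.card V := by omega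
  generalize c.support.toFinset.card = k at *
  generalize Fintype.card V = n at *
  rw [le_div_iff₀ hpos] at hlen
  have hl1q : 2 * (w1.length : ℚ) ≤ 2 * n + c.length := by exact_mod_cast hl1
  have hl2q : (w2.length : ℚ) + 2 * k ≤ c.length + 2 * n := by exact_mod_cast hl2'
  have hkq : (k : ℚ) ≤ n := by exact_mod_cast hk
  have hk0 : (0 : ℚ) ≤ k := by positivity
  generalize (c.length : ℚ) = l at *
  generalize (k : ℚ) = k at *
  generalize (n : ℚ) = n at *
  -- threshold
  by_cases hth : 3 * k ≤ 2 * (1 + α) * n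
  · refine ⟨r1, w1, hs1, ?_⟩
    have : (w1.length : ℚ) * (1 + α) ≤ (4 / 3 * ((1 + α) * n)) * (1 + α) := by
      nlinarith [mul_le_mul_of_nonneg_left hth (by linarith : (0:ℚ) ≤ 1 + 4 * α)]
    have := le_of_mul_le_mul_right this hpos
    linarith
  · push Not at hth
    refine ⟨r2, w2, hs2, ?_⟩
    have hα : α ≤ 1 / 2 := by
      by_contra h
      push Not at h
      nlinarith
    have : (w2.length : ℚ) * (1 + α) ≤ (4 / 3 * ((1 + α) * n)) * (1 + α) := by
      nlinarith [mul_le_mul_of_nonneg_left hth.le (by linarith : (0:ℚ) ≤ 1 - 2 * α)]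
    have := le_of_mul_le_mul_right this hpos
    linarith
end
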